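/- arXiv:2507.15665 — 3 statements merged into one kernel-verified Lean document; each statement's English description precedes it below -/
import Mathlib

section
/- For every positive integer n, the determinant of the n×n matrix whose (i,j)-entry (0 ≤ i,j ≤ n−1) is 3^{j}·binom(3i+j+1, 3i+1) + binom(3i−j+1, 3i+1) equals 2·2^{n(n−3)/2}·3^{−n} times the product over i = 1 to n of Γ(4i−1)·Γ(i/3) / (Γ(3i−1)·Γ(4i/3)). (Here 2^{n(n−3)/2} is the real power with integer exponent n(n−3)/2, which may be negative.) -/
open scoped BigOperators

/-- Generalized binomial coefficient: `binom α p = α(α−1)⋯(α−p+1)/p!`. -/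
noncomputable def binom (α : ℤ) (p : ℕ) : ℝ :=
  (∏ k ∈ Finset.range p, ((α : ℝ) - (k : ℝ))) / (p.factorial : ℝ)

section

open PowerSeries

theorem PowerSeries.exists_derivative_eq_mul {k : Type*} [Field k] [CharZero k] (p : k⟦X⟧) :
    ∃ E : k⟦X⟧, constantCoeff E = 1 ∧ d⁄dX k E = p * E := by
  let P : k⟦X⟧ := PowerSeries.mk fun n => coeff (n - 1) p / n
  have hP0 : constantCoeff P = 0 := by
    rw [← coeff_zero_eq_constantCoeff_apply]; simp [P]
  have hs : HasSubst P := HasSubst.of_constantCoeff_zero' hP0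
  have hP : d⁄dX k P = p := by
    ext n
    have : (n : k) + 1 ≠ 0 := by exact_mod_cast Nat.succ_ne_zero n
    simp [P, coeff_derivative]
    field_simp
  refine ⟨(PowerSeries.exp k).subst P, ?_, ?_⟩
  · have h : constantCoeff (subst P (PowerSeries.exp k - 1)) = 0 :=
      constantCoeff_subst_eq_zero hP0 _ (by simp)
    rw [← coe_substAlgHom hs, map_sub, map_one, map_sub, map_one, sub_eq_zero] at h
    rwa [← coe_substAlgHom hs]
  · rw [derivative_subst hs, derivative_exp, hP, mul_comm]

/-- Triangular coordinates diagonalising the operator `f ↦ c X (df/dX) + e f`, in which multiplication by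
`u` is a shift. -/
theorem PowerSeries.exists_coordinates {k : Type*} [Field k] [CharZero k] {c e u : k⟦X⟧}
    (hc : constantCoeff c = 1) (he : constantCoeff e = 0) (hu0 : constantCoeff u = 0)
    (hcu : c * (X * d⁄dX k u) = u) (hu1 : coeff 1 u = 1) :
    ∃ l : ℕ → k⟦X⟧ →ₗ[k] k,
      (∀ j f, l j (c * (X * d⁄dX k f) + e * f) = j * l j f) ∧
      (∀ j f, l (j + 1) (u * f) = l j f) ∧
      (∀ j, l j (X ^ j) = 1) ∧
      (∀ j f, X ^ (j + 1) ∣ f → l j f = 0) := by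
  obtain ⟨e, rfl⟩ := X_dvd_iff.mpr he
  obtain ⟨t, rfl⟩ := X_dvd_iff.mpr hu0
  have ht : constantCoeff t = 1 := by
    simpa [coeff_succ_X_mul] using hu1
  have hcc : c * c⁻¹ = 1 := PowerSeries.mul_inv_cancel c (by simp [hc])
  have htt : t * t⁻¹ = 1 := PowerSeries.mul_inv_cancel t (by simp [ht])
  obtain ⟨E, hE0, hE⟩ := exists_derivative_eq_mul (c⁻¹ * e)
  obtain ⟨W, rfl⟩ : ∃ W, t⁻¹ = W := ⟨_, rfl⟩
  have hW : d⁄dX k t⁻¹ = - t⁻¹ ^ 2 * d⁄dX k t := derivative_inv' t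
  have hW0 : constantCoeff t⁻¹ = 1 := by simp [ht]
  generalize hWd : t⁻¹ = W at *
  generalize hid : c⁻¹ = ic at *
  have hX : (X : k⟦X⟧) ≠ 0 := X_ne_zero
  simp only [Derivation.leibniz, smul_eq_mul, derivative_X, mul_one] at hcu ⊢
  have hcu' : c * (X * d⁄dX k t + t) = t := by
    apply mul_left_cancel₀ hX
    linear_combination hcu
  set v := X * d⁄dX k t + t with hv
  refine ⟨fun j => (coeff j).comp (LinearMap.mulRight k (E * W ^ (j + 1) * v)), ?_, ?_, ?_, ?_⟩
  · intro j f
    simp only [LinearMap.comp_apply, LinearMap.mulRight_apply]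
    have key : (c * (X * d⁄dX k f) + X * e * f) * (E * W ^ (j + 1) * v)
        = X * d⁄dX k (f * E * W ^ j) + (j : k⟦X⟧) * (X * (f * E * W ^ (j + 1) * d⁄dX k t)) := by
      have h1 : (c * (X * d⁄dX k f) + X * e * f) * (E * W ^ (j + 1) * v)
          = X * (d⁄dX k f * E + f * d⁄dX k E) * W ^ j := by
        rw [hE]
        have h2 : v = ic * t := by linear_combination ic * hcu' - v * hcc
        rw [h2]
        linear_combination (X * d⁄dX k f * E * W ^ j * t * W) * hcc
          + (X * d⁄dX k f * E * W ^ j + X * e * f * E * ic * W ^ j) * htt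
      rw [h1]
      rcases j with _ | j
      · simp [Derivation.leibniz]; ring
      · simp only [Derivation.leibniz, smul_eq_mul, Derivation.leibniz_pow, hW, nsmul_eq_mul]
        simp only [Nat.add_sub_cancel]
        push_cast
        ring
    rw [key]
    have h3 : f * (E * W ^ (j + 1) * v) = X * (f * E * W ^ (j + 1) * d⁄dX k t) + f * E * W ^ j := by
      rw [hv]; linear_combination (f * E * W ^ j) * htt
    rw [h3]
    have h4 : coeff j (X * d⁄dX k (f * E * W ^ j)) = j * coeff j (f * E * W ^ j) := by
      rcases j with _ | j
      · simp
      · rw [coeff_succ_X_mul, coeff_derivative]; push_cast; ring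
    have h5 : ∀ g : k⟦X⟧, coeff j ((j : k⟦X⟧) * g) = j * coeff j g := by
      intro g
      rw [← nsmul_eq_mul, map_nsmul, nsmul_eq_mul]
    rw [map_add, map_add, h4, h5]
    ring
  · intro j f
    simp only [LinearMap.comp_apply, LinearMap.mulRight_apply]
    rw [show X * t * f * (E * W ^ (j + 1 + 1) * v) = X * (f * (E * W ^ (j + 1) * v)) by
      linear_combination (X * f * E * W ^ (j + 1) * v) * htt, coeff_succ_X_mul]
  · intro j
    simp only [LinearMap.comp_apply, LinearMap.mulRight_apply]
    rw [coeff_X_pow_mul']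
    simp [hE0, hW0, hv, ht]
  · rintro j _ ⟨f, rfl⟩
    simp only [LinearMap.comp_apply, LinearMap.mulRight_apply]
    rw [mul_assoc, coeff_X_pow_mul']
    simp

theorem PowerSeries.eq_sum_coeff_mul {k : Type*} [Field k] {l : k⟦X⟧ →ₗ[k] k} {j n : ℕ}
    (hl : ∀ f, X ^ (j + 1) ∣ f → l f = 0) (hj : j < n) (f : k⟦X⟧) :
    l f = ∑ m : Fin n, coeff (m : ℕ) f * l (X ^ (m : ℕ)) := by
  have h : X ^ (j + 1) ∣ f - ∑ m : Fin n, coeff (m : ℕ) f • (X : k⟦X⟧) ^ (m : ℕ) := by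
    rw [X_pow_dvd_iff]
    intro i hi
    rw [map_sub, map_sum]
    simp only [map_smul, coeff_X_pow, smul_eq_mul, mul_ite, mul_one, mul_zero]
    rw [Finset.sum_eq_single (⟨i, by omega⟩ : Fin n)]
    · simp
    · intro b _ hb
      rw [if_neg]
      intro h
      exact hb (Fin.ext h.symm)
    · simp
  have h2 := hl _ h
  rw [map_sub, sub_eq_zero] at h2
  rw [h2, map_sum]
  simp

theorem Matrix.det_coeff_eq_det_coordinates {k : Type*} [Field k] (n : ℕ)
    {lx ly : ℕ → k⟦X⟧ →ₗ[k] k}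
    (hx1 : ∀ j, lx j (X ^ j) = 1) (hx : ∀ j f, X ^ (j + 1) ∣ f → lx j f = 0)
    (hy1 : ∀ j, ly j (X ^ j) = 1) (hy : ∀ j f, X ^ (j + 1) ∣ f → ly j f = 0) (f : ℕ → k⟦X⟧) :
    (Matrix.of fun i j : Fin n => coeff (j : ℕ) (f i)).det =
      (Matrix.of fun i j : Fin n => ly i (PowerSeries.mk fun m => lx j (f m))).det := by
  let A : Matrix (Fin n) (Fin n) k := Matrix.of fun i m => ly i (X ^ (m : ℕ))
  let B : Matrix (Fin n) (Fin n) k := Matrix.of fun m j => lx j (X ^ (m : ℕ))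
  have hA : A.det = 1 := by
    rw [Matrix.det_of_isLowerTriangular]
    · simp [A, hy1]
    · intro i j hij
      exact hy _ _ (pow_dvd_pow _ (by simpa using hij))
  have hB : B.det = 1 := by
    rw [Matrix.det_of_isUpperTriangular]
    · simp [B, hx1]
    · intro i j hij
      exact hx _ _ (pow_dvd_pow _ (by simpa using hij))
  have h : (Matrix.of fun i j : Fin n => ly i (PowerSeries.mk fun m => lx j (f m))) =
      A * ((Matrix.of fun i j : Fin n => coeff (j : ℕ) (f i)) * B) := by
    ext i j
    rw [Matrix.of_apply, eq_sum_coeff_mul (hy i) i.2, Matrix.mul_apply]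
    refine Finset.sum_congr rfl fun m _ => ?_
    rw [coeff_mk, eq_sum_coeff_mul (hx j) j.2, Matrix.mul_apply, mul_comm]
    rfl
  rw [h, Matrix.det_mul, Matrix.det_mul, hA, hB]
  ring

theorem Matrix.det_cauchy_succ {k : Type*} [Field k] (n : ℕ) (x y : ℕ → k)
    (h : ∀ i j, x i + y j ≠ 0) :
    (Matrix.of fun i j : Fin (n + 1) => 1 / (x i + y j)).det =
      1 / (x n + y n) * (∏ i ∈ Finset.range n,
        ((x n - x i) * (y n - y i) / ((x i + y n) * (x n + y i)))) *
      (Matrix.of fun i j : Fin n => 1 / (x i + y j)).det := by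
  let A : Matrix (Fin n) (Fin n) k := Matrix.of fun i j => 1 / (x i + y j)
  let B : Matrix (Fin n) (Fin 1) k := Matrix.of fun i _ => 1 / (x i + y n)
  let C : Matrix (Fin 1) (Fin n) k := Matrix.of fun _ j => 1 / (x n + y j)
  let D : Matrix (Fin 1) (Fin 1) k := Matrix.of fun _ _ => 1 / (x n + y n)
  let D' : Matrix (Fin 1) (Fin 1) k := Matrix.of fun _ _ => (x n + y n)
  let : Invertible D := ⟨D',
    by ext i j; fin_cases i; fin_cases j; simp [D, D', Matrix.mul_apply, h],
    by ext i j; fin_cases i; fin_cases j; simp [D, D', Matrix.mul_apply, h]⟩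
  have e : (Matrix.of fun i j : Fin (n + 1) => 1 / (x i + y j)) =
      Matrix.reindex finSumFinEquiv finSumFinEquiv (Matrix.fromBlocks A B C D) := by
    ext i j
    refine Fin.lastCases ?_ (fun i => ?_) i <;> refine Fin.lastCases ?_ (fun j => ?_) j <;>
      simp [A, B, C, D, finSumFinEquiv, Fin.addCases, Fin.castSucc, Fin.last]
  rw [e, Matrix.det_reindex_self, Matrix.det_fromBlocks₂₂]
  have hs : A - B * ⅟D * C = Matrix.of fun i j : Fin n =>
      ((x n - x i) / (x i + y n)) * ((y n - y j) / (x n + y j) * (1 / (x i + y j))) := by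
    ext i j
    have : ⅟D = D' := rfl
    rw [this]
    simp [A, B, C, D', Matrix.mul_apply]
    have h1 := h i j
    have h2 := h n j
    have h3 := h i n
    field_simp
    ring
  rw [hs]
  have := Matrix.det_mul_column (fun i : Fin n => (x n - x i) / (x i + y n))
    (Matrix.of fun i j : Fin n => ((y n - y j) / (x n + y j) * (1 / (x i + y j))))
  simp only [Matrix.of_apply] at this
  rw [this]
  have := Matrix.det_mul_row (fun j : Fin n => (y n - y j) / (x n + y j))
    (Matrix.of fun i j : Fin n => (1 / (x i + y j)))
  simp only [Matrix.of_apply] at this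
  have hD : D.det = 1 / (x n + y n) := by rw [Matrix.det_fin_one]; rfl
  rw [this, hD, Finset.prod_range]
  simp only [← div_mul_div_comm, Finset.prod_mul_distrib, mul_assoc]

end

namespace BinomDet

open PowerSeries

theorem eq_of_algebraMap_eq {f g : ℝ⟦X⟧}
    (h : algebraMap ℝ⟦X⟧ (FractionRing ℝ⟦X⟧) f = algebraMap ℝ⟦X⟧ (FractionRing ℝ⟦X⟧) g) : f = g :=
  IsFractionRing.injective _ _ h

theorem algebraMap_of_mul_eq_one {v w : ℝ⟦X⟧} (h : v * w = 1) :
    algebraMap ℝ⟦X⟧ (FractionRing ℝ⟦X⟧) w ≠ 0 ∧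
      algebraMap ℝ⟦X⟧ (FractionRing ℝ⟦X⟧) v = 1 / algebraMap ℝ⟦X⟧ (FractionRing ℝ⟦X⟧) w := by
  have h1 := congrArg (algebraMap ℝ⟦X⟧ (FractionRing ℝ⟦X⟧)) h
  rw [map_mul, map_one] at h1
  exact ⟨right_ne_zero_of_mul_eq_one h1, eq_one_div_of_mul_eq_one_left h1⟩

theorem charZero_fractionRing : CharZero (FractionRing ℝ⟦X⟧) :=
  have : CharZero ℝ⟦X⟧ := charZero_of_injective_algebraMap (algebraMap ℝ ℝ⟦X⟧).injective
  charZero_of_injective_algebraMap (IsFractionRing.injective ℝ⟦X⟧ _)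

theorem derivative_ofNat (n : ℕ) [n.AtLeastTwo] :
    d⁄dX ℝ (ofNat(n) : ℝ⟦X⟧) = 0 :=
  Derivation.map_natCast _ n

/-- Coordinates in which the three-term recurrence in the row index becomes diagonal. -/
theorem exists_row_coordinates :
    ∃ (l : ℕ → ℝ⟦X⟧ →ₗ[ℝ] ℝ) (α : ℕ → ℝ),
      (∀ i, l i (X ^ i) = 1) ∧ (∀ i f, X ^ (i + 1) ∣ f → l i f = 0) ∧ α 0 = 1 ∧
      (∀ i : ℕ, (6 * i + 8) * (6 * i + 6) * (6 * i + 4) * α (i + 1) =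
        -8 * ((6 * i + 7) * (6 * i + 5) * (6 * i + 3)) * α i) ∧
      ∀ (φ : ℕ → ℝ) (t β : ℝ), (8 * t - 4) * φ 0 = 8 * β →
        (8 * t - 28) * φ 1 + (20 * t + 29) * φ 0 = -2 * β →
        (∀ m : ℕ, (8 * t - (24 * m + 52)) * φ (m + 2) + (20 * t + (21 * m + 50)) * φ (m + 1)
          + (-t + (3 * m + 2)) * φ m = 0) →
        ∀ i : ℕ, (t - 3 * i - 1 / 2) * l i (PowerSeries.mk φ) = α i * β := by
  obtain ⟨r, hr⟩ : ∃ r : ℝ⟦X⟧, r = (1 - X)⁻¹ := ⟨_, rfl⟩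
  obtain ⟨q, hq⟩ : ∃ q : ℝ⟦X⟧, q = (16 + 40 * X - 2 * X ^ 2)⁻¹ := ⟨_, rfl⟩
  obtain ⟨s, hs⟩ : ∃ s : ℝ⟦X⟧, s = (8 + X)⁻¹ := ⟨_, rfl⟩
  have hr1 : r * (1 - X) = 1 := by
    rw [hr]; exact PowerSeries.inv_mul_cancel _ (by simp)
  have hq1 : q * (16 + 40 * X - 2 * X ^ 2) = 1 := by
    rw [hq]; exact PowerSeries.inv_mul_cancel _ (by simp [map_ofNat constantCoeff])
  have hs1 : s * (8 + X) = 1 := by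
    rw [hs]; exact PowerSeries.inv_mul_cancel _ (by simp [map_ofNat constantCoeff])
  have dr : d⁄dX ℝ r = r ^ 2 := by
    rw [hr, derivative_inv']; simp
  have dq : d⁄dX ℝ q = - q ^ 2 * (40 - 4 * X) := by
    rw [hq, derivative_inv']
    simp [Derivation.leibniz, Derivation.leibniz_pow, derivative_ofNat]
    left; ring
  have ds : d⁄dX ℝ s = - s ^ 2 := by
    rw [hs, derivative_inv']; simp [derivative_ofNat]
  have q0 : constantCoeff q = 1 / 16 := by
    simp [hq, map_ofNat constantCoeff]
  have r0 : constantCoeff r = 1 := by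
    simp [hr]
  have hC : (C (1 / 512 : ℝ) : ℝ⟦X⟧) * 512 = 1 := by
    rw [show (512 : ℝ⟦X⟧) = C 512 from rfl, ← map_mul]; norm_num
  have dC : d⁄dX ℝ (C (1 / 512 : ℝ) : ℝ⟦X⟧) = 0 := by simp
  have C0 : constantCoeff (C (1 / 512 : ℝ) : ℝ⟦X⟧) = 1 / 512 := by simp
  generalize hh : (C (1 / 512 : ℝ) : ℝ⟦X⟧) = h at hC dC C0
  clear hh hr hq hs
  have key : ∀ f g : ℝ⟦X⟧, (∀ (K : Type) [Field K] [CharZero K] (σ : ℝ⟦X⟧ →+* K) (y v : K),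
      v = 8 + 20 * y - y ^ 2 →
      y ≠ 0 → 1 - y ≠ 0 → v ≠ 0 → 8 + y ≠ 0 → σ X = y →
      σ r = 1 / (1 - y) →
      σ q = 1 / (2 * v) → σ s = 1 / (8 + y) → σ h = 1 / 512 → σ f = σ g) →
      f = g := by
    intro f g H
    have := charZero_fractionRing
    obtain ⟨r2, r3⟩ := algebraMap_of_mul_eq_one hr1
    obtain ⟨q2, q3⟩ := algebraMap_of_mul_eq_one hq1
    obtain ⟨s2, s3⟩ := algebraMap_of_mul_eq_one hs1
    obtain ⟨h2, h3⟩ := algebraMap_of_mul_eq_one hC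
    simp only [map_sub, map_add, map_mul, map_pow, map_one, map_ofNat] at r2 r3 q2 q3 s2 s3 h2 h3
    rw [show ∀ y : FractionRing ℝ⟦X⟧, 16 + 40 * y - 2 * y ^ 2 = 2 * (8 + 20 * y - y ^ 2) from
      fun y => by ring] at q2 q3
    exact eq_of_algebraMap_eq (H _ (algebraMap _ _) _ _ rfl (by simp) r2
      (right_ne_zero_of_mul q2) s2 rfl r3 q3 s3 h3)
  obtain ⟨l, l1, l2, l4, l5⟩ := exists_coordinates
    (c := 2 * (1 - X) * (8 + X) * q) (e := - X * (X + 26) * q) (u := h * X * (8 + X) ^ 3 * r ^ 3)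
    (by simp [map_ofNat constantCoeff, q0]; norm_num) (by simp) (by simp)
    (by
      apply key
      intro K _ _ σ y v hv h1 h2 h3 h4 h5 h6 h7 h8 h9
      simp only [Derivation.leibniz, Derivation.leibniz_pow, derivative_ofNat, smul_eq_mul, dr, dC,
        map_sub, map_add, map_mul, map_pow, map_one, map_ofNat, derivative_X, nsmul_eq_mul,
        map_zero, h5, h6, h7, h9, Nat.cast_ofNat, Nat.reduceSub]
      field_simp
      rw [hv]
      ring)
    (by
      rw [show h * X * (8 + X) ^ 3 * r ^ 3 = X * (h * (8 + X) ^ 3 * r ^ 3) by ring,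
        show (1 : ℕ) = 0 + 1 from rfl, coeff_succ_X_mul, coeff_zero_eq_constantCoeff_apply]
      simp [map_ofNat constantCoeff, r0, C0]; norm_num)
  let X0 : ℝ⟦X⟧ := - (8 + X) * (2 + X) * r * (2 * q)
  let X1 : ℝ⟦X⟧ := - 4 * (4 - X) * q
  let X2 : ℝ⟦X⟧ := - 48 * (1 - X) * (2 * q) * s
  let d : ℝ⟦X⟧ → ℝ⟦X⟧ := fun f =>
    2 * (1 - X) * (8 + X) * q * (X * d⁄dX ℝ f) + - X * (X + 26) * q * f
  have ld : ∀ i f, l i (d f) = i * l i f := l1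
  have e1 : (6 : ℝ) • d X1 + (2 : ℝ) • X1 = (6 : ℝ) • d X0 + X0 := by
    apply key
    intro K _ _ σ y v hv h1 h2 h3 h4 h5 h6 h7 h8 h9
    simp only [Derivation.leibniz, derivative_ofNat, smul_eq_mul, dr, map_sub, map_add, map_mul,
      map_pow, map_one, map_ofNat, derivative_X, nsmul_eq_mul, ofNat_smul_eq_nsmul, d, X0, X1,
      map_neg, dq, map_zero, h5, h6, h7, Nat.cast_ofNat]
    field_simp
    rw [hv]
    ring
  have e2 : (6 : ℝ) • d X2 + (4 : ℝ) • X2 = (6 : ℝ) • d X1 + (3 : ℝ) • X1 := by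
    apply key
    intro K _ _ σ y v hv h1 h2 h3 h4 h5 h6 h7 h8 h9
    simp only [Derivation.leibniz, derivative_ofNat, smul_eq_mul, ds, Derivation.map_one_eq_zero,
      map_sub, map_add, map_mul, map_pow, map_one, map_ofNat, derivative_X, nsmul_eq_mul,
      ofNat_smul_eq_nsmul, d, X2, X1, map_neg, dq, map_zero, h5, h7, h8, Nat.cast_ofNat]
    field_simp
    rw [hv]
    ring
  have e3 : (6 : ℝ) • d X0 =
      (-8 : ℝ) • ((h * X * (8 + X) ^ 3 * r ^ 3) * ((6 : ℝ) • d X2 + (5 : ℝ) • X2)) := by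
    rw [neg_smul]
    apply key
    intro K _ _ σ y v hv h1 h2 h3 h4 h5 h6 h7 h8 h9
    simp only [Derivation.leibniz, derivative_ofNat, smul_eq_mul, dr, ds,
      Derivation.map_one_eq_zero, map_sub, map_add, map_mul, map_pow, map_one, map_ofNat,
      derivative_X, nsmul_eq_mul, ofNat_smul_eq_nsmul, d, X2, X0, map_neg, dq, map_zero, h5, h6, h7,
      h8, h9, Nat.cast_ofNat]
    field_simp
    rw [hv]
    ring
  refine ⟨l, fun i => - l i X1, l4, l5, ?_, ?_, ?_⟩
  · have h0 : l 0 X1 = l 0 (X ^ 0) * (-1) := by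
      have : X ^ (0 + 1) ∣ X1 + X ^ 0 := by
        rw [pow_one, X_dvd_iff]
        simp [X1, map_ofNat constantCoeff, q0]
        norm_num
      have := l5 0 _ this
      rw [map_add] at this
      linear_combination this
    change - l 0 X1 = 1
    rw [h0, l4]
    norm_num
  · intro i
    have a1 := congrArg (l (i + 1)) e1
    have a2 := congrArg (l i) e2
    have a3 := congrArg (l (i + 1)) e3
    simp only [map_add, map_smul, ld, smul_eq_mul, l2] at a1 a2 a3
    push_cast at a1 a3
    linear_combination (-(6 * i + 6) * (6 * i + 4)) * a1 - (6 * i + 7) * (6 * i + 4) * a3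
      + 8 * (6 * i + 7) * (6 * i + 5) * a2
  · intro φ t β b0 b1 b2 i
    have e4 : t • PowerSeries.mk φ - (3 : ℝ) • d (PowerSeries.mk φ) - (1 / 2 : ℝ) • PowerSeries.mk φ
        = - β • X1 := by
      set Φ := PowerSeries.mk φ
      set G := X * d⁄dX ℝ Φ with hG
      have hc : ∀ m, coeff m G = m * φ m := by
        rintro (_ | m)
        · simp [G]
        · rw [hG, coeff_succ_X_mul, coeff_derivative, coeff_mk]
          push_cast
          ring
      have hc0 : constantCoeff G = 0 := by simp [G]
      have e5 : (16 * t - 8) • Φ - (48 : ℝ) • G + X * ((40 * t + 58) • Φ + (42 : ℝ) • G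
          + X * ((-2 * t + 4) • Φ + (6 : ℝ) • G)) = C (16 * β) + X * C (-4 * β) := by
        ext m
        rcases m with _ | _ | m
        · simp [hc0, Φ]
          linear_combination 2 * b0
        · simp [hc, hc0, Φ, coeff_succ_X_mul]
          linear_combination 2 * b1
        · simp [hc, Φ, coeff_succ_X_mul]
          linear_combination 2 * b2 m
      simp only [smul_eq_C_mul, map_mul, map_add, map_sub, map_neg, map_ofNat] at e5 ⊢
      have e6 : (C (1 / 2 : ℝ) : ℝ⟦X⟧) * 2 = 1 := by
        rw [show (2 : ℝ⟦X⟧) = C 2 from rfl, ← map_mul]; norm_num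
      simp only [d, X1, ← hG]
      linear_combination q * e5 - (C t - C (1 / 2)) * Φ * hq1
        - Φ * q * (8 + 20 * X - X ^ 2) * e6
    have a4 := congrArg (l i) e4
    simp only [map_sub, map_smul, ld, smul_eq_mul] at a4
    linear_combination a4

theorem power_recurrence {t κ c e : ℝ⟦X⟧} (hκ : κ * (1 - 20 * t ^ 3 - 8 * t ^ 6) = 1)
    (hc : c * (X * d⁄dX ℝ t) = t * (1 - t ^ 3) * (1 + 8 * t ^ 3) * κ)
    (he : e = 96 * t ^ 3 * (1 - t ^ 3) ^ 3 * κ ^ 2) (m : ℕ) :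
    8 * (c * (X * d⁄dX ℝ (t ^ (3 * (m + 2) + 2))) + e * t ^ (3 * (m + 2) + 2))
      + 20 * (c * (X * d⁄dX ℝ (t ^ (3 * (m + 1) + 2))) + e * t ^ (3 * (m + 1) + 2))
      - (c * (X * d⁄dX ℝ (t ^ (3 * m + 2))) + e * t ^ (3 * m + 2))
      = (24 * (m : ℝ⟦X⟧) + 52) * t ^ (3 * (m + 2) + 2)
        - (21 * (m : ℝ⟦X⟧) + 50) * t ^ (3 * (m + 1) + 2)
        - (3 * (m : ℝ⟦X⟧) + 2) * t ^ (3 * m + 2) := by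
  have hp : ∀ n : ℕ, c * (X * d⁄dX ℝ (t ^ (n + 1))) =
      ((n : ℝ⟦X⟧) + 1) * t ^ (n + 1) * ((1 - t ^ 3) * (1 + 8 * t ^ 3) * κ) := by
    intro n
    rw [Derivation.leibniz_pow, nsmul_eq_mul, smul_eq_mul, Nat.add_sub_cancel]
    push_cast
    linear_combination ((n : ℝ⟦X⟧) + 1) * t ^ n * hc
  rw [hp, hp, hp, he]
  push_cast
  linear_combination t ^ (3 * m + 2) * (- (3 * (m : ℝ⟦X⟧) + 2) * (1 - t ^ 3) * (1 + 8 * t ^ 3)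
    - 96 * t ^ 3 * (1 - t ^ 3) ^ 3 * κ - 36 * t ^ 3 * (1 - t ^ 3)) * hκ

/-- The generating function of the rows of the matrix, with its constant coefficient halved. -/
noncomputable def rowSeries (m : ℕ) : ℝ⟦X⟧ :=
  ((1 - 3 * X)⁻¹) ^ (3 * m + 2) - (- X * (1 - X)⁻¹) ^ (3 * m + 2)

/-- Coordinates diagonalising the column operator for which the row series satisfy a three-term
recurrence. -/
theorem exists_column_coordinates :
    ∃ (l : ℕ → ℝ⟦X⟧ →ₗ[ℝ] ℝ) (β : ℕ → ℝ),
      (∀ j, l j (X ^ j) = 1) ∧ (∀ j f, X ^ (j + 1) ∣ f → l j f = 0) ∧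
      β 0 = - 1 / 2 ∧ β 1 = 3 ∧ β 2 = 30 ∧
      (∀ j : ℕ, (j + 1) * (j + 2) * (j + 3) * β (j + 3) =
        -8 * ((2 * j + 3) * (2 * j + 5) * (2 * j + 7)) * β j) ∧
      ∀ j : ℕ, (8 * (j : ℝ) - 4) * l j (rowSeries 0) = 8 * β j ∧
        (8 * (j : ℝ) - 28) * l j (rowSeries 1) + (20 * j + 29) * l j (rowSeries 0) = -2 * β j ∧
        ∀ m : ℕ, (8 * (j : ℝ) - (24 * m + 52)) * l j (rowSeries (m + 2))
          + (20 * j + (21 * m + 50)) * l j (rowSeries (m + 1))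
          + (-j + (3 * m + 2)) * l j (rowSeries m) = 0 := by
  obtain ⟨w, hw⟩ : ∃ w : ℝ⟦X⟧, w = (1 - X)⁻¹ := ⟨_, rfl⟩
  obtain ⟨b, hb⟩ : ∃ b : ℝ⟦X⟧, b = - X * w := ⟨_, rfl⟩
  obtain ⟨a, ha⟩ : ∃ a : ℝ⟦X⟧, a = (1 - 3 * X)⁻¹ := ⟨_, rfl⟩
  obtain ⟨p, hp⟩ : ∃ p : ℝ⟦X⟧, p = (1 + 8 * b ^ 3)⁻¹ := ⟨_, rfl⟩
  obtain ⟨q, hq⟩ : ∃ q : ℝ⟦X⟧, q = (1 - 20 * b ^ 3 - 8 * b ^ 6)⁻¹ := ⟨_, rfl⟩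
  have hrow : ∀ m, rowSeries m = a ^ (3 * m + 2) - b ^ (3 * m + 2) := by
    intro m; rw [rowSeries, ha, hb, hw]
  have b0 : constantCoeff b = 0 := by simp [hb]
  have w0 : constantCoeff w = 1 := by simp [hw]
  have hw1 : w * (1 - X) = 1 := by
    rw [hw]; exact PowerSeries.inv_mul_cancel _ (by simp)
  have ha1 : a * (1 - 3 * X) = 1 := by
    rw [ha]; exact PowerSeries.inv_mul_cancel _ (by simp)
  have hp1 : p * (1 + 8 * b ^ 3) = 1 := by
    rw [hp]; exact PowerSeries.inv_mul_cancel _ (by simp [b0])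
  have hq1 : q * (1 - 20 * b ^ 3 - 8 * b ^ 6) = 1 := by
    rw [hq]; exact PowerSeries.inv_mul_cancel _ (by simp [b0])
  have p0 : constantCoeff p = 1 := by simp [hp, b0]
  have q0 : constantCoeff q = 1 := by simp [hq, b0]
  have hwb : w = 1 - b := by rw [hb]; linear_combination hw1
  have hXb : w * X = - b := by rw [hb]; ring
  have hab : a * (1 + 2 * b) = 1 - b := by
    rw [hb]; linear_combination w * ha1 + (1 - a) * hw1
  have db : d⁄dX ℝ b = - (1 - b) ^ 2 := by
    have : b = 1 - w := by rw [hwb]; ring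
    rw [← hwb, this, map_sub, Derivation.map_one_eq_zero, hw, derivative_inv']; simp
  have da : d⁄dX ℝ a = 3 * a ^ 2 := by
    rw [ha, derivative_inv']
    simp [Derivation.leibniz, derivative_ofNat]
    ring
  have dp : d⁄dX ℝ p = p ^ 2 * (24 * b ^ 2 * (1 - b) ^ 2) := by
    rw [hp, derivative_inv', ← hp]
    simp only [map_add, Derivation.leibniz, Derivation.leibniz_pow, derivative_ofNat, smul_eq_mul,
      nsmul_eq_mul, Derivation.map_one_eq_zero, db, Nat.reduceSub, Nat.cast_ofNat]
    ring
  have hC : (C (1 / 27 : ℝ) : ℝ⟦X⟧) * 27 = 1 := by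
    rw [show (27 : ℝ⟦X⟧) = C 27 from rfl, ← map_mul]; norm_num
  generalize (C (1 / 27 : ℝ) : ℝ⟦X⟧) = h at hC
  have key : ∀ f g : ℝ⟦X⟧, (∀ (K : Type) [Field K] [CharZero K] (σ : ℝ⟦X⟧ →+* K) (y s u v : K),
      s = 1 + 2 * y → u = 1 + 8 * y ^ 3 → v = 1 - 20 * y ^ 3 - 8 * y ^ 6 →
      1 - y ≠ 0 → s ≠ 0 → u ≠ 0 → v ≠ 0 → σ b = y → σ X = - y / (1 - y) →
      σ a = (1 - y) / s → σ p = 1 / u → σ q = 1 / v → σ h = 1 / 27 → σ f = σ g) →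
      f = g := by
    intro f g H
    have := charZero_fractionRing
    have hw2 := (algebraMap_of_mul_eq_one (v := 1 - X) (w := 1 - b)
      (by rw [← hwb, mul_comm, hw1])).1
    obtain ⟨p2, p3⟩ := algebraMap_of_mul_eq_one hp1
    obtain ⟨q2, q3⟩ := algebraMap_of_mul_eq_one hq1
    obtain ⟨h2, h3⟩ := algebraMap_of_mul_eq_one hC
    have ha2 := congrArg (algebraMap ℝ⟦X⟧ (FractionRing ℝ⟦X⟧)) hab
    have hX2 := congrArg (algebraMap ℝ⟦X⟧ (FractionRing ℝ⟦X⟧)) hXb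
    rw [hwb] at hX2
    simp only [map_sub, map_add, map_mul, map_pow, map_one, map_ofNat, map_neg]
      at p2 p3 q2 q3 h2 h3 hw2 ha2 hX2
    have hb2 : 1 + 2 * algebraMap ℝ⟦X⟧ (FractionRing ℝ⟦X⟧) b ≠ 0 := by
      intro h0
      rw [h0, mul_zero] at ha2
      exact hw2 ha2.symm
    exact eq_of_algebraMap_eq (H _ (algebraMap _ _) _ _ _ _ rfl rfl rfl hw2 hb2 p2 q2 rfl
      (by rw [eq_div_iff hw2, mul_comm, hX2]) (by rw [eq_div_iff hb2, ha2]) p3 q3 h3)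
  have hca : (1 + b + b ^ 2) * (1 + 8 * b ^ 3) * q * (X * d⁄dX ℝ a) =
      a * (1 - a ^ 3) * (1 + 8 * a ^ 3) * (- (1 + 2 * b) ^ 6 * q * h) := by
    apply key
    intro K _ _ σ y s u v hs hu hv h1 h2 h3 h4 h5 h6 h7 h8 h9 h10
    simp only [da, map_sub, map_add, map_mul, map_pow, map_one, map_ofNat, map_neg, h5, h6, h7, h9,
      h10]
    field_simp
    subst hu hv hs
    ring
  have hea : 96 * b ^ 3 * (1 - b ^ 3) ^ 3 * q ^ 2 =
      96 * a ^ 3 * (1 - a ^ 3) ^ 3 * (- (1 + 2 * b) ^ 6 * q * h) ^ 2 := by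
    apply key
    intro K _ _ σ y s u v hs hu hv h1 h2 h3 h4 h5 h6 h7 h8 h9 h10
    simp only [map_sub, map_add, map_mul, map_pow, map_one, map_ofNat, map_neg, h5, h7, h9, h10]
    field_simp
    subst hu hv hs
    ring
  have hqa : - (1 + 2 * b) ^ 6 * q * h * (1 - 20 * a ^ 3 - 8 * a ^ 6) = 1 := by
    apply key
    intro K _ _ σ y s u v hs hu hv h1 h2 h3 h4 h5 h6 h7 h8 h9 h10
    simp only [map_sub, map_add, map_mul, map_pow, map_one, map_ofNat, map_neg, h5, h7, h9, h10]
    field_simp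
    subst hu hv hs
    ring
  have hcb : (1 + b + b ^ 2) * (1 + 8 * b ^ 3) * q * (X * d⁄dX ℝ b) =
      b * (1 - b ^ 3) * (1 + 8 * b ^ 3) * q := by
    rw [db]
    linear_combination (- (1 + b + b ^ 2) * (1 + 8 * b ^ 3) * q * (1 - b)) * hXb
      + (1 + b + b ^ 2) * (1 + 8 * b ^ 3) * q * (1 - b) * X * hwb
  obtain ⟨l, l1, l2, l4, l5⟩ := exists_coordinates
    (c := (1 + b + b ^ 2) * (1 + 8 * b ^ 3) * q) (e := 96 * b ^ 3 * (1 - b ^ 3) ^ 3 * q ^ 2)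
    (u := - b * (1 - b ^ 3) * p)
    (by simp [b0, q0]) (by simp [b0]) (by simp [b0])
    (by
      apply key
      intro K _ _ σ y s u v hs hu hv h1 h2 h3 h4 h5 h6 h7 h8 h9 h10
      simp only [Derivation.leibniz, Derivation.leibniz_pow, smul_eq_mul, nsmul_eq_mul,
        Derivation.map_one_eq_zero, ofNat_smul_eq_nsmul, db, dp, map_sub, map_add, map_mul, map_pow,
        map_one, map_ofNat, map_neg, map_zero, h5, h6, h8, h9, Nat.cast_ofNat, Nat.reduceSub]
      field_simp
      subst hu hv hs
      ring)
    (by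
      rw [show - b * (1 - b ^ 3) * p = X * (w * (1 - b ^ 3) * p) by rw [hb]; ring,
        show (1 : ℕ) = 0 + 1 from rfl, coeff_succ_X_mul, coeff_zero_eq_constantCoeff_apply]
      simp [w0, p0, b0])
  let P0 : ℝ⟦X⟧ := (1 - 4 * b ^ 3) * p
  let P1 : ℝ⟦X⟧ := 2 * b * (1 + 2 * b ^ 3) * p
  let P2 : ℝ⟦X⟧ := 6 * b ^ 2 * p
  let D : ℝ⟦X⟧ → ℝ⟦X⟧ := fun f => (1 + b + b ^ 2) * (1 + 8 * b ^ 3) * q * (X * d⁄dX ℝ f)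
    + 96 * b ^ 3 * (1 - b ^ 3) ^ 3 * q ^ 2 * f
  let U : ℝ⟦X⟧ := - b * (1 - b ^ 3) * p
  have lD : ∀ i f, l i (D f) = i * l i f := l1
  have hP1 : D P1 = (-2 : ℝ) • (U * ((2 : ℝ) • D P0 + P0)) := by
    rw [neg_smul]
    apply key
    intro K _ _ σ y s u v hs hu hv h1 h2 h3 h4 h5 h6 h7 h8 h9 h10
    simp only [Derivation.leibniz, Derivation.leibniz_pow, derivative_ofNat, smul_eq_mul,
      nsmul_eq_mul, Derivation.map_one_eq_zero, ofNat_smul_eq_nsmul, db, dp, P0, P1, D, U, map_sub,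
      map_add, map_mul, map_pow, map_one, map_ofNat, map_neg, map_zero, h5, h6, h8, h9,
      Nat.cast_ofNat, Nat.reduceSub]
    field_simp
    subst hu hv hs
    ring
  have hP2 : D P2 = (-2 : ℝ) • (U * ((2 : ℝ) • D P1 + P1)) := by
    rw [neg_smul]
    apply key
    intro K _ _ σ y s u v hs hu hv h1 h2 h3 h4 h5 h6 h7 h8 h9 h10
    simp only [Derivation.leibniz, Derivation.leibniz_pow, derivative_ofNat, smul_eq_mul,
      nsmul_eq_mul, Derivation.map_one_eq_zero, ofNat_smul_eq_nsmul, db, dp, P1, P2, D, U, map_sub,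
      map_add, map_mul, map_pow, map_one, map_ofNat, map_neg, map_zero, h5, h6, h8, h9,
      Nat.cast_ofNat, Nat.reduceSub]
    field_simp
    subst hu hv hs
    ring
  have hP0 : D P0 = (-2 : ℝ) • (U * ((2 : ℝ) • D P2 + P2)) := by
    rw [neg_smul]
    apply key
    intro K _ _ σ y s u v hs hu hv h1 h2 h3 h4 h5 h6 h7 h8 h9 h10
    simp only [Derivation.leibniz, Derivation.leibniz_pow, derivative_ofNat, smul_eq_mul,
      nsmul_eq_mul, Derivation.map_one_eq_zero, ofNat_smul_eq_nsmul, db, dp, P0, P2, D, U, map_sub,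
      map_add, map_mul, map_pow, map_one, map_ofNat, map_neg, map_zero, h5, h6, h8, h9,
      Nat.cast_ofNat, Nat.reduceSub]
    field_simp
    subst hu hv hs
    ring
  have hrow0 : (2 : ℝ) • D (rowSeries 0) - rowSeries 0 =
      - ((2 : ℝ) • D (P0 + P1 - (2 : ℝ) • P2) + (P0 + P1 - (2 : ℝ) • P2)) := by
    simp only [hrow, mul_zero, zero_add]
    apply key
    intro K _ _ σ y s u v hs hu hv h1 h2 h3 h4 h5 h6 h7 h8 h9 h10
    simp only [Derivation.leibniz, Derivation.leibniz_pow, derivative_ofNat, smul_eq_mul,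
      nsmul_eq_mul, Derivation.map_one_eq_zero, ofNat_smul_eq_nsmul, da, db, dp, P0, P1, P2, D,
      map_sub, map_add, map_mul, map_pow, map_one, map_ofNat, map_neg, map_zero, h5, h6, h7, h8, h9,
      Nat.cast_ofNat, Nat.reduceSub]
    field_simp
    subst hu hv hs
    ring
  have hrow1 : (8 : ℝ) • D (rowSeries 1) + (22 : ℝ) • D (rowSeries 0)
      - (28 : ℝ) • rowSeries 1 + (28 : ℝ) • rowSeries 0 = 0 := by
    simp only [hrow, mul_zero, mul_one, zero_add, Nat.reduceAdd]
    apply key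
    intro K _ _ σ y s u v hs hu hv h1 h2 h3 h4 h5 h6 h7 h8 h9 h10
    simp only [Derivation.leibniz_pow, smul_eq_mul, nsmul_eq_mul, ofNat_smul_eq_nsmul, da, db, D,
      map_sub, map_add, map_mul, map_pow, map_one, map_ofNat, map_neg, map_zero, h5, h6, h7, h9,
      Nat.cast_ofNat, Nat.reduceSub]
    field_simp
    subst hu hv hs
    ring
  have r0 : ∀ j : ℕ, (j + 1) * l (j + 1) P0 = -2 * ((2 * j + 1) * l j P2) := by
    intro j
    have := congrArg (l (j + 1)) hP0
    simp only [map_add, map_smul, lD, smul_eq_mul, U, l2] at this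
    push_cast at this
    linear_combination this
  have r1 : ∀ j : ℕ, (j + 1) * l (j + 1) P1 = -2 * ((2 * j + 1) * l j P0) := by
    intro j
    have := congrArg (l (j + 1)) hP1
    simp only [map_add, map_smul, lD, smul_eq_mul, U, l2] at this
    push_cast at this
    linear_combination this
  have r2 : ∀ j : ℕ, (j + 1) * l (j + 1) P2 = -2 * ((2 * j + 1) * l j P1) := by
    intro j
    have := congrArg (l (j + 1)) hP2
    simp only [map_add, map_smul, lD, smul_eq_mul, U, l2] at this
    push_cast at this
    linear_combination this
  have z0 : l 0 P0 = 1 := by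
    have : X ^ (0 + 1) ∣ P0 - X ^ 0 := by
      rw [pow_one, X_dvd_iff]
      simp [P0, b0, p0]
    have := l5 0 _ this
    rw [map_sub, l4] at this
    linear_combination this
  have z1 : l 0 P1 = 0 := l5 0 _ (by rw [pow_one, X_dvd_iff]; simp [P1, b0])
  have z2 : l 0 P2 = 0 := l5 0 _ (by rw [pow_one, X_dvd_iff]; simp [P2, b0])
  have o0 := r0 0
  have o1 := r1 0
  have o2 := r2 0
  have t0 := r0 1
  have t1 := r1 1
  have t2 := r2 1
  simp only [z0, z1, z2, Nat.cast_zero, Nat.cast_one, zero_add, Nat.reduceAdd]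
    at o0 o1 o2 t0 t1 t2
  refine ⟨l, fun j => - (1 / 2) * ((2 * j + 1) * (l j P0 + l j P1 - 2 * l j P2)), l4, l5,
    ?_, ?_, ?_, ?_, ?_⟩
  · simp only [z0, z1, z2]
    norm_num
  · push_cast
    linarith
  · push_cast
    linarith
  · intro j
    have c0 := r0 (j + 1)
    have c1 := r1 (j + 1)
    have c2 := r2 (j + 1)
    have d0 := r0 (j + 2)
    have d1 := r1 (j + 2)
    have d2 := r2 (j + 2)
    have e0 := r0 j
    have e1 := r1 j
    have e2 := r2 j
    push_cast at c0 c1 c2 d0 d1 d2 ⊢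
    have f0 : ((j : ℝ) + 1) * (j + 2) * (j + 3) * l (j + 3) P0 =
        -8 * ((2 * j + 1) * (2 * j + 3) * (2 * j + 5)) * l j P0 := by
      linear_combination (j + 1) * (j + 2) * d0 - 2 * (2 * j + 5) * (j + 1) * c2
        + 4 * (2 * j + 5) * (2 * j + 3) * e1
    have f1 : ((j : ℝ) + 1) * (j + 2) * (j + 3) * l (j + 3) P1 =
        -8 * ((2 * j + 1) * (2 * j + 3) * (2 * j + 5)) * l j P1 := by
      linear_combination (j + 1) * (j + 2) * d1 - 2 * (2 * j + 5) * (j + 1) * c0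
        + 4 * (2 * j + 5) * (2 * j + 3) * e2
    have f2 : ((j : ℝ) + 1) * (j + 2) * (j + 3) * l (j + 3) P2 =
        -8 * ((2 * j + 1) * (2 * j + 3) * (2 * j + 5)) * l j P2 := by
      linear_combination (j + 1) * (j + 2) * d2 - 2 * (2 * j + 5) * (j + 1) * c1
        + 4 * (2 * j + 5) * (2 * j + 3) * e0
    linear_combination (- (1 / 2) * (2 * j + 7)) * (f0 + f1 - 2 * f2)
  · intro j
    have g0 := congrArg (l j) hrow0
    have g1 := congrArg (l j) hrow1
    simp only [map_add, map_sub, map_neg, map_smul, lD, smul_eq_mul, map_zero] at g0 g1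
    refine ⟨by linear_combination 4 * g0, by linear_combination g1 - g0, fun m => ?_⟩
    have ga := power_recurrence hqa hca hea m
    have gb := power_recurrence hq1 hcb rfl m
    have g2 : (8 : ℝ) • D (rowSeries (m + 2)) + (20 : ℝ) • D (rowSeries (m + 1))
        - D (rowSeries m) = (24 * (m : ℝ) + 52) • rowSeries (m + 2)
          - (21 * (m : ℝ) + 50) • rowSeries (m + 1) - (3 * (m : ℝ) + 2) • rowSeries m := by
      simp only [smul_eq_C_mul, map_add, map_mul, map_ofNat, map_natCast, hrow, D, map_sub]
      linear_combination ga - gb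
    have g3 := congrArg (l j) g2
    simp only [map_add, map_sub, map_smul, lD, smul_eq_mul] at g3
    linear_combination g3

theorem binom_natCast (m p : ℕ) : binom m p = m.choose p := by
  rw [binom, Int.cast_natCast, ← descPochhammer_eval_eq_prod_range,
    ← Nat.cast_choose_eq_descPochhammer_div]

theorem binom_sub_natCast_succ (p m : ℕ) : binom ((p : ℤ) - (m + 1)) p = (-1) ^ p * m.choose p := by
  have h : ∏ k ∈ Finset.range p, (((p : ℤ) - (m + 1) : ℤ) - (k : ℝ)) =
      (-1) ^ p * ∏ k ∈ Finset.range p, ((m : ℝ) - k) := by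
    rw [← Finset.prod_range_reflect, ← Finset.card_range p, ← Finset.prod_const,
      Finset.card_range, ← Finset.prod_mul_distrib]
    refine Finset.prod_congr rfl fun k hk => ?_
    rw [Nat.cast_sub (by have := Finset.mem_range.mp hk; omega), Nat.cast_sub (by
      have := Finset.mem_range.mp hk; omega)]
    push_cast
    ring
  rw [binom, h, mul_div_assoc, ← descPochhammer_eval_eq_prod_range,
    ← Nat.cast_choose_eq_descPochhammer_div]

theorem inv_one_sub_X_pow_succ (d : ℕ) :
    ((1 - X : ℝ⟦X⟧)⁻¹) ^ (d + 1) = PowerSeries.mk fun n => ((d + n).choose d : ℝ) := by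
  have h1 := mk_add_choose_mul_one_sub_pow_eq_one ℝ d
  have h2 : (1 - X : ℝ⟦X⟧) * (1 - X)⁻¹ = 1 := PowerSeries.mul_inv_cancel _ (by simp)
  have h3 : (1 - X : ℝ⟦X⟧) ^ (d + 1) * (1 - X)⁻¹ ^ (d + 1) = 1 := by rw [← mul_pow, h2, one_pow]
  linear_combination (-(1 - X : ℝ⟦X⟧)⁻¹ ^ (d + 1)) * h1 +
    (PowerSeries.mk fun n => ((d + n).choose d : ℝ)) * h3

theorem coeff_inv_one_sub_three_mul_X_pow_succ (d j : ℕ) :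
    coeff j (((1 - 3 * X : ℝ⟦X⟧)⁻¹) ^ (d + 1)) = 3 ^ j * ((d + j).choose d : ℝ) := by
  have h1 : (1 - 3 * X : ℝ⟦X⟧)⁻¹ = rescale 3 (1 - X)⁻¹ := by
    rw [PowerSeries.inv_eq_iff_mul_eq_one (by simp)]
    have h2 : (1 - X : ℝ⟦X⟧)⁻¹ * (1 - X) = 1 := PowerSeries.inv_mul_cancel _ (by simp)
    have h3 := congrArg (rescale (3 : ℝ)) h2
    rw [map_mul, map_sub, map_one, rescale_X] at h3
    exact h3
  rw [h1, ← map_pow, inv_one_sub_X_pow_succ, coeff_rescale, coeff_mk]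

theorem coeff_neg_X_mul_inv_pow_succ (d j : ℕ) :
    coeff (j + 1) ((- X * (1 - X : ℝ⟦X⟧)⁻¹) ^ (d + 1)) = (-1) ^ (d + 1) * (j.choose d : ℝ) := by
  rw [mul_pow, inv_one_sub_X_pow_succ, neg_pow, mul_assoc,
    show ((-1 : ℝ⟦X⟧) ^ (d + 1)) = C ((-1) ^ (d + 1)) by simp, coeff_C_mul, coeff_X_pow_mul']
  split_ifs with h
  · rw [coeff_mk, Nat.add_sub_add_right, Nat.add_sub_cancel' (by omega)]
  · rw [Nat.choose_eq_zero_of_lt (by omega), Nat.cast_zero]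

theorem entry_eq_coeff_rowSeries (i j : ℕ) :
    (3 : ℝ) ^ j * binom (3 * (i : ℤ) + (j : ℤ) + 1) (3 * i + 1)
      + binom (3 * (i : ℤ) - (j : ℤ) + 1) (3 * i + 1) =
      (if j = 0 then 2 else 1) * coeff j (rowSeries i) := by
  rw [rowSeries, map_sub, coeff_inv_one_sub_three_mul_X_pow_succ (3 * i + 1),
    show 3 * (i : ℤ) + (j : ℤ) + 1 = ((3 * i + 1 + j : ℕ) : ℤ) by push_cast; ring, binom_natCast]
  rcases j with _ | j
  · rw [show 3 * (i : ℤ) - ((0 : ℕ) : ℤ) + 1 = ((3 * i + 1 : ℕ) : ℤ) by push_cast; ring,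
      binom_natCast]
    simp
    norm_num
  · rw [show 3 * (i : ℤ) - ((j + 1 : ℕ) : ℤ) + 1 = ((3 * i + 1 : ℕ) : ℤ) - (j + 1) by
      push_cast; ring, binom_sub_natCast_succ, coeff_neg_X_mul_inv_pow_succ (3 * i + 1)]
    simp only [Nat.add_eq_zero_iff, one_ne_zero, and_false, if_false]
    ring

theorem det_entries (n : ℕ) (hn : 0 < n) :
    (Matrix.of fun i j : Fin n =>
        (3 : ℝ) ^ (j : ℕ) * binom (3 * ((i : ℕ) : ℤ) + ((j : ℕ) : ℤ) + 1) (3 * (i : ℕ) + 1)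
          + binom (3 * ((i : ℕ) : ℤ) - ((j : ℕ) : ℤ) + 1) (3 * (i : ℕ) + 1)).det =
      2 * (Matrix.of fun i j : Fin n => coeff (j : ℕ) (rowSeries i)).det := by
  have h := Matrix.det_mul_row (fun j : Fin n => if (j : ℕ) = 0 then (2 : ℝ) else 1)
    (Matrix.of fun i j : Fin n => coeff (j : ℕ) (rowSeries i))
  simp only [entry_eq_coeff_rowSeries]
  refine h.trans ?_
  congr 1
  rw [Finset.prod_eq_single (⟨0, hn⟩ : Fin n)]
  · simp
  · intro b _ hb
    exact if_neg fun h0 => hb (Fin.ext h0)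
  · simp

/-- In suitable coordinates the matrix is a Cauchy matrix with rescaled rows and columns, which
gives a first order recurrence for its determinant. -/
theorem exists_det_recurrence :
    ∃ α β : ℕ → ℝ, α 0 = 1 ∧
      (∀ i : ℕ, (6 * i + 8) * (6 * i + 6) * (6 * i + 4) * α (i + 1) =
        -8 * ((6 * i + 7) * (6 * i + 5) * (6 * i + 3)) * α i) ∧
      β 0 = - 1 / 2 ∧ β 1 = 3 ∧ β 2 = 30 ∧
      (∀ j : ℕ, (j + 1) * (j + 2) * (j + 3) * β (j + 3) =
        -8 * ((2 * j + 3) * (2 * j + 5) * (2 * j + 7)) * β j) ∧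
      ∀ n : ℕ, (Matrix.of fun i j : Fin (n + 1) => coeff (j : ℕ) (rowSeries i)).det =
        α n * β n * (1 / (-3 * (n : ℝ) - 1 / 2 + n)) * (∏ i ∈ Finset.range n,
          ((-3 * (n : ℝ) - 1 / 2 - (-3 * (i : ℝ) - 1 / 2)) * ((n : ℝ) - i) /
            ((-3 * (i : ℝ) - 1 / 2 + n) * (-3 * (n : ℝ) - 1 / 2 + i)))) *
        (Matrix.of fun i j : Fin n => coeff (j : ℕ) (rowSeries i)).det := by
  obtain ⟨lx, β, x1, x2, β0, β1, β2, hβ, hx⟩ := exists_column_coordinates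
  obtain ⟨ly, α, y1, y2, α0, hα, hy⟩ := exists_row_coordinates
  refine ⟨α, β, α0, hα, β0, β1, β2, hβ, fun n => ?_⟩
  let x : ℕ → ℝ := fun i => -3 * i - 1 / 2
  let y : ℕ → ℝ := fun j => j
  have hxy : ∀ i j, x i + y j ≠ 0 := by
    intro i j h
    have h1 : ((2 * j : ℤ) : ℝ) = ((6 * i + 1 : ℤ) : ℝ) := by
      push_cast
      simp only [x, y] at h
      linarith
    have h2 : (2 * j : ℤ) = 6 * i + 1 := by exact_mod_cast h1
    omega
  have hdet : ∀ n, (Matrix.of fun i j : Fin n => coeff (j : ℕ) (rowSeries i)).det =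
      (∏ i ∈ Finset.range n, α i) * ((∏ j ∈ Finset.range n, β j) *
        (Matrix.of fun i j : Fin n => 1 / (x i + y j)).det) := by
    intro n
    rw [Matrix.det_coeff_eq_det_coordinates n x1 x2 y1 y2]
    have h1 := Matrix.det_mul_column (fun i : Fin n => α i)
      (Matrix.of fun i j : Fin n => β j * (1 / (x i + y j)))
    have h2 := Matrix.det_mul_row (fun j : Fin n => β j)
      (Matrix.of fun i j : Fin n => 1 / (x i + y j))
    simp only [Matrix.of_apply] at h1 h2
    rw [Finset.prod_range, Finset.prod_range, ← h2, ← h1]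
    congr 2
    ext i j
    obtain ⟨c0, c1, c2⟩ := hx j
    have h3 := hy (fun m => lx j (rowSeries m)) ((j : ℕ) : ℝ) (β j) c0 c1 c2 i
    have h4 := hxy i j
    rw [mul_one_div, mul_div_assoc', eq_div_iff h4, ← h3]
    simp only [x, y]
    ring
  rw [hdet, hdet, Matrix.det_cauchy_succ n x y hxy, Finset.prod_range_succ, Finset.prod_range_succ]
  ring

theorem prod_range_shift_three (n : ℕ) :
    ∏ i ∈ Finset.range (n + 3), (((n + 3 : ℕ) : ℝ) - 3 * i - 1 / 2) =
      (n + 5 / 2) * (2 * n + 1 / 2) * (2 * n + 7 / 2) *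
        ∏ i ∈ Finset.range n, ((n : ℝ) - 3 * i - 1 / 2) := by
  have h : ∀ i ∈ Finset.range (n + 2), (((n + 3 : ℕ) : ℝ) - 3 * ((i + 1 : ℕ) : ℝ) - 1 / 2) =
      (n : ℝ) - 3 * i - 1 / 2 := fun i _ => by push_cast; ring
  rw [Finset.prod_range_succ', Finset.prod_congr rfl h, Finset.prod_range_succ,
    Finset.prod_range_succ]
  push_cast
  ring

theorem prod_range_three_mul_succ (n : ℕ) :
    (∏ i ∈ Finset.range (n + 1), (3 * ((n + 1 : ℕ) : ℝ) + 1 / 2 - i)) *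
        ((2 * n + 5 / 2) * (2 * n + 3 / 2)) =
      (3 * n + 7 / 2) * (3 * n + 5 / 2) * (3 * n + 3 / 2) *
        ∏ i ∈ Finset.range n, (3 * (n : ℝ) + 1 / 2 - i) := by
  have h1 := Finset.prod_range_succ (fun i : ℕ => 3 * ((n + 1 : ℕ) : ℝ) + 1 / 2 - i) (n + 2)
  rw [Finset.prod_range_succ _ (n + 1)] at h1
  rw [Finset.prod_range_succ', Finset.prod_range_succ', Finset.prod_range_succ'] at h1
  have h : ∀ i ∈ Finset.range n,
      3 * ((n + 1 : ℕ) : ℝ) + 1 / 2 - ((i + 1 + 1 + 1 : ℕ) : ℝ) = 3 * (n : ℝ) + 1 / 2 - i :=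
    fun i _ => by push_cast; ring
  rw [Finset.prod_congr rfl h] at h1
  push_cast at h1 ⊢
  linear_combination -h1

theorem prod_range_sub_ne_zero (n : ℕ) :
    ∏ i ∈ Finset.range n, ((n : ℝ) - 3 * i - 1 / 2) ≠ 0 := by
  refine Finset.prod_ne_zero_iff.mpr fun i _ h => ?_
  have h1 : ((2 * n : ℤ) : ℝ) = ((6 * i + 1 : ℤ) : ℝ) := by push_cast; linarith
  have h2 : (2 * n : ℤ) = 6 * i + 1 := by exact_mod_cast h1
  omega

theorem prod_range_three_mul_ne_zero (n : ℕ) :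
    ∏ i ∈ Finset.range n, (3 * (n : ℝ) + 1 / 2 - i) ≠ 0 := by
  refine Finset.prod_ne_zero_iff.mpr fun i _ h => ?_
  have h1 : ((2 * i : ℤ) : ℝ) = ((6 * n + 1 : ℤ) : ℝ) := by push_cast; linarith
  have h2 : (2 * i : ℤ) = 6 * n + 1 := by exact_mod_cast h1
  omega

theorem prod_range_cauchy (n : ℕ) :
    ∏ i ∈ Finset.range n, ((-3 * (n : ℝ) - 1 / 2 - (-3 * (i : ℝ) - 1 / 2)) * ((n : ℝ) - i) /
        ((-3 * (i : ℝ) - 1 / 2 + n) * (-3 * (n : ℝ) - 1 / 2 + i))) =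
      3 ^ n * (n.factorial : ℝ) ^ 2 / ((∏ i ∈ Finset.range n, ((n : ℝ) - 3 * i - 1 / 2)) *
        ∏ i ∈ Finset.range n, (3 * (n : ℝ) + 1 / 2 - i)) := by
  have h1 : (n.factorial : ℝ) = ∏ i ∈ Finset.range n, ((n : ℝ) - i) := by
    rw [← descPochhammer_eval_eq_prod_range, descPochhammer_eval_eq_descFactorial,
      Nat.descFactorial_self]
  have h2 : (3 : ℝ) ^ n = ∏ _i ∈ Finset.range n, (3 : ℝ) := by simp
  rw [h1, h2, sq, ← Finset.prod_mul_distrib, ← Finset.prod_mul_distrib, ← Finset.prod_mul_distrib,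
    ← Finset.prod_div_distrib]
  refine Finset.prod_congr rfl fun i _ => ?_
  rw [← neg_div_neg_eq]
  congr 1 <;> ring

theorem Gamma_add_nat (x : ℝ) (hx : 0 < x) (m : ℕ) :
    Real.Gamma (x + m) = (∏ k ∈ Finset.range m, (x + k)) * Real.Gamma x := by
  induction m with
  | zero => simp
  | succ m ih =>
    rw [Nat.cast_succ, ← add_assoc, Real.Gamma_add_one (by positivity), ih,
      Finset.prod_range_succ]
    ring

theorem gamma_ratio_add_three (n : ℕ) :
    (2 : ℝ) ^ (((n + 3 : ℕ) : ℤ) - 1) / 3 * (Real.Gamma (4 * ((n + 3 : ℕ) : ℝ) + 3) *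
        Real.Gamma ((((n + 3 : ℕ) : ℝ) + 1) / 3) / (Real.Gamma (3 * ((n + 3 : ℕ) : ℝ) + 2) *
          Real.Gamma (4 * (((n + 3 : ℕ) : ℝ) + 1) / 3))) =
      8 * (∏ k ∈ Finset.range 12, (4 * (n : ℝ) + 3 + k)) * ((n + 1) / 3) /
        ((∏ k ∈ Finset.range 9, (3 * (n : ℝ) + 2 + k)) *
          ∏ k ∈ Finset.range 4, (4 * ((n : ℝ) + 1) / 3 + k)) *
      ((2 : ℝ) ^ ((n : ℤ) - 1) / 3 * (Real.Gamma (4 * (n : ℝ) + 3) *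
        Real.Gamma (((n : ℝ) + 1) / 3) / (Real.Gamma (3 * (n : ℝ) + 2) *
          Real.Gamma (4 * ((n : ℝ) + 1) / 3)))) := by
  have e1 : 4 * ((n + 3 : ℕ) : ℝ) + 3 = 4 * (n : ℝ) + 3 + (12 : ℕ) := by push_cast; ring
  have e2 : (((n + 3 : ℕ) : ℝ) + 1) / 3 = ((n : ℝ) + 1) / 3 + (1 : ℕ) := by push_cast; ring
  have e3 : 3 * ((n + 3 : ℕ) : ℝ) + 2 = 3 * (n : ℝ) + 2 + (9 : ℕ) := by push_cast; ring
  have e4 : 4 * (((n + 3 : ℕ) : ℝ) + 1) / 3 = 4 * ((n : ℝ) + 1) / 3 + (4 : ℕ) := by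
    push_cast; ring
  have e5 : (2 : ℝ) ^ (((n + 3 : ℕ) : ℤ) - 1) = 8 * 2 ^ ((n : ℤ) - 1) := by
    rw [show ((n + 3 : ℕ) : ℤ) - 1 = 3 + ((n : ℤ) - 1) by push_cast; ring,
      zpow_add₀ two_ne_zero]
    norm_num
  rw [e1, e2, e3, e4, e5, Gamma_add_nat _ (by positivity), Gamma_add_nat _ (by positivity),
    Gamma_add_nat _ (by positivity), Gamma_add_nat _ (by positivity), Finset.prod_range_one,
    Nat.cast_zero, add_zero]
  simp only [div_eq_mul_inv, mul_inv]
  ring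

theorem coefficient_ratio_eq_gamma_ratio (α β : ℕ → ℝ) (α0 : α 0 = 1)
    (hα : ∀ i : ℕ, (6 * i + 8) * (6 * i + 6) * (6 * i + 4) * α (i + 1) =
      -8 * ((6 * i + 7) * (6 * i + 5) * (6 * i + 3)) * α i)
    (β0 : β 0 = - 1 / 2) (β1 : β 1 = 3) (β2 : β 2 = 30)
    (hβ : ∀ j : ℕ, (j + 1) * (j + 2) * (j + 3) * β (j + 3) =
      -8 * ((2 * j + 3) * (2 * j + 5) * (2 * j + 7)) * β j) (n : ℕ) :
    α n * β n * (1 / (-3 * (n : ℝ) - 1 / 2 + n)) * (∏ i ∈ Finset.range n,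
        ((-3 * (n : ℝ) - 1 / 2 - (-3 * (i : ℝ) - 1 / 2)) * ((n : ℝ) - i) /
          ((-3 * (i : ℝ) - 1 / 2 + n) * (-3 * (n : ℝ) - 1 / 2 + i)))) =
      (2 : ℝ) ^ ((n : ℤ) - 1) / 3 * (Real.Gamma (4 * (n : ℝ) + 3) *
        Real.Gamma (((n : ℝ) + 1) / 3) / (Real.Gamma (3 * (n : ℝ) + 2) *
          Real.Gamma (4 * ((n : ℝ) + 1) / 3))) := by
  have α_succ : ∀ i : ℕ, α (i + 1) = -8 * ((6 * i + 7) * (6 * i + 5) * (6 * i + 3)) /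
      ((6 * i + 8) * (6 * i + 6) * (6 * i + 4)) * α i := fun i => by
    rw [div_mul_eq_mul_div, eq_div_iff (by positivity), ← hα]
    ring
  induction n using Nat.strong_induction_on with
  | _ n ih =>
  rcases n with _ | _ | _ | n
  · have h1 : Real.Gamma (4 / 3) = 1 / 3 * Real.Gamma (1 / 3) := by
      rw [← Real.Gamma_add_one (by norm_num)]; norm_num
    have h3 : Real.Gamma (1 / 3) ≠ 0 := (Real.Gamma_pos_of_pos (by norm_num)).ne'
    norm_num [α0, β0] at h1 h3 ⊢
    rw [h1]
    field_simp
    norm_num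
  · have h1 : Real.Gamma (8 / 3) = 5 / 3 * (2 / 3 * Real.Gamma (2 / 3)) := by
      rw [← Real.Gamma_add_one (by norm_num), show (2 / 3 + 1 : ℝ) = 5 / 3 by norm_num,
        ← Real.Gamma_add_one (by norm_num)]
      norm_num
    have h3 : Real.Gamma (2 / 3) ≠ 0 := (Real.Gamma_pos_of_pos (by norm_num)).ne'
    norm_num [α0, α_succ, β1] at h1 h3 ⊢
    rw [h1]
    field_simp
    norm_num
  · have h2 : Real.Gamma 11 = 3628800 := by
      rw [show (11 : ℝ) = (10 : ℕ) + 1 by norm_num, Real.Gamma_nat_eq_factorial]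
      norm_num [Nat.factorial]
    norm_num [α0, α_succ, β2, Finset.prod_range_succ]
  · rw [show n + 1 + 1 + 1 = n + 3 by rfl, gamma_ratio_add_three, ← ih n (by omega),
      prod_range_cauchy, prod_range_cauchy, prod_range_shift_three]
    have q_succ : ∀ m : ℕ, ∏ i ∈ Finset.range (m + 1), (3 * ((m + 1 : ℕ) : ℝ) + 1 / 2 - i) =
        (3 * m + 7 / 2) * (3 * m + 5 / 2) * (3 * m + 3 / 2) /
          ((2 * m + 5 / 2) * (2 * m + 3 / 2)) *
            ∏ i ∈ Finset.range m, (3 * (m : ℝ) + 1 / 2 - i) := fun m => by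
      rw [div_mul_eq_mul_div, eq_div_iff (by positivity), prod_range_three_mul_succ]
    have hβn : β (n + 3) = -8 * ((2 * n + 3) * (2 * n + 5) * (2 * n + 7)) /
        ((n + 1) * (n + 2) * (n + 3)) * β n := by
      rw [div_mul_eq_mul_div, eq_div_iff (by positivity), ← hβ]
      ring
    have hP := prod_range_sub_ne_zero n
    have hQ := prod_range_three_mul_ne_zero n
    rw [q_succ (n + 2), q_succ (n + 1), q_succ n, hβn, α_succ (n + 2), α_succ (n + 1), α_succ n,
      Nat.factorial_succ, Nat.factorial_succ, Nat.factorial_succ]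
    simp only [Finset.prod_range_succ, Finset.prod_range_zero] at *
    generalize ∏ i ∈ Finset.range n, ((n : ℝ) - 3 * i - 1 / 2) = P at *
    generalize ∏ i ∈ Finset.range n, (3 * (n : ℝ) + 1 / 2 - i) = Q at *
    push_cast
    have hn : (0 : ℝ) ≤ n := n.cast_nonneg
    generalize (n : ℝ) = t at *
    have d1 : -3 * (t + 3) - 1 / 2 + (t + 3) = -((4 * t + 13) / 2) := by ring
    have d2 : -3 * t - 1 / 2 + t = -((4 * t + 1) / 2) := by ring
    rw [d1, d2]
    field_simp
    ring

theorem zpow_two_mul_zpow_three_succ (n : ℕ) :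
    (2 : ℝ) ^ (((n + 1 : ℕ) : ℤ) * (((n + 1 : ℕ) : ℤ) - 3) / 2) * (3 : ℝ) ^ (-((n + 1 : ℕ) : ℤ)) =
      (2 : ℝ) ^ ((n : ℤ) - 1) / 3 *
        ((2 : ℝ) ^ ((n : ℤ) * ((n : ℤ) - 3) / 2) * (3 : ℝ) ^ (-(n : ℤ))) := by
  have h : ((n + 1 : ℕ) : ℤ) * (((n + 1 : ℕ) : ℤ) - 3) / 2 =
      (n : ℤ) - 1 + (n : ℤ) * ((n : ℤ) - 3) / 2 := by
    push_cast
    rw [add_comm ((n : ℤ) - 1), ← Int.add_mul_ediv_left _ _ two_ne_zero]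
    congr 1
    ring
  rw [h, zpow_add₀ two_ne_zero, Nat.cast_succ, neg_add, zpow_add₀ three_ne_zero, zpow_neg_one]
  ring

theorem det_coeff_rowSeries (n : ℕ) :
    (Matrix.of fun i j : Fin n => PowerSeries.coeff (j : ℕ) (rowSeries i)).det =
      (2 : ℝ) ^ ((n : ℤ) * ((n : ℤ) - 3) / 2) * (3 : ℝ) ^ (-(n : ℤ)) * ∏ i ∈ Finset.Icc 1 n,
        Real.Gamma (4 * (i : ℝ) - 1) * Real.Gamma ((i : ℝ) / 3)
          / (Real.Gamma (3 * (i : ℝ) - 1) * Real.Gamma (4 * (i : ℝ) / 3)) := by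
  obtain ⟨α, β, α0, hα, β0, β1, β2, hβ, hdet⟩ := exists_det_recurrence
  induction n with
  | zero => simp
  | succ n ih =>
    rw [hdet, coefficient_ratio_eq_gamma_ratio α β α0 hα β0 β1 β2 hβ, ih,
      zpow_two_mul_zpow_three_succ, Finset.prod_Icc_succ_top (by omega), Nat.cast_succ,
      show 4 * ((n : ℝ) + 1) - 1 = 4 * n + 3 by ring,
      show 3 * ((n : ℝ) + 1) - 1 = 3 * n + 2 by ring]
    ring

end BinomDet

theorem stmt_6 (n : ℕ) (hn : 0 < n) :
    (Matrix.of fun i j : Fin n =>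
        (3 : ℝ) ^ (j : ℕ) * binom (3 * ((i : ℕ) : ℤ) + ((j : ℕ) : ℤ) + 1) (3 * (i : ℕ) + 1)
          + binom (3 * ((i : ℕ) : ℤ) - ((j : ℕ) : ℤ) + 1) (3 * (i : ℕ) + 1)).det =
      2 * (2 : ℝ) ^ (((n : ℤ) * ((n : ℤ) - 3)) / 2) * (3 : ℝ) ^ (-(n : ℤ)) * ∏ i ∈ Finset.Icc 1 n,
          Real.Gamma (4 * (i : ℝ) - 1) * Real.Gamma ((i : ℝ) / 3)
            / (Real.Gamma (3 * (i : ℝ) - 1) * Real.Gamma (4 * (i : ℝ) / 3)) := by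
  rw [BinomDet.det_entries n hn, BinomDet.det_coeff_rowSeries]
  ring
end

section
/- For every positive integer n, the determinant of the n×n matrix whose (i,j)-entry (0 ≤ i,j ≤ n−1) is 3^{j}·binom(3i+j+2, 3i+2) + binom(3i−j+2, 3i+2) equals 2·2^{n(n−5)/2} times the product over i = 1 to n of Γ(4i+1)·Γ((i+2)/3) / (Γ(3i+1)·Γ((4i+2)/3)). (Here 2^{n(n−5)/2} is the real power with integer exponent n(n−5)/2, which may be negative.) -/
open scoped BigOperators

namespace PowerSeries

/-- The binomial series `(1 - X) ^ r`. -/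
noncomputable def oneSubPow (r : ℝ) : ℝ⟦X⟧ := rescale (-1) (binomialSeries ℝ r)

theorem coeff_oneSubPow (r : ℝ) (m : ℕ) :
    coeff m (oneSubPow r) = (∏ k ∈ Finset.range m, ((k : ℝ) - r)) / (m.factorial : ℝ) := by
  have h : (descPochhammer ℤ m).smeval r = ∏ k ∈ Finset.range m, (r - k) := by
    induction m with
    | zero => simp
    | succ m ih =>
      rw [descPochhammer_succ_right, Polynomial.smeval_mul, ih, Finset.prod_range_succ,
        Polynomial.smeval_sub, Polynomial.smeval_X, Polynomial.smeval_natCast]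
      simp
  have h' : ∏ k ∈ Finset.range m, ((k : ℝ) - r) = (-1) ^ m * ∏ k ∈ Finset.range m, (r - k) := by
    rw [← Finset.card_range m, ← Finset.prod_const, Finset.card_range, ← Finset.prod_mul_distrib]
    exact Finset.prod_congr rfl fun k _ => by ring
  rw [oneSubPow, coeff_rescale, binomialSeries_coeff, smul_eq_mul, mul_one,
    Ring.choose_eq_smul, h, h', smul_eq_mul]
  ring

theorem oneSubPow_add (r s : ℝ) : oneSubPow (r + s) = oneSubPow r * oneSubPow s := by
  simp [oneSubPow, binomialSeries_add]

theorem oneSubPow_natCast (n : ℕ) : oneSubPow n = (1 - X) ^ n := by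
  rw [oneSubPow, binomialSeries_nat, map_pow, map_add, map_one, rescale_X]
  simp [sub_eq_add_neg]

theorem constantCoeff_oneSubPow (r : ℝ) : constantCoeff (oneSubPow r) = 1 := by
  rw [← coeff_zero_eq_constantCoeff_apply, coeff_oneSubPow]; simp

/-- The subseries of the coefficients at exponents congruent to two modulo three. -/
noncomputable def sec : ℝ⟦X⟧ →ₗ[ℝ] ℝ⟦X⟧ where
  toFun f := mk fun i => coeff (3 * i + 2) f
  map_add' f g := by ext; simp
  map_smul' a f := by ext; simp

theorem coeff_sec (f : ℝ⟦X⟧) (i : ℕ) : coeff i (sec f) = coeff (3 * i + 2) f := by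
  simp [sec]

theorem sec_expand (f : ℝ⟦X⟧) : sec (expand 3 three_ne_zero f) = 0 := by
  ext i
  rw [coeff_sec, coeff_expand, if_neg (by omega)]; simp

theorem sec_X_mul_expand (f : ℝ⟦X⟧) : sec (X * expand 3 three_ne_zero f) = 0 := by
  ext i
  rw [coeff_sec, coeff_succ_X_mul, coeff_expand, if_neg (by omega)]; simp

theorem sec_X_sq_mul_expand (f : ℝ⟦X⟧) : sec (X ^ 2 * expand 3 three_ne_zero f) = f := by
  ext i
  rw [coeff_sec, coeff_X_pow_mul, coeff_expand, if_pos (by omega)]; simp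

theorem sec_X_pow_mul (m : ℕ) (f : ℝ⟦X⟧) : sec (X ^ (3 * m) * f) = X ^ m * sec f := by
  ext i
  rw [coeff_sec, coeff_X_pow_mul', coeff_X_pow_mul']
  by_cases hm : m ≤ i
  · rw [if_pos (by omega), if_pos hm, coeff_sec]; congr 2; omega
  · rw [if_neg hm, if_neg (by omega)]

theorem coeff_oneSubPow_eq_binom (α : ℤ) (m : ℕ) (r : ℝ) (h : (α : ℝ) = m - 1 - r) :
    coeff m (oneSubPow r) = binom α m := by
  rw [coeff_oneSubPow, binom, ← Finset.prod_range_reflect]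
  congr 1
  refine Finset.prod_congr rfl fun k hk => ?_
  have := Finset.mem_range.1 hk
  rw [h, Nat.cast_sub (by omega), Nat.cast_sub (by omega)]
  push_cast; ring

/-- The geometric series `1 / (1 - X)`. -/
noncomputable def geom : ℝ⟦X⟧ := mk 1

/-- The geometric series `1 / (1 - X ^ 3)`. -/
noncomputable def geomCubed : ℝ⟦X⟧ := expand 3 three_ne_zero geom

theorem geom_mul_one_sub : geom * (1 - X) = 1 := mk_one_mul_one_sub_eq_one ℝ

theorem geomCubed_mul_one_sub : geomCubed * (1 - X ^ 3) = 1 := by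
  have h := congrArg (expand 3 three_ne_zero) geom_mul_one_sub
  simpa [geomCubed] using h

theorem geom_eq : geom = (1 + X + X ^ 2) * geomCubed := by
  linear_combination (1 + X + X ^ 2) * geomCubed * geom_mul_one_sub - geom * geomCubed_mul_one_sub

/-- The series `κ` with `twist = X * κ(X³)`. -/
noncomputable def twistCore : ℝ⟦X⟧ := -(C (1 / 4) * (8 + X) * geom)

/-- The substitution `-X (8 + X³) / (4 (1 - X³))`. -/
noncomputable def twist : ℝ⟦X⟧ := X * expand 3 three_ne_zero twistCore

theorem four_mul_C : (4 : ℝ⟦X⟧) * C (1 / 4) = 1 := by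
  rw [← map_ofNat (C (R := ℝ)) 4, ← map_mul]; norm_num

theorem four_mul_twist : 4 * twist = -(X * (8 + X ^ 3) * geomCubed) := by
  have h8 : expand 3 three_ne_zero (8 : ℝ⟦X⟧) = 8 := map_ofNat _ 8
  have hg : expand 3 three_ne_zero geom = geomCubed := rfl
  simp only [twist, twistCore, map_neg, map_mul, expand_C, map_add, expand_X, hg, h8]
  linear_combination - (X * (8 + X ^ 3) * geomCubed) * four_mul_C

theorem constantCoeff_twistCore : constantCoeff twistCore = -2 := by
  have h8 : constantCoeff (8 : ℝ⟦X⟧) = 8 := map_ofNat _ 8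
  simp [twistCore, geom, h8]; norm_num

theorem hasSubst_twist : HasSubst twist :=
  HasSubst.of_constantCoeff_zero' (by simp [twist])

theorem twist_pow (k : ℕ) : twist ^ k = X ^ k * expand 3 three_ne_zero (twistCore ^ k) := by
  rw [twist, mul_pow, map_pow]

/-- The sum of the two eigenvalues `3 / (1 - X)` and `1 - X`. -/
noncomputable def eigSum : ℝ⟦X⟧ := 3 * geom + (1 - X)

theorem eigSum_sq : eigSum ^ 2 = 4 * (1 - twist) * eigSum + 12 * twist := by
  have h := four_mul_twist
  have hJ := geomCubed_mul_one_sub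
  rw [eigSum, geom_eq]
  linear_combination (3 * (1 + X + X ^ 2) * geomCubed + (1 - X) - 3) * h +
    (3 * (3 - 2 * X + X ^ 2 + X ^ 3) * geomCubed + (4 * (1 - X) - (1 - X) ^ 2)) * hJ

theorem eigSum_mul_geom :
    eigSum * geom = 4 * geom - 4 * twist * geom - (6 * X + 3 * X ^ 2) * geomCubed := by
  have h := four_mul_twist
  have hJ := geomCubed_mul_one_sub
  rw [eigSum, geom_eq]
  linear_combination ((1 + X + X ^ 2) * geomCubed) * h +
    (3 - 2 * X + X ^ 2 + X ^ 3) * geomCubed * hJ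

theorem sec_X_pow_mul_expand (m : ℕ) (f : ℝ⟦X⟧) :
    sec (X ^ (3 * m) * expand 3 three_ne_zero f) = 0 ∧
    sec (X ^ (3 * m + 1) * expand 3 three_ne_zero f) = 0 ∧
    sec (X ^ (3 * m + 2) * expand 3 three_ne_zero f) = X ^ m * f ∧
    sec (X ^ (3 * m + 3) * expand 3 three_ne_zero f) = 0 ∧
    sec (X ^ (3 * m + 4) * expand 3 three_ne_zero f) = 0 := by
  have h0 : ∀ m, sec (X ^ (3 * m) * expand 3 three_ne_zero f) = 0 := fun m => by
    rw [sec_X_pow_mul, sec_expand, mul_zero]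
  have h1 : ∀ m, sec (X ^ (3 * m + 1) * expand 3 three_ne_zero f) = 0 := fun m => by
    rw [pow_succ, mul_assoc, sec_X_pow_mul, sec_X_mul_expand, mul_zero]
  refine ⟨h0 m, h1 m, ?_, h0 (m + 1), h1 (m + 1)⟩
  rw [pow_add, mul_assoc, sec_X_pow_mul, sec_X_sq_mul_expand]

theorem twist_pow_mul_geomCubed (k : ℕ) :
    twist ^ k * geomCubed = X ^ k * expand 3 three_ne_zero (twistCore ^ k * geom) := by
  rw [twist_pow, map_mul, geomCubed, mul_assoc]

theorem sec_twist_pow_mul_eigSum (k : ℕ) :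
    ∃ a : ℝ, sec (twist ^ k * (eigSum * geom)) =
      a • sec (twist ^ k * geom) - 4 • sec (twist ^ (k + 1) * geom) := by
  have e : twist ^ k * (eigSum * geom) = 4 • (twist ^ k * geom) - 4 • (twist ^ (k + 1) * geom)
      - (6 • (X ^ (k + 1) * expand 3 three_ne_zero (twistCore ^ k * geom))
        + 3 • (X ^ (k + 2) * expand 3 three_ne_zero (twistCore ^ k * geom))) := by
    rw [eigSum_mul_geom]
    simp only [nsmul_eq_mul]
    push_cast
    linear_combination - (6 * X + 3 * X ^ 2) * twist_pow_mul_geomCubed k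
  have e' : twist ^ k * geom = X ^ k * expand 3 three_ne_zero (twistCore ^ k * geom) +
      X ^ (k + 1) * expand 3 three_ne_zero (twistCore ^ k * geom) +
      X ^ (k + 2) * expand 3 three_ne_zero (twistCore ^ k * geom) := by
    conv_lhs => rw [geom_eq]
    linear_combination (1 + X + X ^ 2) * twist_pow_mul_geomCubed k
  rw [e, e']
  simp only [map_add, map_sub, map_nsmul]
  obtain ⟨m, r, hr, rfl⟩ : ∃ m r, r < 3 ∧ k = 3 * m + r := ⟨k / 3, k % 3, by omega, by omega⟩
  obtain ⟨h0, h1, h2, h3, h4⟩ := sec_X_pow_mul_expand m (twistCore ^ (3 * m + r) * geom)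
  interval_cases r
  · refine ⟨1, ?_⟩
    simp only [add_zero] at *
    rw [h0, h1, h2]; module
  · refine ⟨-2, ?_⟩
    simp only [add_assoc] at *
    rw [h1, h2, h3]; module
  · refine ⟨4, ?_⟩
    simp only [add_assoc] at *
    rw [h2, h3, h4]; module

/-- The ratio of the sections of `twist ^ k * geom` and
`twist ^ k * (1 + X - X ^ 2 / 2) * geomCubed`. -/
noncomputable def secRatio (k : ℕ) : ℝ := if k % 3 = 0 then -2 else 1

theorem two_mul_C_half : (2 : ℝ⟦X⟧) * C (1 / 2) = 1 := by
  rw [← map_ofNat (C (R := ℝ)) 2, ← map_mul]; norm_num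

theorem sec_twist_pow_mul_geom (k : ℕ) :
    sec (twist ^ k * geom) =
      secRatio k • sec (twist ^ k * ((1 + X - C (1 / 2) * X ^ 2) * geomCubed)) := by
  have e' : twist ^ k * geom = X ^ k * expand 3 three_ne_zero (twistCore ^ k * geom) +
      X ^ (k + 1) * expand 3 three_ne_zero (twistCore ^ k * geom) +
      X ^ (k + 2) * expand 3 three_ne_zero (twistCore ^ k * geom) := by
    conv_lhs => rw [geom_eq]
    linear_combination (1 + X + X ^ 2) * twist_pow_mul_geomCubed k
  have e : twist ^ k * ((1 + X - C (1 / 2) * X ^ 2) * geomCubed) =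
      X ^ k * expand 3 three_ne_zero (twistCore ^ k * geom) +
      X ^ (k + 1) * expand 3 three_ne_zero (twistCore ^ k * geom) -
      (1 / 2 : ℝ) • (X ^ (k + 2) * expand 3 three_ne_zero (twistCore ^ k * geom)) := by
    rw [smul_eq_C_mul]
    linear_combination (1 + X - C (1 / 2) * X ^ 2) * twist_pow_mul_geomCubed k
  rw [e, e']
  simp only [map_add, map_sub, map_smul]
  obtain ⟨m, r, hr, rfl⟩ : ∃ m r, r < 3 ∧ k = 3 * m + r := ⟨k / 3, k % 3, by omega, by omega⟩
  obtain ⟨h0, h1, h2, h3, h4⟩ := sec_X_pow_mul_expand m (twistCore ^ (3 * m + r) * geom)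
  interval_cases r
  · simp only [add_zero] at *
    rw [secRatio, if_pos (by omega), h0, h1, h2]
    simp [smul_smul]
  · simp only [add_assoc] at *
    rw [secRatio, if_neg (by omega), h1, h2, h3]
    simp
  · simp only [add_assoc] at *
    rw [secRatio, if_neg (by omega), h2, h3, h4]
    simp

theorem exists_sec_aeval_mul_geom (Q : Polynomial ℝ) :
    ∃ P : Polynomial ℝ, (∀ k, P.coeff k = secRatio k * Q.coeff k) ∧
      sec (Q.aeval twist * geom) =
        sec (P.aeval twist * ((1 + X - C (1 / 2) * X ^ 2) * geomCubed)) := by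
  induction Q using Polynomial.induction_on' with
  | add p q hp hq =>
    obtain ⟨p', hp, hp'⟩ := hp
    obtain ⟨q', hq, hq'⟩ := hq
    refine ⟨p' + q', fun k => by simp [hp, hq]; ring, ?_⟩
    simp only [map_add, add_mul, hp', hq']
  | monomial k a =>
    refine ⟨Polynomial.monomial k (secRatio k * a), fun l => ?_, ?_⟩
    · simp only [Polynomial.coeff_monomial]
      split_ifs with h
      · rw [h]
      · simp
    · simp only [Polynomial.aeval_monomial, ← Algebra.smul_def, smul_mul_assoc, map_smul, mul_smul,
        sec_twist_pow_mul_geom k]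
      rw [smul_comm]

theorem exists_sec_aeval_mul_eigSum (B : Polynomial ℝ) :
    ∃ Q : Polynomial ℝ, (∀ d, B.natDegree ≤ d → Q.natDegree ≤ d + 1 ∧
        Q.coeff (d + 1) = -4 * B.coeff d) ∧
      sec (B.aeval twist * (eigSum * geom)) = sec (Q.aeval twist * geom) := by
  choose α hα using sec_twist_pow_mul_eigSum
  suffices h : ∃ Q : Polynomial ℝ, (∀ k, Q.coeff k = α k * B.coeff k) ∧
      sec (B.aeval twist * (eigSum * geom)) =
        sec ((Q - 4 • (Polynomial.X * B)).aeval twist * geom) by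
    obtain ⟨Q, hQ, h⟩ := h
    refine ⟨_, fun d hd => ⟨?_, ?_⟩, h⟩
    · refine Polynomial.natDegree_le_iff_coeff_eq_zero.2 fun N hN => ?_
      obtain ⟨N, rfl⟩ : ∃ N', N = N' + 1 := ⟨N - 1, by omega⟩
      simp [hQ, Polynomial.coeff_eq_zero_of_natDegree_lt (show B.natDegree < N + 1 by omega),
        Polynomial.coeff_eq_zero_of_natDegree_lt (show B.natDegree < N by omega)]
    · simp [hQ, Polynomial.coeff_eq_zero_of_natDegree_lt (show B.natDegree < d + 1 by omega)]
  induction B using Polynomial.induction_on' with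
  | add p q hp hq =>
    obtain ⟨p', hp, hp'⟩ := hp
    obtain ⟨q', hq, hq'⟩ := hq
    refine ⟨p' + q', fun k => by simp [hp, hq]; ring, ?_⟩
    rw [map_add, add_mul, map_add, hp', hq', ← map_add, ← add_mul, ← map_add]
    congr 3
    rw [mul_add, smul_add]
    abel
  | monomial k a =>
    refine ⟨Polynomial.monomial k (α k * a), fun l => ?_, ?_⟩
    · simp only [Polynomial.coeff_monomial]
      split_ifs with h
      · rw [h]
      · simp
    · rw [map_sub, map_nsmul, map_mul (Polynomial.aeval twist), Polynomial.aeval_X, sub_mul,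
        map_sub]
      simp only [Polynomial.aeval_monomial, ← Algebra.smul_def, smul_mul_assoc, map_smul,
        hα, mul_smul_comm, map_nsmul, ← pow_succ']
      module

/-- The power sums of the eigenvalues `3 / (1 - X)` and `1 - X`. -/
noncomputable def eigPowSum (j : ℕ) : ℝ⟦X⟧ := (3 * geom) ^ j + (1 - X) ^ j

theorem eigPowSum_add_two (j : ℕ) :
    eigPowSum (j + 2) = eigSum * eigPowSum (j + 1) - 3 * eigPowSum j := by
  rw [eigPowSum, eigPowSum, eigPowSum, eigSum]
  linear_combination (3 * (3 * geom) ^ j + 3 * (1 - X) ^ j) * (-geom_mul_one_sub)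

theorem exists_eigPowSum_eq (j : ℕ) :
    ∃ A B : Polynomial ℝ, A.natDegree ≤ j ∧ B.natDegree ≤ j ∧ B.coeff j = (-4) ^ j ∧
      eigPowSum (j + 1) = A.aeval twist + B.aeval twist * eigSum := by
  induction j using Nat.twoStepInduction with
  | zero => exact ⟨0, 1, by simp, by simp, by simp, by simp [eigPowSum, eigSum]⟩
  | one =>
    refine ⟨12 * Polynomial.X - 6, 4 * (1 - Polynomial.X), by compute_degree, by compute_degree,
      by simp [Polynomial.coeff_one], ?_⟩
    rw [eigPowSum_add_two]
    simp only [map_mul, map_sub, map_ofNat, map_one, Polynomial.aeval_X]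
    have h0 : eigPowSum 0 = 2 := by simp [eigPowSum]; norm_num
    have h1 : eigPowSum (0 + 1) = eigSum := by simp [eigPowSum, eigSum]
    rw [h0, h1]
    linear_combination eigSum_sq
  | more j ih₁ ih₂ =>
    obtain ⟨A, B, hA, hB, hB', h⟩ := ih₁
    obtain ⟨A', B', hA', hB₁, hB₁', h'⟩ := ih₂
    rw [Polynomial.natDegree_le_iff_coeff_eq_zero] at hA hB hA' hB₁
    refine ⟨12 * (Polynomial.X * B') - 3 * A, A' + 4 * (B' - Polynomial.X * B') - 3 * B,
      ?_, ?_, ?_, ?_⟩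
    · refine Polynomial.natDegree_le_iff_coeff_eq_zero.2 fun N hN => ?_
      obtain ⟨N, rfl⟩ : ∃ N', N = N' + 1 := ⟨N - 1, by omega⟩
      simp [Polynomial.coeff_ofNat_mul, hA (N + 1) (by omega), hB₁ N (by omega)]
    · refine Polynomial.natDegree_le_iff_coeff_eq_zero.2 fun N hN => ?_
      obtain ⟨N, rfl⟩ : ∃ N', N = N' + 1 := ⟨N - 1, by omega⟩
      simp [Polynomial.coeff_ofNat_mul, hA' (N + 1) (by omega), hB (N + 1) (by omega),
        hB₁ N (by omega), hB₁ (N + 1) (by omega)]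
    · simp [Polynomial.coeff_ofNat_mul, hA' (j + 2) (by omega), hB (j + 2) (by omega),
        hB₁', hB₁ (j + 2) (by omega)]
      ring
    · rw [eigPowSum_add_two, h, h']
      simp only [map_mul, map_add, map_sub, map_ofNat, Polynomial.aeval_X]
      linear_combination Polynomial.aeval twist B' * eigSum_sq

theorem exists_sec_eigPowSum_mul_geom (j : ℕ) :
    ∃ P : Polynomial ℝ, P.natDegree ≤ j ∧
      P.coeff j = (if j = 0 then 2 else 1) * ((-4) ^ j * secRatio j) ∧
      sec (eigPowSum j * geom) =
        sec (P.aeval twist * ((1 + X - C (1 / 2) * X ^ 2) * geomCubed)) := by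
  suffices h : ∃ Q : Polynomial ℝ, Q.natDegree ≤ j ∧
      Q.coeff j = (if j = 0 then 2 else 1) * (-4) ^ j ∧
      sec (eigPowSum j * geom) = sec (Q.aeval twist * geom) by
    obtain ⟨Q, hQ, hQ', h⟩ := h
    obtain ⟨P, hP, hP'⟩ := exists_sec_aeval_mul_geom Q
    refine ⟨P, ?_, ?_, h.trans hP'⟩
    · refine Polynomial.natDegree_le_iff_coeff_eq_zero.2 fun N hN => ?_
      rw [hP, Polynomial.natDegree_le_iff_coeff_eq_zero.1 hQ N hN, mul_zero]
    · rw [hP, hQ']; ring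
  obtain _ | j := j
  · refine ⟨2, by simp, by simp, ?_⟩
    have h0 : eigPowSum 0 = 2 := by simp [eigPowSum]; norm_num
    rw [h0, map_ofNat]
  · obtain ⟨A, B, hA, hB, hB', h⟩ := exists_eigPowSum_eq j
    obtain ⟨Q, hQ, hQ'⟩ := exists_sec_aeval_mul_eigSum B
    refine ⟨A + Q, ?_, ?_, ?_⟩
    · exact (Polynomial.natDegree_add_le _ _).trans (max_le (by omega) (hQ j hB).1)
    · rw [Polynomial.coeff_add, Polynomial.coeff_eq_zero_of_natDegree_lt (by omega), (hQ j hB).2,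
        hB', if_neg (by omega)]
      ring
    · rw [h, add_mul, map_add, mul_assoc, hQ', ← map_add, ← add_mul, ← map_add]

theorem oneSubPow_half_sq : oneSubPow (1 / 2) ^ 2 = 1 - X := by
  rw [sq, ← oneSubPow_add, ← pow_one (1 - X : ℝ⟦X⟧), ← oneSubPow_natCast]
  norm_num

theorem constantCoeff_subst_twist (f : ℝ⟦X⟧) :
    constantCoeff (f.subst twist) = constantCoeff f := by
  refine (constantCoeff_subst hasSubst_twist f).trans ?_
  rw [finsum_eq_single _ 0 fun d hd => ?_]
  · simp
  · have h : constantCoeff (twist ^ d) = 0 := by simp [twist, hd]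
    exact (congrArg (coeff d f • ·) h).trans (smul_zero _)

theorem subst_twist_mul_expand :
    (oneSubPow (1 / 2)).subst twist * expand 3 three_ne_zero (oneSubPow (1 / 2)) =
      1 + X - C (1 / 2) * X ^ 2 := by
  have hS : ((oneSubPow (1 / 2)).subst twist : ℝ⟦X⟧) ^ 2 = 1 - twist := by
    rw [← subst_pow hasSubst_twist, oneSubPow_half_sq, ← coe_substAlgHom hasSubst_twist, map_sub,
      map_one, coe_substAlgHom, subst_X hasSubst_twist]
  have hX : (expand 3 three_ne_zero (oneSubPow (1 / 2))) ^ 2 = 1 - X ^ 3 := by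
    rw [← map_pow, oneSubPow_half_sq]; simp
  have hsq : ((oneSubPow (1 / 2)).subst twist *
      expand 3 three_ne_zero (oneSubPow (1 / 2))) ^ 2 = (1 + X - C (1 / 2) * X ^ 2) ^ 2 := by
    have h4 : (4 : ℝ⟦X⟧) ≠ 0 := fun h => by
      have := congrArg constantCoeff h
      rw [map_ofNat] at this
      norm_num at this
    rw [mul_pow, hS, hX]
    refine mul_left_cancel₀ h4 ?_
    have h2 := two_mul_C_half
    linear_combination -(1 - X ^ 3) * four_mul_twist + X * (8 + X ^ 3) * geomCubed_mul_one_sub +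
      (4 * (1 + X) * X ^ 2 - (2 * C (1 / 2) + 1) * X ^ 4) * h2
  rcases sq_eq_sq_iff_eq_or_eq_neg.1 hsq with h | h
  · exact h
  · have := congrArg constantCoeff h
    simp [constantCoeff_subst_twist, constantCoeff_oneSubPow] at this
    norm_num at this

/-- The lower triangular matrix relating the coefficients of a series `f` to those of
`f(twist) / √(1 - X³)`. -/
noncomputable def lowerCoeff (i l : ℕ) : ℝ :=
  coeff i (X ^ l * (twistCore ^ (3 * l + 2) * (oneSubPow (1 / 2) * geom)))

theorem lowerCoeff_eq_zero {i l : ℕ} (h : i < l) : lowerCoeff i l = 0 := by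
  rw [lowerCoeff, coeff_X_pow_mul', if_neg (by omega)]

theorem lowerCoeff_self (i : ℕ) : lowerCoeff i i = 4 * (-8) ^ i := by
  rw [lowerCoeff, coeff_X_pow_mul', if_pos le_rfl]
  simp [constantCoeff_twistCore, constantCoeff_oneSubPow, geom, pow_add, pow_mul]
  norm_num
  ring

theorem sum_range_three_mul {M : Type*} [AddCommMonoid M] (f : ℕ → M) (n : ℕ) :
    ∑ d ∈ Finset.range (3 * n), f d =
      ∑ l ∈ Finset.range n, (f (3 * l) + f (3 * l + 1) + f (3 * l + 2)) := by
  induction n with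
  | zero => simp
  | succ n ih =>
    rw [Finset.sum_range_succ, ← ih, mul_add, mul_one]
    simp [Finset.sum_range_succ, add_assoc]

theorem coeff_sec_subst_twist_mul (W : ℝ⟦X⟧) {i n : ℕ} (h : i < n) :
    coeff i (sec (W.subst twist * expand 3 three_ne_zero (oneSubPow (1 / 2) * geom))) =
      ∑ l ∈ Finset.range n, lowerCoeff i l * coeff (3 * l + 2) W := by
  set G := oneSubPow (1 / 2) * geom with hG
  have hd : ∀ d, twist ^ d * expand 3 three_ne_zero G =
      X ^ d * expand 3 three_ne_zero (twistCore ^ d * G) := fun d => by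
    rw [twist_pow, map_mul _ (twistCore ^ d), mul_assoc]
  conv_lhs => rw [eq_X_pow_mul_shift_add_trunc (3 * n) W]
  rw [subst_add hasSubst_twist, subst_mul hasSubst_twist, subst_pow hasSubst_twist,
    subst_X hasSubst_twist, add_mul, map_add, map_add, mul_right_comm, hd, mul_assoc,
    sec_X_pow_mul, coeff_X_pow_mul', if_neg (by omega), zero_add]
  have hdeg : (trunc (3 * n) W).natDegree < 3 * n := by
    obtain ⟨m, hm⟩ : ∃ m, 3 * n = m + 1 := ⟨3 * n - 1, by omega⟩
    rw [hm]
    exact natDegree_trunc_lt W m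
  rw [subst_coe hasSubst_twist, Polynomial.aeval_eq_sum_range' hdeg, sum_range_three_mul,
    Finset.sum_mul, map_sum, map_sum]
  refine Finset.sum_congr rfl fun l hl => ?_
  have hl := Finset.mem_range.1 hl
  simp only [add_mul, smul_mul_assoc, hd, map_add, map_smul]
  rw [(sec_X_pow_mul_expand l _).1, (sec_X_pow_mul_expand l _).2.1,
    (sec_X_pow_mul_expand l _).2.2.1, coeff_trunc (3 * l + 2), if_pos (by omega), lowerCoeff]
  simp [hG, mul_comm]

theorem coeff_polynomial_mul_oneSubPow {P : Polynomial ℝ} {n : ℕ} (h : P.natDegree < n) (m : ℕ)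
    (r : ℝ) :
    coeff m ((P : ℝ⟦X⟧) * oneSubPow r) =
      ∑ k ∈ Finset.range n, coeff m (oneSubPow (k + r)) * (P.comp (1 - Polynomial.X)).coeff k := by
  have hP : (P.comp (1 - Polynomial.X)).comp (1 - Polynomial.X) = P := by
    rw [Polynomial.comp_assoc]; simp
  have hdeg : (P.comp (1 - Polynomial.X)).natDegree < n := by
    have h1 : (1 - Polynomial.X : Polynomial ℝ).natDegree ≤ 1 := by compute_degree
    have h2 := P.natDegree_comp_le (q := 1 - Polynomial.X)
    nlinarith
  have hcoe : (P : ℝ⟦X⟧) =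
      ∑ k ∈ Finset.range n, C ((P.comp (1 - Polynomial.X)).coeff k) * (1 - X) ^ k := by
    conv_lhs => rw [← hP]
    rw [Polynomial.comp, Polynomial.eval₂_eq_sum_range' _ hdeg,
      ← Polynomial.coeToPowerSeries.ringHom_apply, map_sum]
    simp
  rw [hcoe, Finset.sum_mul, map_sum]
  refine Finset.sum_congr rfl fun k _ => ?_
  rw [mul_assoc, coeff_C_mul, oneSubPow_add, oneSubPow_natCast, mul_comm]

theorem coeff_comp_one_sub_X {P : Polynomial ℝ} {j : ℕ} (h : P.natDegree ≤ j) :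
    (∀ k, j < k → (P.comp (1 - Polynomial.X)).coeff k = 0) ∧
      (P.comp (1 - Polynomial.X)).coeff j = (-1) ^ j * P.coeff j := by
  have h1 : (1 - Polynomial.X : Polynomial ℝ).natDegree = 1 := by
    rw [← Polynomial.natDegree_neg]; simpa using Polynomial.natDegree_X_sub_C (1 : ℝ)
  have h2 : (1 - Polynomial.X : Polynomial ℝ).leadingCoeff = -1 := by
    rw [Polynomial.leadingCoeff, h1]; simp [Polynomial.coeff_one]
  have h3 := P.natDegree_comp (q := 1 - Polynomial.X)
  rw [h1, mul_one] at h3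
  refine ⟨fun k hk => Polynomial.coeff_eq_zero_of_natDegree_lt (by omega), ?_⟩
  rcases h.eq_or_lt with rfl | h
  · have := P.leadingCoeff_comp (q := 1 - Polynomial.X) (by rw [h1]; exact one_ne_zero)
    rw [Polynomial.leadingCoeff, h3, h2] at this
    rw [this, mul_comm]; rfl
  · rw [Polynomial.coeff_eq_zero_of_natDegree_lt h, mul_zero,
      Polynomial.coeff_eq_zero_of_natDegree_lt (by omega)]

theorem exists_coeff_sec_eigPowSum_mul_geom (j : ℕ) :
    ∃ u : ℕ → ℝ, (∀ k, j < k → u k = 0) ∧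
      u j = (if j = 0 then 2 else 1) * (4 ^ j * secRatio j) ∧
      ∀ n i, i < n → j < n → coeff (3 * i + 2) (eigPowSum j * geom) =
        ∑ l ∈ Finset.range n, lowerCoeff i l *
          ∑ k ∈ Finset.range n, coeff (3 * l + 2) (oneSubPow (k + 1 / 2)) * u k := by
  obtain ⟨P, hP, hP', h⟩ := exists_sec_eigPowSum_mul_geom j
  obtain ⟨h1, h2⟩ := coeff_comp_one_sub_X hP
  refine ⟨_, h1, ?_, fun n i hi hj => ?_⟩
  · rw [h2, hP', mul_left_comm, ← mul_assoc ((-1) ^ j), ← mul_pow]; norm_num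
  · rw [← coeff_sec, h, ← subst_twist_mul_expand, ← subst_coe hasSubst_twist, mul_assoc, geomCubed,
      ← map_mul, ← mul_assoc, ← subst_mul hasSubst_twist, coeff_sec_subst_twist_mul _ hi]
    simp only [coeff_polynomial_mul_oneSubPow (lt_of_le_of_lt hP hj)]

/-- The determinant of the coefficients of half-integral powers of `1 - X`. -/
noncomputable def halfPowDet (n : ℕ) : ℝ :=
  (Matrix.of fun i k : Fin n => coeff (3 * (i : ℕ) + 2) (oneSubPow ((k : ℕ) + 1 / 2))).det

theorem binom_entry (i j : ℕ) :
    (3 : ℝ) ^ j * binom (3 * (i : ℤ) + (j : ℤ) + 2) (3 * i + 2) +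
      binom (3 * (i : ℤ) - (j : ℤ) + 2) (3 * i + 2) = coeff (3 * i + 2) (eigPowSum j * geom) := by
  have hg : geom = oneSubPow (-1) := by
    refine mul_right_cancel₀ (b := 1 - X) (fun h => ?_) ?_
    · simpa using congrArg constantCoeff h
    · rw [geom_mul_one_sub, ← pow_one (1 - X : ℝ⟦X⟧), ← oneSubPow_natCast, ← oneSubPow_add]
      simpa using (oneSubPow_natCast 0).symm
  have hgp : ∀ m : ℕ, geom ^ m = oneSubPow (-m) := fun m => by
    induction m with
    | zero => simpa using (oneSubPow_natCast 0).symm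
    | succ m ih => rw [pow_succ, ih, hg, ← oneSubPow_add]; push_cast; ring_nf
  have e : eigPowSum j * geom =
      C (3 ^ j) * oneSubPow (-((j + 1 : ℕ) : ℝ)) + oneSubPow (j + -1) := by
    rw [← hgp, oneSubPow_add, oneSubPow_natCast, ← hg, eigPowSum, map_pow, map_ofNat]
    ring
  rw [e, map_add, coeff_C_mul, coeff_oneSubPow_eq_binom (3 * (i : ℤ) + (j : ℤ) + 2),
    coeff_oneSubPow_eq_binom (3 * (i : ℤ) - (j : ℤ) + 2)]
  · push_cast; ring
  · push_cast; ring

theorem det_eq_halfPowDet {n : ℕ} (hn : 0 < n) :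
    (Matrix.of fun i j : Fin n => coeff (3 * (i : ℕ) + 2) (eigPowSum j * geom)).det =
      2 * (∏ j ∈ Finset.range n, 4 ^ j * secRatio j * (4 * (-8) ^ j)) * halfPowDet n := by
  choose u hu hu' h using exists_coeff_sec_eigPowSum_mul_geom
  have hfac : (Matrix.of fun i j : Fin n => coeff (3 * (i : ℕ) + 2) (eigPowSum j * geom)) =
      Matrix.of (fun i l : Fin n => lowerCoeff i l) *
        (Matrix.of (fun i k : Fin n => coeff (3 * (i : ℕ) + 2) (oneSubPow ((k : ℕ) + 1 / 2))) *
          Matrix.of fun k j : Fin n => u j k) := by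
    ext i j
    simp only [Matrix.mul_apply, Matrix.of_apply]
    rw [h j n i i.2 j.2, Finset.sum_range]
    simp only [Finset.sum_range]
  have hL : (Matrix.of (fun i l : Fin n => lowerCoeff i l)).det =
      ∏ j ∈ Finset.range n, 4 * (-8) ^ j := by
    have hlow : (Matrix.of (fun i l : Fin n => lowerCoeff i l)).IsLowerTriangular :=
      fun i l hil => lowerCoeff_eq_zero (OrderDual.toDual_lt_toDual.1 hil)
    rw [Matrix.det_of_isLowerTriangular _ hlow, Finset.prod_range]
    simp [lowerCoeff_self]
  have hU : (Matrix.of (fun k j : Fin n => u j k)).det =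
      2 * ∏ j ∈ Finset.range n, 4 ^ j * secRatio j := by
    have hup : (Matrix.of (fun k j : Fin n => u j k)).IsUpperTriangular :=
      fun k j hkj => hu _ _ hkj
    rw [Matrix.det_of_isUpperTriangular hup]
    simp only [Matrix.of_apply, hu']
    rw [← Finset.prod_range (fun j => (if j = 0 then 2 else 1) * (4 ^ j * secRatio j)),
      Finset.prod_mul_distrib]
    congr 1
    rw [Finset.prod_ite_eq' (Finset.range n) 0 fun _ => (2 : ℝ)]
    simp [hn]
  rw [hfac, Matrix.det_mul, Matrix.det_mul, hL, hU, halfPowDet,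
    Finset.prod_mul_distrib (f := fun j => 4 ^ j * secRatio j)]
  ring

end PowerSeries

theorem Matrix.det_prod_Ico_sub {R : Type*} [CommRing R] [Nontrivial R] (n : ℕ) (x c : ℕ → R) :
    (Matrix.of fun i k : Fin n => ∏ l ∈ Finset.Ico ((k : ℕ) + 1) n, (x i - c l)).det =
      ∏ j : Fin n, ∏ i : Fin j, (x i - x j) := by
  have key := Matrix.det_eval_matrixOfPolynomials_eq_det_vandermonde
    (fun i : Fin n => x (Fin.rev i))
    (fun k => ∏ l ∈ Finset.Ico ((Fin.rev k : ℕ) + 1) n, (Polynomial.X - Polynomial.C (c l)))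
    (fun k => by
      rw [Polynomial.natDegree_prod_of_monic _ _ fun l _ => Polynomial.monic_X_sub_C _]
      simp [Fin.val_rev]; omega)
    (fun k => Polynomial.monic_prod_of_monic _ _ fun l _ => Polynomial.monic_X_sub_C _)
  have hdet : (Matrix.of fun i k : Fin n => ∏ l ∈ Finset.Ico ((k : ℕ) + 1) n, (x i - c l)).det =
      (Matrix.vandermonde fun i : Fin n => x (Fin.rev i)).det := by
    rw [key, ← Matrix.det_submatrix_equiv_self Fin.revPerm]
    congr 1
    ext i k
    simp [Polynomial.eval_prod]
  rw [hdet, Matrix.det_vandermonde]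
  clear key hdet
  induction n with
  | zero => simp
  | succ n ih =>
    rw [Fin.prod_univ_succ, Fin.prod_univ_castSucc, mul_comm]
    simp only [Fin.prod_Ioi_zero, Fin.prod_Ioi_succ, Fin.rev_succ, Fin.rev_zero, Fin.val_last,
      Fin.val_castSucc, ih]
    congr 1
    exact Equiv.prod_comp Fin.revPerm fun i : Fin n => x i - x n

namespace PowerSeries

theorem prod_half_shift (N k : ℕ) :
    (∏ m ∈ Finset.range N, ((m : ℝ) - (k + 1 / 2))) *
        ∏ l ∈ Finset.range (k + 1), ((N : ℝ) - (l + 1 / 2)) =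
      (∏ l ∈ Finset.range k, ((l : ℝ) - (k + 1 / 2))) *
        ∏ l ∈ Finset.range (N + 1), ((l : ℝ) - 1 / 2) := by
  induction k with
  | zero => simp [Finset.prod_range_succ]
  | succ k ih =>
    have h1 := (Finset.prod_range_succ (fun m : ℕ => (m : ℝ) - ((k + 1 : ℕ) + 1 / 2)) N).symm.trans
      (Finset.prod_range_succ' _ N)
    have h2 := Finset.prod_range_succ' (fun m : ℕ => (m : ℝ) - ((k + 1 : ℕ) + 1 / 2)) k
    have h3 : ∀ N : ℕ, ∏ m ∈ Finset.range N, (((m + 1 : ℕ) : ℝ) - ((k + 1 : ℕ) + 1 / 2)) =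
        ∏ m ∈ Finset.range N, ((m : ℝ) - (k + 1 / 2)) := fun N =>
      Finset.prod_congr rfl fun m _ => by push_cast; ring
    rw [h3] at h1 h2
    rw [Finset.prod_range_succ _ (k + 1), h2]
    linear_combination (∏ l ∈ Finset.range (k + 1), ((N : ℝ) - (l + 1 / 2))) * h1 +
      (((0 : ℕ) : ℝ) - ((k + 1 : ℕ) + 1 / 2)) * ih

theorem natCast_sub_half_ne_zero (a b : ℕ) : (a : ℝ) - (b + 1 / 2) ≠ 0 := by
  intro h
  have h2 : ((2 * a : ℕ) : ℝ) = (2 * b + 1 : ℕ) := by push_cast; linarith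
  have := Nat.cast_injective h2
  omega

theorem halfPowDet_eq (n : ℕ) :
    halfPowDet n =
      (∏ k ∈ Finset.range n, ∏ l ∈ Finset.range k, ((l : ℝ) - (k + 1 / 2))) *
      (∏ i ∈ Finset.range n, (∏ l ∈ Finset.range (3 * i + 3), ((l : ℝ) - 1 / 2)) /
        ((3 * i + 2).factorial : ℝ)) *
      (∏ j ∈ Finset.range n, ∏ i ∈ Finset.range j, (((3 * i + 2 : ℕ) : ℝ) - (3 * j + 2 : ℕ))) /
      ∏ i ∈ Finset.range n, ∏ l ∈ Finset.range n, (((3 * i + 2 : ℕ) : ℝ) - (l + 1 / 2)) := by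
  have hne : ∀ i n : ℕ, ∏ l ∈ Finset.range n, (((3 * i + 2 : ℕ) : ℝ) - (l + 1 / 2)) ≠ 0 :=
    fun i n => Finset.prod_ne_zero_iff.2 fun l _ => natCast_sub_half_ne_zero _ _
  have hentry : (Matrix.of fun i k : Fin n =>
      coeff (3 * (i : ℕ) + 2) (oneSubPow ((k : ℕ) + 1 / 2))) =
      Matrix.of fun i k : Fin n => (∏ l ∈ Finset.range k, ((l : ℝ) - ((k : ℕ) + 1 / 2))) *
        Matrix.of (fun i k : Fin n => ((∏ l ∈ Finset.range (3 * i + 3), ((l : ℝ) - 1 / 2)) /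
          ((3 * (i : ℕ) + 2).factorial : ℝ) /
          ∏ l ∈ Finset.range n, (((3 * i + 2 : ℕ) : ℝ) - (l + 1 / 2))) *
          Matrix.of (fun i k : Fin n => ∏ l ∈ Finset.Ico ((k : ℕ) + 1) n,
            (((3 * i + 2 : ℕ) : ℝ) - (l + 1 / 2))) i k) i k := by
    ext i k
    simp only [Matrix.of_apply]
    have h1 := hne i (k + 1)
    have h2 := Finset.prod_range_mul_prod_Ico (fun l : ℕ => ((3 * i + 2 : ℕ) : ℝ) - (l + 1 / 2))
      (show (k : ℕ) + 1 ≤ n from k.2)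
    have h3 : ∏ l ∈ Finset.Ico ((k : ℕ) + 1) n, (((3 * i + 2 : ℕ) : ℝ) - (l + 1 / 2)) ≠ 0 :=
      Finset.prod_ne_zero_iff.2 fun l _ => natCast_sub_half_ne_zero _ _
    rw [coeff_oneSubPow, ← h2, eq_div_of_mul_eq h1 (prod_half_shift (3 * i + 2) k)]
    have alg : ∀ a b f q r : ℝ, f ≠ 0 → q ≠ 0 → r ≠ 0 → a * b / q / f = a * (b / f / (q * r) * r) :=
      fun a b f q r hf hq hr => by field_simp
    exact alg _ _ _ _ _ (Nat.cast_ne_zero.2 (Nat.factorial_ne_zero _)) h1 h3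
  rw [halfPowDet, hentry, Matrix.det_mul_row, Matrix.det_mul_column,
    Matrix.det_prod_Ico_sub n (fun i => ((3 * i + 2 : ℕ) : ℝ)) fun l => (l : ℝ) + 1 / 2,
    Finset.prod_div_distrib]
  simp only [Finset.prod_range]
  ring

theorem halfPowDet_succ (n : ℕ) :
    halfPowDet (n + 1) = halfPowDet n *
      ((∏ l ∈ Finset.range n, ((l : ℝ) - (n + 1 / 2))) *
        (∏ l ∈ Finset.range (3 * n + 3), ((l : ℝ) - 1 / 2)) *
        (∏ i ∈ Finset.range n, (((3 * i + 2 : ℕ) : ℝ) - (3 * n + 2 : ℕ))) /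
        (((3 * n + 2).factorial : ℝ) *
          (∏ i ∈ Finset.range n, (((3 * i + 2 : ℕ) : ℝ) - (n + 1 / 2))) *
          ∏ l ∈ Finset.range (n + 1), (((3 * n + 2 : ℕ) : ℝ) - (l + 1 / 2)))) := by
  rw [halfPowDet_eq, halfPowDet_eq]
  have hlast : ∀ f : ℕ → ℕ → ℝ,
      ∏ i ∈ Finset.range (n + 1), ∏ l ∈ Finset.range (n + 1), f i l =
        (∏ i ∈ Finset.range n, ∏ l ∈ Finset.range n, f i l) * (∏ i ∈ Finset.range n, f i n) *
          ∏ l ∈ Finset.range (n + 1), f n l := fun f => by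
    rw [Finset.prod_range_succ (fun i => ∏ l ∈ Finset.range (n + 1), f i l),
      ← Finset.prod_mul_distrib]
    simp only [Finset.prod_range_succ]
  rw [hlast, Finset.prod_range_succ _ n, Finset.prod_range_succ _ n, Finset.prod_range_succ _ n]
  ring

theorem secRatio_add_three (n : ℕ) : secRatio (n + 3) = secRatio n := by
  simp [secRatio]

theorem pivot_identity (n : ℕ) :
    (-96) ^ n * 16 * secRatio n * (∏ l ∈ Finset.range n, ((l : ℝ) + 3 / 2)) *
        (∏ l ∈ Finset.range (2 * n + 2), ((l : ℝ) - 1 / 2)) * (n.factorial : ℝ) * (3 * n + 3) *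
        ∏ k ∈ Finset.range (n + 1), (((n : ℝ) + 3) / 3 + k) =
      2 ^ n * ((4 * n + 4).factorial : ℝ) *
        ∏ i ∈ Finset.range n, (3 * (i : ℝ) + 3 / 2 - n) := by
  induction n using Nat.strong_induction_on with
  | _ n ih =>
  obtain h | ⟨n, rfl⟩ : n < 3 ∨ ∃ m, n = m + 3 := by
    rcases lt_or_ge n 3 with h | h
    · exact Or.inl h
    · exact Or.inr ⟨n - 3, by omega⟩
  · interval_cases n <;> norm_num [secRatio, Finset.prod_range_succ, Nat.factorial]
  · have ih := ih n (by omega)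
    have hH : ((n : ℝ) + 3) / 3 *
        ∏ k ∈ Finset.range (n + 3 + 1), ((((n + 3 : ℕ) : ℝ) + 3) / 3 + k) =
        (∏ k ∈ Finset.range (n + 1), (((n : ℝ) + 3) / 3 + k)) *
          ((((n : ℝ) + 3) / 3 + (n + 1)) * (((n : ℝ) + 3) / 3 + (n + 2)) *
            (((n : ℝ) + 3) / 3 + (n + 3)) * (((n : ℝ) + 3) / 3 + (n + 4))) := by
      have h1 := (Finset.prod_range_succ' (fun k : ℕ => ((n : ℝ) + 3) / 3 + k) (n + 4))
      have h2 : ∏ k ∈ Finset.range (n + 3 + 1), ((((n + 3 : ℕ) : ℝ) + 3) / 3 + k) =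
          ∏ k ∈ Finset.range (n + 4), (((n : ℝ) + 3) / 3 + ((k + 1 : ℕ) : ℝ)) :=
        Finset.prod_congr rfl fun k _ => by push_cast; ring
      rw [Nat.cast_zero, add_zero] at h1
      rw [h2, mul_comm, ← h1]
      simp only [Finset.prod_range_succ _ (n + 1), Finset.prod_range_succ _ (n + 2),
        Finset.prod_range_succ _ (n + 3), Finset.prod_range_succ _ (n + 4)]
      push_cast
      ring
    have hD : ∏ i ∈ Finset.range (n + 3), (3 * (i : ℝ) + 3 / 2 - ((n + 3 : ℕ) : ℝ)) =
        (∏ i ∈ Finset.range n, (3 * (i : ℝ) + 3 / 2 - n)) *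
          ((-(3 / 2) - n) * (2 * n + 3 / 2) * (2 * n + 9 / 2)) := by
      have h2 : ∏ k ∈ Finset.range (n + 2), (3 * ((k + 1 : ℕ) : ℝ) + 3 / 2 - ((n + 3 : ℕ) : ℝ)) =
          ∏ k ∈ Finset.range (n + 2), (3 * (k : ℝ) + 3 / 2 - n) :=
        Finset.prod_congr rfl fun k _ => by push_cast; ring
      rw [Finset.prod_range_succ', h2, Finset.prod_range_succ, Finset.prod_range_succ]
      push_cast
      ring
    have hA : ∏ l ∈ Finset.range (n + 3), ((l : ℝ) + 3 / 2) =
        (∏ l ∈ Finset.range n, ((l : ℝ) + 3 / 2)) *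
          ((n + 3 / 2) * (n + 5 / 2) * (n + 7 / 2)) := by
      simp only [Finset.prod_range_succ]
      push_cast
      ring
    have hB : ∏ l ∈ Finset.range (2 * (n + 3) + 2), ((l : ℝ) - 1 / 2) =
        (∏ l ∈ Finset.range (2 * n + 2), ((l : ℝ) - 1 / 2)) *
          ((2 * n + 3 / 2) * (2 * n + 5 / 2) * (2 * n + 7 / 2) * (2 * n + 9 / 2) *
            (2 * n + 11 / 2) * (2 * n + 13 / 2)) := by
      rw [show 2 * (n + 3) + 2 = 2 * n + 8 by ring]
      simp only [Finset.prod_range_succ _ (2 * n + 2), Finset.prod_range_succ _ (2 * n + 3),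
        Finset.prod_range_succ _ (2 * n + 4), Finset.prod_range_succ _ (2 * n + 5),
        Finset.prod_range_succ _ (2 * n + 6), Finset.prod_range_succ _ (2 * n + 7)]
      push_cast
      ring
    have hn : ((n : ℝ) + 3) / 3 * (3 * n + 3) ≠ 0 := by positivity
    refine mul_left_cancel₀ hn ?_
    rw [secRatio_add_three, hA, hB, hD]
    have hf : ((n + 3).factorial : ℝ) = n.factorial * ((n + 1) * (n + 2) * (n + 3)) := by
      simp only [Nat.factorial_succ]
      push_cast
      ring
    have hf' : ((4 * (n + 3) + 4).factorial : ℝ) = (4 * n + 4).factorial *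
        ((4 * n + 5) * (4 * n + 6) * (4 * n + 7) * (4 * n + 8) * (4 * n + 9) * (4 * n + 10) *
          (4 * n + 11) * (4 * n + 12) * (4 * n + 13) * (4 * n + 14) * (4 * n + 15) *
          (4 * n + 16)) := by
      rw [show 4 * (n + 3) + 4 = 4 * n + 4 + 12 by ring]
      simp only [Nat.factorial_succ (4 * n + 4), Nat.factorial_succ (4 * n + 5),
        Nat.factorial_succ (4 * n + 6), Nat.factorial_succ (4 * n + 7),
        Nat.factorial_succ (4 * n + 8), Nat.factorial_succ (4 * n + 9),
        Nat.factorial_succ (4 * n + 10), Nat.factorial_succ (4 * n + 11),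
        Nat.factorial_succ (4 * n + 12), Nat.factorial_succ (4 * n + 13),
        Nat.factorial_succ (4 * n + 14), Nat.factorial_succ (4 * n + 15)]
      push_cast
      ring
    rw [hf, hf']
    generalize ∏ l ∈ Finset.range n, ((l : ℝ) + 3 / 2) = a at *
    generalize ∏ l ∈ Finset.range (2 * n + 2), ((l : ℝ) - 1 / 2) = b at *
    generalize ∏ k ∈ Finset.range (n + 3 + 1), ((((n + 3 : ℕ) : ℝ) + 3) / 3 + k) = H' at *
    generalize ∏ k ∈ Finset.range (n + 1), (((n : ℝ) + 3) / 3 + k) = H at *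
    generalize ∏ i ∈ Finset.range n, (3 * (i : ℝ) + 3 / 2 - n) = D at *
    generalize ((4 * n + 4).factorial : ℝ) = F at *
    generalize (n.factorial : ℝ) = f at *
    rw [pow_add, pow_add]
    generalize ((-96 : ℝ) ^ n) = p at *
    generalize ((2 : ℝ) ^ n) = q at *
    generalize secRatio n = s at *
    push_cast
    generalize (n : ℝ) = x at *
    linear_combination ((-96) ^ 3 *
        ((x + 3 / 2) * (x + 5 / 2) * (x + 7 / 2)) *
      ((2 * x + 3 / 2) * (2 * x + 5 / 2) * (2 * x + 7 / 2) * (2 * x + 9 / 2) *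
        (2 * x + 11 / 2) * (2 * x + 13 / 2)) *
      ((x + 1) * (x + 2) * (x + 3)) * (3 * x + 12) *
      (((x + 3) / 3 + (x + 1)) * ((x + 3) / 3 + (x + 2)) * ((x + 3) / 3 + (x + 3)) *
        ((x + 3) / 3 + (x + 4)))) * ih +
      ((3 * x + 3) * p * 16 * s * a * b * f * ((-96) ^ 3 *
        ((x + 3 / 2) * (x + 5 / 2) * (x + 7 / 2)) *
      ((2 * x + 3 / 2) * (2 * x + 5 / 2) * (2 * x + 7 / 2) * (2 * x + 9 / 2) *
        (2 * x + 11 / 2) * (2 * x + 13 / 2)) *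
      ((x + 1) * (x + 2) * (x + 3)) * (3 * x + 12))) * hH

theorem gamma_add_natCast {x : ℝ} (hx : 0 < x) (m : ℕ) :
    Real.Gamma (x + m) = Real.Gamma x * ∏ k ∈ Finset.range m, (x + k) := by
  induction m with
  | zero => simp
  | succ m ih =>
    rw [Nat.cast_succ, ← add_assoc, Real.Gamma_add_one (by positivity), ih,
      Finset.prod_range_succ]
    ring

theorem gamma_quotient (i : ℕ) :
    Real.Gamma (4 * (i : ℝ) + 1) * Real.Gamma (((i : ℝ) + 2) / 3) /
        (Real.Gamma (3 * (i : ℝ) + 1) * Real.Gamma ((4 * (i : ℝ) + 2) / 3)) =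
      ((4 * i).factorial : ℝ) /
        ((3 * i).factorial * ∏ k ∈ Finset.range i, (((i : ℝ) + 2) / 3 + k)) := by
  have h4 := Real.Gamma_nat_eq_factorial (4 * i)
  have h3 := Real.Gamma_nat_eq_factorial (3 * i)
  push_cast at h3 h4
  have hx : (0 : ℝ) < ((i : ℝ) + 2) / 3 := by positivity
  have hΓ := (Real.Gamma_pos_of_pos hx).ne'
  rw [h3, h4, show (4 * (i : ℝ) + 2) / 3 = ((i : ℝ) + 2) / 3 + i by ring, gamma_add_natCast hx]
  have alg : ∀ a g f p : ℝ, g ≠ 0 → a * g / (f * (g * p)) = a / (f * p) := fun a g f p hg => by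
    rw [mul_left_comm, mul_comm a g, mul_div_mul_left _ _ hg]
  exact alg _ _ _ _ hΓ

theorem pivot_eq (n : ℕ) :
    4 ^ n * secRatio n * (4 * (-8) ^ n) *
      ((∏ l ∈ Finset.range n, ((l : ℝ) - (n + 1 / 2))) *
        (∏ l ∈ Finset.range (3 * n + 3), ((l : ℝ) - 1 / 2)) *
        (∏ i ∈ Finset.range n, (((3 * i + 2 : ℕ) : ℝ) - (3 * n + 2 : ℕ))) /
        (((3 * n + 2).factorial : ℝ) *
          (∏ i ∈ Finset.range n, (((3 * i + 2 : ℕ) : ℝ) - (n + 1 / 2))) *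
          ∏ l ∈ Finset.range (n + 1), (((3 * n + 2 : ℕ) : ℝ) - (l + 1 / 2)))) =
      (2 : ℝ) ^ ((n : ℤ) - 2) * (((4 * (n + 1)).factorial : ℝ) /
        ((3 * (n + 1)).factorial *
          ∏ k ∈ Finset.range (n + 1), ((((n + 1 : ℕ) : ℝ) + 2) / 3 + k))) := by
  have hA : ∏ l ∈ Finset.range n, ((l : ℝ) - (n + 1 / 2)) =
      (-1) ^ n * ∏ l ∈ Finset.range n, ((l : ℝ) + 3 / 2) := by
    rw [← Finset.prod_range_reflect]
    conv_rhs => rw [← Finset.card_range n, ← Finset.prod_const, Finset.card_range]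
    rw [← Finset.prod_mul_distrib]
    refine Finset.prod_congr rfl fun l hl => ?_
    have := Finset.mem_range.1 hl
    rw [Nat.cast_sub (by omega), Nat.cast_sub (by omega)]
    push_cast; ring
  have hC : ∏ i ∈ Finset.range n, (((3 * i + 2 : ℕ) : ℝ) - (3 * n + 2 : ℕ)) =
      (-3) ^ n * (n.factorial : ℝ) := by
    rw [← Finset.prod_range_add_one_eq_factorial, Nat.cast_prod, ← Finset.prod_range_reflect]
    conv_rhs => rw [← Finset.card_range n, ← Finset.prod_const, Finset.card_range]
    rw [← Finset.prod_mul_distrib]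
    refine Finset.prod_congr rfl fun l hl => ?_
    have := Finset.mem_range.1 hl
    push_cast
    rw [Nat.cast_sub (by omega), Nat.cast_sub (by omega)]
    push_cast; ring
  have hD : ∏ i ∈ Finset.range n, (((3 * i + 2 : ℕ) : ℝ) - (n + 1 / 2)) =
      ∏ i ∈ Finset.range n, (3 * (i : ℝ) + 3 / 2 - n) :=
    Finset.prod_congr rfl fun i _ => by push_cast; ring
  have hE : ∏ l ∈ Finset.range (3 * n + 3), ((l : ℝ) - 1 / 2) =
      (∏ l ∈ Finset.range (2 * n + 2), ((l : ℝ) - 1 / 2)) *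
        ∏ l ∈ Finset.range (n + 1), (((3 * n + 2 : ℕ) : ℝ) - (l + 1 / 2)) := by
    rw [show 3 * n + 3 = 2 * n + 2 + (n + 1) by ring, Finset.prod_range_add,
      ← Finset.prod_range_reflect _ (n + 1)]
    congr 1
    refine Finset.prod_congr rfl fun l hl => ?_
    have := Finset.mem_range.1 hl
    rw [Nat.cast_add, Nat.cast_sub (by omega), Nat.cast_sub (by omega)]
    push_cast; ring
  have hH : ∏ k ∈ Finset.range (n + 1), ((((n + 1 : ℕ) : ℝ) + 2) / 3 + k) =
      ∏ k ∈ Finset.range (n + 1), (((n : ℝ) + 3) / 3 + k) :=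
    Finset.prod_congr rfl fun k _ => by push_cast; ring
  have hE0 : ∏ l ∈ Finset.range (n + 1), (((3 * n + 2 : ℕ) : ℝ) - (l + 1 / 2)) ≠ 0 :=
    Finset.prod_ne_zero_iff.2 fun l _ => natCast_sub_half_ne_zero _ _
  have hD0 : ∏ i ∈ Finset.range n, (((3 * i + 2 : ℕ) : ℝ) - (n + 1 / 2)) ≠ 0 :=
    Finset.prod_ne_zero_iff.2 fun l _ => natCast_sub_half_ne_zero _ _
  have hH0 : ∏ k ∈ Finset.range (n + 1), (((n : ℝ) + 3) / 3 + k) ≠ 0 :=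
    Finset.prod_ne_zero_iff.2 fun k _ => by positivity
  have hf0 : ((3 * n + 2).factorial : ℝ) ≠ 0 := Nat.cast_ne_zero.2 (Nat.factorial_ne_zero _)
  have hf : ((3 * (n + 1)).factorial : ℝ) = (3 * n + 3) * (3 * n + 2).factorial := by
    rw [show 3 * (n + 1) = 3 * n + 2 + 1 by ring, Nat.factorial_succ]
    push_cast; ring
  have hz : (2 : ℝ) ^ ((n : ℤ) - 2) = 2 ^ n / 4 := by
    rw [zpow_sub₀ two_ne_zero, zpow_natCast]; norm_num
  have hn0 : (3 * (n : ℝ) + 3) ≠ 0 := by positivity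
  have hp : (-96 : ℝ) ^ n = 4 ^ n * (-8) ^ n * (-1) ^ n * (-3) ^ n := by
    rw [← mul_pow, ← mul_pow, ← mul_pow]; norm_num
  have key := pivot_identity n
  rw [hp] at key
  rw [hD] at hD0
  rw [hE, hA, hC, hD, hH, hf, hz, show 4 * (n + 1) = 4 * n + 4 by ring]
  generalize ∏ l ∈ Finset.range (n + 1), (((3 * n + 2 : ℕ) : ℝ) - (l + 1 / 2)) = e at *
  generalize ∏ i ∈ Finset.range n, (3 * (i : ℝ) + 3 / 2 - n) = d at *
  generalize ∏ k ∈ Finset.range (n + 1), (((n : ℝ) + 3) / 3 + k) = h at *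
  generalize ∏ l ∈ Finset.range n, ((l : ℝ) + 3 / 2) = a at *
  generalize ∏ l ∈ Finset.range (2 * n + 2), ((l : ℝ) - 1 / 2) = b at *
  generalize ((3 * n + 2).factorial : ℝ) = f at *
  generalize ((4 * n + 4).factorial : ℝ) = f' at *
  generalize (3 * (n : ℝ) + 3) = c at *
  rw [← mul_div_assoc, div_mul_eq_mul_div, mul_div_assoc', div_div,
    div_eq_div_iff (by positivity) (by positivity)]
  linear_combination (f * e) * key

theorem prod_pivot_mul_halfPowDet (n : ℕ) :
    (∏ j ∈ Finset.range n, 4 ^ j * secRatio j * (4 * (-8) ^ j)) * halfPowDet n =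
      (2 : ℝ) ^ (((n : ℤ) * ((n : ℤ) - 5)) / 2) * ∏ i ∈ Finset.Icc 1 n,
          Real.Gamma (4 * (i : ℝ) + 1) * Real.Gamma (((i : ℝ) + 2) / 3)
            / (Real.Gamma (3 * (i : ℝ) + 1) * Real.Gamma ((4 * (i : ℝ) + 2) / 3)) := by
  induction n with
  | zero => simp [halfPowDet]
  | succ n ih =>
    have hexp : (((n + 1 : ℕ) : ℤ) * (((n + 1 : ℕ) : ℤ) - 5)) / 2 =
        ((n : ℤ) * ((n : ℤ) - 5)) / 2 + ((n : ℤ) - 2) := by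
      rw [← Int.add_mul_ediv_right _ _ two_ne_zero]
      congr 1
      push_cast; ring
    rw [Finset.prod_range_succ, halfPowDet_succ, Finset.prod_Icc_succ_top (by omega), hexp,
      zpow_add₀ two_ne_zero, gamma_quotient (n + 1), mul_mul_mul_comm, ih, pivot_eq]
    ring

end PowerSeries

theorem stmt_7 (n : ℕ) (hn : 0 < n) :
    (Matrix.of fun i j : Fin n =>
        (3 : ℝ) ^ (j : ℕ) * binom (3 * ((i : ℕ) : ℤ) + ((j : ℕ) : ℤ) + 2) (3 * (i : ℕ) + 2)
          + binom (3 * ((i : ℕ) : ℤ) - ((j : ℕ) : ℤ) + 2) (3 * (i : ℕ) + 2)).det =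
      2 * (2 : ℝ) ^ (((n : ℤ) * ((n : ℤ) - 5)) / 2) * ∏ i ∈ Finset.Icc 1 n,
          Real.Gamma (4 * (i : ℝ) + 1) * Real.Gamma (((i : ℝ) + 2) / 3)
            / (Real.Gamma (3 * (i : ℝ) + 1) * Real.Gamma ((4 * (i : ℝ) + 2) / 3)) := by
  simp only [PowerSeries.binom_entry]
  rw [PowerSeries.det_eq_halfPowDet hn, mul_assoc, PowerSeries.prod_pivot_mul_halfPowDet, mul_assoc]
end

section
/- For every positive integer n, the determinant of the n×n matrix whose (i,j)-entry (0 ≤ i,j ≤ n−1) is 2^{j+1}·binom(2i+j+1, 2i+1) + binom(2i−j−1, 2i+1) equals 2^{n(n−1)} times the product over i = 1 to n of Γ(i)·Γ(4i−1)·Γ((3i−2)/2) / (Γ(3i)·Γ(3i−2)·Γ(i/2)). -/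
open scoped BigOperators

/-- The `k`-th term of the terminating well-poised series
`₃F₂(a, -N, c; 1 + a + N, 1 + a - c; 1)`. -/
noncomputable def dixonTerm (a c : ℝ) (N k : ℕ) : ℝ :=
  ∏ j ∈ Finset.range k,
    (a + j) * (j - N) * (c + j) / ((1 + j) * (1 + a + N + j) * (1 + a - c + j))

lemma dixonTerm_succ_left (a c : ℝ) (N k : ℕ) (ha : ∀ j : ℕ, 1 + a + N + j ≠ 0) :
    dixonTerm a c (N + 1) k * ((N + 1 - k) * (1 + a + N + k)) =
      dixonTerm a c N k * ((N + 1) * (1 + a + N)) := by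
  induction k with
  | zero => simp [dixonTerm]
  | succ k ih =>
    have h1 := ha (k + 1)
    have h2 := ha k
    unfold dixonTerm at ih ⊢
    rw [Finset.prod_range_succ, Finset.prod_range_succ]
    push_cast at h1 h2 ⊢
    have h1' : 1 + a + ((N : ℝ) + 1) + k ≠ 0 := by
      intro h; apply h1; linarith
    have e1 : (a + k) * (k - ((N : ℝ) + 1)) * (c + k) /
        ((1 + k) * (1 + a + (N + 1) + k) * (1 + a - c + k)) *
        ((N + 1 - (k + 1)) * (1 + a + N + (k + 1))) =
        (a + k) * (k - (N : ℝ)) * (c + k) / ((1 + k) * (1 + a + N + k) * (1 + a - c + k)) *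
        ((N + 1 - k) * (1 + a + N + k)) := by
      have h3 : (1 : ℝ) + k ≠ 0 := by positivity
      by_cases h4 : 1 + a - c + k = 0
      · simp [h4]
      · field_simp
        ring
    push_cast at ih
    linear_combination (∏ x ∈ Finset.range k, (a + x) * (x - ((N : ℝ) + 1)) * (c + x) /
        ((1 + x) * (1 + a + (N + 1) + x) * (1 + a - c + x))) * e1 +
      (a + k) * (k - (N : ℝ)) * (c + k) / ((1 + k) * (1 + a + N + k) * (1 + a - c + k)) * ih

lemma dixonTerm_zeilberger (a c : ℝ) (N k : ℕ) (ha : ∀ j : ℕ, 1 + a + N + j ≠ 0)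
    (hc : ∀ j : ℕ, 1 + a - c + j ≠ 0) :
    (1 + a / 2 + N) * (1 + a - c + N) * dixonTerm a c (N + 1) k -
        (1 + a + N) * (1 + a / 2 - c + N) * dixonTerm a c N k =
      -1 / (2 * (N + 1)) * ((k + 1) * (1 + a + N + (k + 1)) * (a - c + (k + 1)) *
          dixonTerm a c (N + 1) (k + 1) -
        k * (1 + a + N + k) * (a - c + k) * dixonTerm a c (N + 1) k) := by
  have h := dixonTerm_succ_left a c N k ha
  have hN : (N : ℝ) + 1 ≠ 0 := by positivity
  have haN : 1 + a + N ≠ 0 := by simpa using ha 0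
  have h2 : dixonTerm a c N k =
      dixonTerm a c (N + 1) k * ((N + 1 - k) * (1 + a + N + k)) / ((N + 1) * (1 + a + N)) := by
    rw [h]; field_simp
  have h3 : dixonTerm a c (N + 1) (k + 1) = dixonTerm a c (N + 1) k *
      ((a + k) * (k - (N + 1)) * (c + k) / ((1 + k) * (1 + a + (N + 1) + k) * (1 + a - c + k))) := by
    unfold dixonTerm
    rw [Finset.prod_range_succ]
    push_cast
    rfl
  rw [h2, h3]
  have e1 : (1 : ℝ) + k ≠ 0 := by positivity
  have e2 := hc k
  have e3 : 1 + a + ((N : ℝ) + 1) + k ≠ 0 := by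
    have := ha (k + 1)
    push_cast at this
    intro h; apply this; linarith
  have e4 : ((k : ℝ) + 1) * (1 + a + N + (k + 1)) * (a - c + (k + 1)) * (dixonTerm a c (N + 1) k *
      ((a + k) * (k - (N + 1)) * (c + k) / ((1 + k) * (1 + a + (N + 1) + k) * (1 + a - c + k)))) =
      dixonTerm a c (N + 1) k * ((a + k) * (k - (N + 1)) * (c + k)) := by
    field_simp
    ring
  rw [e4]
  field_simp
  ring

lemma dixonTerm_eq_zero (a c : ℝ) (N : ℕ) : dixonTerm a c N (N + 1) = 0 := by
  simp [dixonTerm, Finset.prod_range_succ]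

/-- Dixon's summation of a terminating well-poised `₃F₂(1)`. -/
lemma sum_dixonTerm (a c : ℝ) (N : ℕ) (ha : ∀ j : ℤ, a ≠ j)
    (hc : ∀ j : ℕ, 1 + a - c + j ≠ 0) (ha2 : ∀ j : ℕ, 1 + a / 2 + j ≠ 0) :
    ∑ k ∈ Finset.range (N + 1), dixonTerm a c N k =
      ∏ j ∈ Finset.range N,
        (1 + a + j) * (1 + a / 2 - c + j) / ((1 + a / 2 + j) * (1 + a - c + j)) := by
  induction N with
  | zero => simp [dixonTerm]
  | succ N ih =>
    have ha' : ∀ j : ℕ, 1 + a + N + j ≠ 0 := by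
      intro j h
      apply ha (-(1 + N + j))
      push_cast
      linarith
    rw [Finset.prod_range_succ, ← ih]
    have key := Finset.sum_congr rfl
      (fun k (_ : k ∈ Finset.range (N + 2)) => dixonTerm_zeilberger a c N k ha' hc)
    rw [← Finset.mul_sum] at key
    have tel := Finset.sum_range_sub
      (fun k : ℕ => (k : ℝ) * (1 + a + N + k) * (a - c + k) * dixonTerm a c (N + 1) k) (N + 2)
    push_cast at tel
    rw [tel, dixonTerm_eq_zero a c (N + 1), Finset.sum_sub_distrib, ← Finset.mul_sum,
      ← Finset.mul_sum] at key
    rw [Finset.sum_range_succ (fun k => dixonTerm a c N k), dixonTerm_eq_zero] at key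
    have h1 := hc N
    have h2 := ha2 N
    rw [mul_div_assoc', eq_div_iff (by positivity)]
    linarith

lemma prod_signed_odd (n : ℕ) :
    ∏ j ∈ Finset.range n, (3 - 2 * (n : ℝ) + 4 * j) =
      (-1) ^ (n / 2) * ∏ j ∈ Finset.range n, (2 * (j : ℝ) + 1) := by
  induction n using Nat.twoStepInduction with
  | zero => simp
  | one => norm_num
  | more n ih _ =>
    have h : (n + 2) / 2 = n / 2 + 1 := by omega
    rw [Finset.prod_range_succ', Finset.prod_range_succ, h, Finset.prod_range_succ _ (n + 1),
      Finset.prod_range_succ _ n, pow_succ]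
    have h2 : ∏ k ∈ Finset.range n, (3 - 2 * ((n + 2 : ℕ) : ℝ) + 4 * ((k + 1 : ℕ) : ℝ)) =
        ∏ k ∈ Finset.range n, (3 - 2 * (n : ℝ) + 4 * k) :=
      Finset.prod_congr rfl fun k _ => by push_cast; ring
    rw [h2, ih]
    push_cast
    ring

lemma prod_neg_odd (n : ℕ) :
    ∏ j ∈ Finset.range n, (1 - 2 * (n : ℝ) + 2 * j) =
      (-1) ^ n * ∏ j ∈ Finset.range n, (2 * (j : ℝ) + 1) := by
  have h := Finset.prod_const (s := Finset.range n) (-1 : ℝ)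
  rw [Finset.card_range] at h
  rw [← Finset.prod_range_reflect, ← h, ← Finset.prod_mul_distrib]
  refine Finset.prod_congr rfl fun j hj => ?_
  have hj' : j + 1 ≤ n := Finset.mem_range.mp hj
  rw [show n - 1 - j = n - (j + 1) by omega, Nat.cast_sub hj']
  push_cast
  ring

/-- The reciprocal of `∏ (4l+1-m')` over all `m' ∈ {0, …, 4n+4}` that are neither equal to `4l+1`
nor divisible by `4`. -/
noncomputable def nodeWeight (n l : ℕ) : ℝ :=
  -(∏ k ∈ Finset.range (n + 2), (4 * (l : ℝ) + 1 - 4 * k)) /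
    ((4 * l + 1).factorial * (4 * n + 3 - 4 * l).factorial)

lemma nodeWeight_eq_dixonTerm (n l : ℕ) (hl : l ≤ n) :
    nodeWeight n l = nodeWeight n 0 * dixonTerm (-n - 1 / 2) (-n - 1 / 4) n l := by
  induction l with
  | zero => simp [dixonTerm]
  | succ l ih =>
    have h3 := ih (by omega)
    unfold dixonTerm at h3 ⊢
    rw [Finset.prod_range_succ, ← mul_assoc, ← h3]
    obtain ⟨d, rfl⟩ : ∃ d, n = l + 1 + d := ⟨n - (l + 1), by omega⟩
    unfold nodeWeight
    rw [show 4 * (l + 1 + d) + 3 - 4 * (l + 1) = 4 * d + 3 by omega,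
      show 4 * (l + 1 + d) + 3 - 4 * l = 4 * d + 3 + 1 + 1 + 1 + 1 by omega,
      show 4 * (l + 1) + 1 = 4 * l + 1 + 1 + 1 + 1 + 1 by omega,
      Finset.prod_range_succ' _ (l + 1 + d + 1),
      Finset.prod_range_succ (fun k : ℕ => 4 * (l : ℝ) + 1 - 4 * k) (l + 1 + d + 1)]
    have h2 : ∏ k ∈ Finset.range (l + 1 + d + 1),
        (4 * ((l + 1 : ℕ) : ℝ) + 1 - 4 * ((k + 1 : ℕ) : ℝ)) =
        ∏ k ∈ Finset.range (l + 1 + d + 1), (4 * (l : ℝ) + 1 - 4 * k) :=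
      Finset.prod_congr rfl fun k _ => by push_cast; ring
    rw [h2]
    simp only [Nat.factorial_succ (4 * d + 3), Nat.factorial_succ (4 * d + 3 + 1),
      Nat.factorial_succ (4 * d + 3 + 1 + 1), Nat.factorial_succ (4 * d + 3 + 1 + 1 + 1),
      Nat.factorial_succ (4 * l + 1), Nat.factorial_succ (4 * l + 1 + 1),
      Nat.factorial_succ (4 * l + 1 + 1 + 1), Nat.factorial_succ (4 * l + 1 + 1 + 1 + 1)]
    have f1 : ((4 * d + 3).factorial : ℝ) ≠ 0 := by positivity
    have f2 : ((4 * l + 1).factorial : ℝ) ≠ 0 := by positivity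
    generalize ((4 * d + 3).factorial) = F1 at *
    generalize ((4 * l + 1).factorial) = F2 at *
    generalize ∏ k ∈ Finset.range (l + 1 + d + 1), (4 * (l : ℝ) + 1 - 4 * k) = P
    push_cast
    rw [show (1 : ℝ) + (-(l + 1 + d) - 1 / 2) + (l + 1 + d) + l = 1 / 2 + l by ring,
      show (1 : ℝ) + (-(l + 1 + d) - 1 / 2) - (-(l + 1 + d) - 1 / 4) + l = 3 / 4 + l by ring,
      show (-((l : ℝ) + 1 + d) - 1 / 2) + l = -(d + 3 / 2) by ring,
      show (-((l : ℝ) + 1 + d) - 1 / 4) + l = -(d + 5 / 4) by ring,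
      show (l : ℝ) - (l + 1 + d) = -(d + 1) by ring]
    have g1 : (1 / 2 + (l : ℝ)) ≠ 0 := by positivity
    have g2 : (3 / 4 + (l : ℝ)) ≠ 0 := by positivity
    have g3 : (1 + (l : ℝ)) ≠ 0 := by positivity
    have g4 : (4 * (l : ℝ) + 1 + 1) ≠ 0 := by positivity
    have g5 : (4 * (l : ℝ) + 1 + 1 + 1) ≠ 0 := by positivity
    have g6 : (4 * (l : ℝ) + 1 + 1 + 1 + 1) ≠ 0 := by positivity
    have g7 : (4 * (l : ℝ) + 1 + 1 + 1 + 1 + 1) ≠ 0 := by positivity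
    have k4 : (4 * (d : ℝ) + 3 + 1) ≠ 0 := by positivity
    have k5 : (4 * (d : ℝ) + 3 + 1 + 1) ≠ 0 := by positivity
    have k6 : (4 * (d : ℝ) + 3 + 1 + 1 + 1) ≠ 0 := by positivity
    have k7 : (4 * (d : ℝ) + 3 + 1 + 1 + 1 + 1) ≠ 0 := by positivity
    rw [div_mul_div_comm, div_eq_div_iff (by positivity) (by positivity)]
    ring

lemma nodeWeight_zero (n : ℕ) :
    nodeWeight n 0 =
      (-1) ^ n * (∏ k ∈ Finset.range n, (4 * (k : ℝ) + 3)) / (4 * n + 2).factorial := by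
  have h : ∏ k ∈ Finset.range (n + 1), (4 * ((0 : ℕ) : ℝ) + 1 - 4 * ((k + 1 : ℕ) : ℝ)) =
      (-1) ^ (n + 1) * ∏ k ∈ Finset.range (n + 1), (4 * (k : ℝ) + 3) := by
    have := Finset.prod_const (s := Finset.range (n + 1)) (-1 : ℝ)
    rw [Finset.card_range] at this
    rw [← this, ← Finset.prod_mul_distrib]
    exact Finset.prod_congr rfl fun k _ => by push_cast; ring
  unfold nodeWeight
  rw [Finset.prod_range_succ', h, Finset.prod_range_succ,
    show 4 * n + 3 - 4 * 0 = 4 * n + 2 + 1 by omega, Nat.factorial_succ (4 * n + 2)]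
  have f1 : ((4 * n + 2).factorial : ℝ) ≠ 0 := by positivity
  have f2 : (4 * (n : ℝ) + 2 + 1) ≠ 0 := by positivity
  push_cast
  simp only [mul_zero, zero_add, Nat.factorial_one]
  field_simp
  ring

lemma sum_nodeWeight (n : ℕ) :
    ∑ l ∈ Finset.range (n + 1), nodeWeight n l =
      (-1) ^ (n / 2) * 4 ^ n * (∏ j ∈ Finset.range n, ((n : ℝ) + 2 + 2 * j)) /
        (4 * n + 2).factorial := by
  have hsum : ∑ l ∈ Finset.range (n + 1), nodeWeight n l =
      nodeWeight n 0 * ∑ l ∈ Finset.range (n + 1), dixonTerm (-n - 1 / 2) (-n - 1 / 4) n l := by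
    rw [Finset.mul_sum]
    exact Finset.sum_congr rfl fun l hl =>
      nodeWeight_eq_dixonTerm n l (Nat.lt_succ_iff.mp (Finset.mem_range.mp hl))
  have hodd : ∀ j : ℕ, 3 - 2 * (n : ℝ) + 4 * j ≠ 0 := by
    intro j h
    have : (3 - 2 * (n : ℤ) + 4 * j) = 0 := by exact_mod_cast h
    omega
  rw [hsum, sum_dixonTerm, nodeWeight_zero]
  · have hD : ∀ j ∈ Finset.range n,
        (1 + (-(n : ℝ) - 1 / 2) + j) * (1 + (-(n : ℝ) - 1 / 2) / 2 - (-(n : ℝ) - 1 / 4) + j) /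
          ((1 + (-(n : ℝ) - 1 / 2) / 2 + j) * (1 + (-(n : ℝ) - 1 / 2) - (-(n : ℝ) - 1 / 4) + j)) =
        4 * (1 - 2 * (n : ℝ) + 2 * j) * (n + 2 + 2 * j) /
          ((3 - 2 * (n : ℝ) + 4 * j) * (4 * j + 3)) := by
      intro j _
      have h1 := hodd j
      have h2 : (4 * (j : ℝ) + 3) ≠ 0 := by positivity
      rw [show 1 + (-(n : ℝ) - 1 / 2) / 2 + j = (3 - 2 * (n : ℝ) + 4 * j) / 4 by ring,
        show 1 + (-(n : ℝ) - 1 / 2) - (-(n : ℝ) - 1 / 4) + j = (4 * (j : ℝ) + 3) / 4 by ring]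
      field_simp
      ring
    rw [Finset.prod_congr rfl hD, Finset.prod_div_distrib, Finset.prod_mul_distrib,
      Finset.prod_mul_distrib, Finset.prod_mul_distrib, prod_neg_odd, prod_signed_odd,
      Finset.prod_const, Finset.card_range]
    have p1 : ∏ j ∈ Finset.range n, (2 * (j : ℝ) + 1) ≠ 0 :=
      Finset.prod_ne_zero_iff.mpr fun j _ => by positivity
    have p2 : ∏ j ∈ Finset.range n, (4 * (j : ℝ) + 3) ≠ 0 :=
      Finset.prod_ne_zero_iff.mpr fun j _ => by positivity
    have f1 : ((4 * n + 2).factorial : ℝ) ≠ 0 := by positivity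
    have s1 : ((-1 : ℝ) ^ (n / 2)) * (-1) ^ (n / 2) = 1 := by
      rw [← mul_pow]; simp
    have s2 : ((-1 : ℝ) ^ n) * (-1) ^ n = 1 := by
      rw [← mul_pow]; simp
    have s3 : ((-1 : ℝ) ^ (n / 2)) ≠ 0 := by positivity
    generalize ∏ j ∈ Finset.range n, (2 * (j : ℝ) + 1) = P1 at *
    generalize ∏ j ∈ Finset.range n, (4 * (j : ℝ) + 3) = P2 at *
    generalize ∏ j ∈ Finset.range n, ((n : ℝ) + 2 + 2 * j) = P3 at *
    generalize (-1 : ℝ) ^ (n / 2) = e at *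
    generalize (-1 : ℝ) ^ n = e' at *
    generalize ((4 * n + 2).factorial : ℝ) = F at *
    rw [div_mul_div_comm, div_eq_div_iff (by positivity) (by positivity)]
    linear_combination (4 ^ n * P1 * P2 * P3 * F) * s2 - (4 ^ n * P1 * P2 * P3 * F) * s1
  · intro j h
    have : (-(2 * (n : ℤ)) - 1) = 2 * j := by
      have h' : (-(2 * (n : ℝ)) - 1) = 2 * j := by linarith
      exact_mod_cast h'
    omega
  · intro j h
    have : (0 : ℝ) ≤ j := by positivity
    linarith
  · intro j h
    exact hodd j (by linarith)

open PowerSeries in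
/-- The power series `X (1 + X) / (1 - X)`. -/
noncomputable def delannoySeries : ℂ⟦X⟧ := X * (1 + X) * mk 1

open PowerSeries in
lemma one_sub_X_mul_delannoySeries : (1 - X) * delannoySeries = X * (1 + X) := by
  have h := mk_one_mul_one_sub_eq_one ℂ
  unfold delannoySeries
  linear_combination (X * (1 + X)) * h

/-- The coefficient of `X ^ (k + 1)` in `(X (1 + X) / (1 - X)) ^ (l + 1)`. -/
noncomputable def delannoyCoeff (k l : ℕ) : ℂ :=
  PowerSeries.coeff (k + 1) (delannoySeries ^ (l + 1))

open PowerSeries in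
lemma delannoyCoeff_succ_succ (k l : ℕ) :
    delannoyCoeff (k + 2) (l + 1) =
      delannoyCoeff (k + 1) (l + 1) + delannoyCoeff (k + 1) l + delannoyCoeff k l := by
  have h : delannoySeries ^ (l + 2) = X * delannoySeries ^ (l + 2) +
      X * delannoySeries ^ (l + 1) + X * (X * delannoySeries ^ (l + 1)) := by
    linear_combination delannoySeries ^ (l + 1) * one_sub_X_mul_delannoySeries
  unfold delannoyCoeff
  conv_lhs => rw [show l + 1 + 1 = l + 2 from rfl, h]
  simp only [map_add, coeff_succ_X_mul]

open PowerSeries in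
lemma delannoyCoeff_zero_right (k : ℕ) : delannoyCoeff (k + 2) 0 = delannoyCoeff (k + 1) 0 := by
  have h : delannoySeries = X * delannoySeries + X * (1 + X) := by
    linear_combination one_sub_X_mul_delannoySeries
  unfold delannoyCoeff
  conv_lhs => rw [zero_add, pow_one, h]
  simp only [map_add, coeff_succ_X_mul]
  simp [coeff_X, coeff_one]

open PowerSeries in
lemma delannoyCoeff_eq_zero {k l : ℕ} (h : k < l) : delannoyCoeff k l = 0 := by
  unfold delannoyCoeff delannoySeries
  rw [mul_assoc, mul_pow, coeff_X_pow_mul', if_neg (by omega)]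

open PowerSeries in
lemma delannoyCoeff_zero_zero : delannoyCoeff 0 0 = 1 := by
  simp [delannoyCoeff, delannoySeries, mul_assoc, coeff_succ_X_mul]

open PowerSeries in
lemma delannoyCoeff_one_zero : delannoyCoeff 1 0 = 2 := by
  have h : delannoySeries = X * delannoySeries + X * (1 + X) := by
    linear_combination one_sub_X_mul_delannoySeries
  have h0 := delannoyCoeff_zero_zero
  unfold delannoyCoeff at h0 ⊢
  rw [zero_add, pow_one] at h0 ⊢
  conv_lhs => rw [h]
  simp only [map_add, coeff_succ_X_mul]
  rw [h0]
  norm_num [coeff_X, coeff_one]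

open PowerSeries in
lemma delannoyCoeff_one_one : delannoyCoeff 1 1 = 1 := by
  unfold delannoyCoeff delannoySeries
  rw [mul_assoc, mul_pow, coeff_X_pow_mul']
  simp

open PowerSeries in
/-- Expansion of `aᵏ a' + bᵏ b'` in powers of `r`, where `a + b = 1 + r` and `a b = -r`. -/
lemma pow_mul_add_pow_mul_eq_sum {a b a' b' r r' : ℂ⟦X⟧} (h1 : a + b = 1 + r) (h2 : a * b = -r)
    (h3 : a' + b' = r') (h4 : a' * b + a * b' = -r') (k M : ℕ) (hM : k < M) :
    a ^ k * a' + b ^ k * b' = (∑ l ∈ Finset.range M, C (delannoyCoeff k l) * r ^ l) * r' := by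
  induction k using Nat.twoStepInduction generalizing M with
  | zero =>
    rw [Finset.sum_eq_single_of_mem 0 (Finset.mem_range.mpr hM)
      (fun l _ hl => by rw [delannoyCoeff_eq_zero (Nat.pos_of_ne_zero hl)]; simp),
      delannoyCoeff_zero_zero]
    simpa using h3
  | one =>
    obtain ⟨M, rfl⟩ : ∃ m, M = m + 1 + 1 := ⟨M - 2, by omega⟩
    rw [Finset.sum_range_succ', Finset.sum_range_succ', Finset.sum_eq_zero (fun l _ => by
      rw [delannoyCoeff_eq_zero (by omega)]; simp), zero_add, delannoyCoeff_one_one,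
      delannoyCoeff_one_zero]
    simp only [map_one, map_ofNat]
    linear_combination (a' + b') * h1 + (1 + r) * h3 - h4
  | more k ih0 ih1 =>
    obtain ⟨M, rfl⟩ : ∃ m, M = m + 1 := ⟨M - 1, by omega⟩
    have e0 := ih0 M (by omega)
    have e1 := ih1 M (by omega)
    have e1' := ih1 (M + 1) (by omega)
    have hs : ∑ l ∈ Finset.range (M + 1), C (delannoyCoeff (k + 2) l) * r ^ l =
        ∑ l ∈ Finset.range (M + 1), C (delannoyCoeff (k + 1) l) * r ^ l +
        r * ∑ l ∈ Finset.range M, C (delannoyCoeff (k + 1) l) * r ^ l +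
        r * ∑ l ∈ Finset.range M, C (delannoyCoeff k l) * r ^ l := by
      rw [Finset.sum_range_succ', Finset.sum_range_succ', delannoyCoeff_zero_right]
      simp only [delannoyCoeff_succ_succ, map_add, add_mul, Finset.sum_add_distrib, Finset.mul_sum]
      have : ∀ f : ℕ → ℂ, ∑ l ∈ Finset.range M, C (f l) * r ^ (l + 1) =
          ∑ l ∈ Finset.range M, r * (C (f l) * r ^ l) :=
        fun f => Finset.sum_congr rfl fun l _ => by ring
      rw [this, this, this]
      ring
    rw [hs, add_mul, add_mul, mul_assoc r, mul_assoc r, ← e0, ← e1, ← e1']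
    linear_combination (a ^ (k + 1) * a' + b ^ (k + 1) * b') * h1 -
      (a ^ k * a' + b ^ k * b') * h2

lemma binom_natCast (m p : ℕ) : binom (m : ℤ) p = (m.choose p : ℝ) := by
  unfold binom
  rw [Int.cast_natCast, ← descPochhammer_eval_eq_prod_range, descPochhammer_eval_eq_descFactorial,
    Nat.descFactorial_eq_factorial_mul_choose, Nat.cast_mul, mul_div_cancel_left₀ _ (by positivity)]

lemma binom_sub_one (i j : ℕ) :
    binom (2 * (i : ℤ) - (j : ℤ) - 1) (2 * i + 1) = -((j + 1).choose (2 * i + 1) : ℝ) := by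
  rw [← binom_natCast]
  unfold binom
  rw [← neg_div, ← Finset.prod_range_reflect]
  congr 1
  have h := Finset.prod_const (s := Finset.range (2 * i + 1)) (-1 : ℝ)
  rw [Finset.card_range, pow_succ, pow_mul, neg_one_sq, one_pow, one_mul] at h
  rw [neg_eq_neg_one_mul, ← h, ← Finset.prod_mul_distrib]
  refine Finset.prod_congr rfl fun k hk => ?_
  have hk' : k ≤ 2 * i := by have := Finset.mem_range.mp hk; omega
  rw [show 2 * i + 1 - 1 - k = 2 * i - k by omega, Nat.cast_sub hk']
  push_cast
  ring

open PowerSeries in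
/-- The series `1 / (1 - 2X)`. -/
noncomputable def geomTwo : ℂ⟦X⟧ := rescale 2 (mk 1)

open PowerSeries in
lemma geomTwo_mul : geomTwo * (1 - 2 * X) = 1 := by
  have h := congrArg (rescale (2 : ℂ)) (mk_one_mul_one_sub_eq_one ℂ)
  rw [map_mul, map_sub, map_one, rescale_X] at h
  exact_mod_cast h

open PowerSeries in
lemma coeff_two_mul_geomTwo_pow (i j : ℕ) :
    coeff j (2 * geomTwo ^ (2 * i + 2)) = 2 ^ (j + 1) * ((2 * i + j + 1).choose (2 * i + 1) : ℂ) := by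
  unfold geomTwo
  rw [← map_pow, mk_one_pow_eq_mk_choose_add, show (2 : ℂ⟦X⟧) = C 2 from (map_ofNat C 2).symm,
    coeff_C_mul, coeff_rescale, coeff_mk, show 2 * i + 1 + j = 2 * i + j + 1 by ring]
  ring

open PowerSeries in
lemma coeff_X_pow_mul_geom_pow (i j : ℕ) :
    coeff j (X ^ (2 * i) * (mk 1 : ℂ⟦X⟧) ^ (2 * i + 2)) = ((j + 1).choose (2 * i + 1) : ℂ) := by
  rw [mk_one_pow_eq_mk_choose_add, coeff_X_pow_mul']
  split_ifs with h
  · rw [coeff_mk, show 2 * i + 1 + (j - 2 * i) = j + 1 by omega]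
  · rw [Nat.choose_eq_zero_of_lt (by omega), Nat.cast_zero]

/-- The odd-row Delannoy-type matrix, with entries
`[X ^ (2i + 1)] (X (1 + X) / (1 - X)) ^ (j + 1)`. -/
noncomputable def delannoyMatrix (n : ℕ) : Matrix (Fin n) (Fin n) ℂ :=
  Matrix.of fun i j => delannoyCoeff (2 * i) j

open PowerSeries in
lemma det_eq_det_delannoyMatrix (n : ℕ) :
    (((Matrix.of fun i j : Fin n =>
        (2 : ℝ) ^ ((j : ℕ) + 1) * binom (2 * ((i : ℕ) : ℤ) + ((j : ℕ) : ℤ) + 1) (2 * (i : ℕ) + 1)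
          + binom (2 * ((i : ℕ) : ℤ) - ((j : ℕ) : ℤ) - 1) (2 * (i : ℕ) + 1)).det : ℝ) : ℂ) =
      (delannoyMatrix n).det := by
  set J : ℂ⟦X⟧ := mk 1 with hJ
  have hJ1 : J * (1 - X) = 1 := mk_one_mul_one_sub_eq_one ℂ
  have hJ2 := geomTwo_mul
  set r' : ℂ⟦X⟧ := 2 * geomTwo ^ 2 - J ^ 2 with hr'
  set U : Matrix (Fin n) (Fin n) ℂ :=
    Matrix.of fun l j => coeff (j : ℕ) ((X * J * geomTwo) ^ (l : ℕ) * r') with hU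
  have hU0 : ∀ l j : ℕ, j < l → coeff j ((X * J * geomTwo) ^ l * r') = 0 := by
    intro l j hlj
    rw [mul_assoc X, mul_pow, mul_assoc, coeff_X_pow_mul', if_neg (by omega)]
  have hdetU : U.det = 1 := by
    have hUt : U.IsUpperTriangular := fun i j hij => hU0 (i : ℕ) (j : ℕ) hij
    rw [Matrix.det_of_isUpperTriangular hUt]
    refine Finset.prod_eq_one fun l _ => ?_
    rw [hU, Matrix.of_apply, mul_assoc X, mul_pow, mul_assoc, coeff_X_pow_mul', if_pos le_rfl,
      Nat.sub_self, hr', hJ]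
    have c1 : constantCoeff J = 1 := by simp [hJ]
    have c2 : constantCoeff geomTwo = 1 := by
      have h := coeff_rescale (mk 1) (2 : ℂ) 0
      rwa [coeff_zero_eq_constantCoeff_apply, pow_zero, one_mul, coeff_mk] at h
    rw [coeff_zero_eq_constantCoeff_apply]
    simp only [map_mul, map_pow, map_sub, map_ofNat, ← hJ, c1, c2]
    norm_num
  have hentry : ∀ i j : ℕ, (2 : ℂ) ^ (j + 1) * ((2 * i + j + 1).choose (2 * i + 1) : ℂ) -
      ((j + 1).choose (2 * i + 1) : ℂ) =
      coeff j (geomTwo ^ (2 * i) * (2 * geomTwo ^ 2) + (-(X * J)) ^ (2 * i) * (-J ^ 2)) := by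
    intro i j
    rw [← coeff_two_mul_geomTwo_pow, ← coeff_X_pow_mul_geom_pow, ← map_sub]
    congr 1
    rw [Even.neg_pow (even_two_mul i)]
    ring
  have hmul : (Complex.ofRealHom.mapMatrix (Matrix.of fun i j : Fin n =>
        (2 : ℝ) ^ ((j : ℕ) + 1) * binom (2 * ((i : ℕ) : ℤ) + ((j : ℕ) : ℤ) + 1) (2 * (i : ℕ) + 1)
          + binom (2 * ((i : ℕ) : ℤ) - ((j : ℕ) : ℤ) - 1) (2 * (i : ℕ) + 1))) =
      delannoyMatrix n * U := by
    ext i j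
    rw [RingHom.mapMatrix_apply, Matrix.map_apply, Matrix.of_apply, binom_sub_one,
      show 2 * ((i : ℕ) : ℤ) + ((j : ℕ) : ℤ) + 1 = ((2 * i + j + 1 : ℕ) : ℤ) by push_cast; ring,
      binom_natCast, ← sub_eq_add_neg]
    simp only [Complex.ofRealHom_eq_coe]
    push_cast
    rw [hentry, pow_mul_add_pow_mul_eq_sum (r := X * J * geomTwo) (r' := r') ?_ ?_ ?_ ?_ (2 * i)
      (n + (2 * i + 1)) (by omega), Finset.sum_mul, map_sum, Finset.sum_range_add,
      Finset.sum_eq_zero (s := Finset.range (2 * (i : ℕ) + 1)), add_zero, Matrix.mul_apply,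
      ← Fin.sum_univ_eq_sum_range
        (fun l => coeff (j : ℕ) (C (delannoyCoeff (2 * i) l) * (X * J * geomTwo) ^ l * r'))]
    · refine Finset.sum_congr rfl fun l _ => ?_
      rw [mul_assoc, coeff_C_mul]
      rfl
    · intro l _
      rw [mul_assoc, coeff_C_mul, hU0 _ _ (by omega), mul_zero]
    · linear_combination (1 - geomTwo) * hJ1 + J * hJ2
    · ring
    · rw [hr']; ring
    · rw [hr']
      linear_combination (-2 * geomTwo ^ 2 - 2 * geomTwo * J) * hJ1 + (2 * geomTwo * J + J ^ 2) * hJ2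
  have := congrArg Matrix.det hmul
  rw [Matrix.det_mul, hdetU, mul_one, ← RingHom.map_det] at this
  exact this

open Polynomial in
/-- If `f = (X - 1) ^ #S * B` has degree below `d`, then `∑ f_m ∏_{a ∈ S} (m - a) = (#S)! B(1)`. -/
lemma sum_coeff_mul_prod_sub (S : Finset ℕ) (f B : ℂ[X]) (d : ℕ) (hf : f = (X - 1) ^ S.card * B)
    (hd : ∀ m, d ≤ m → f.coeff m = 0) :
    ∑ m ∈ Finset.range d, f.coeff m * ∏ a ∈ S, ((m : ℂ) - a) = S.card.factorial * B.eval 1 := by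
  induction S using Finset.induction_on generalizing f B with
  | empty =>
    have hdeg : f.degree < d := (Polynomial.degree_lt_iff_coeff_zero f d).mpr hd
    simp only [Finset.prod_empty, mul_one, Finset.card_empty, Nat.factorial_zero, Nat.cast_one,
      one_mul]
    rw [Finset.card_empty, pow_zero, one_mul] at hf
    rw [← hf, Polynomial.eval_eq_sum, Polynomial.sum_def]
    simp only [one_pow, mul_one]
    symm
    refine Finset.sum_subset (fun m hm => ?_) fun m _ hm => by simpa using hm
    rw [Finset.mem_range]
    by_contra hlt
    exact (Polynomial.mem_support_iff.mp hm) (hd m (not_lt.mp hlt))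
  | insert a S ha ih =>
    rw [Finset.card_insert_of_notMem ha] at hf ⊢
    have hcoeff : ∀ m : ℕ,
        (X * derivative f - C (a : ℂ) * f).coeff m = ((m : ℂ) - a) * f.coeff m := by
      intro m
      rw [coeff_sub, coeff_C_mul]
      cases m with
      | zero => simp
      | succ m => rw [coeff_X_mul, coeff_derivative]; push_cast; ring
    have h := ih (X * derivative f - C (a : ℂ) * f)
      (((S.card : ℂ[X]) + 1) * X * B + (X - 1) * (X * derivative B - C (a : ℂ) * B)) ?_
      fun m hm => by rw [hcoeff, hd m hm, mul_zero]
    · rw [Nat.factorial_succ]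
      simp only [eval_add, eval_mul, eval_natCast, eval_one, eval_X, eval_sub, sub_self, zero_mul,
        add_zero, mul_one] at h
      push_cast
      rw [mul_comm ((S.card : ℂ) + 1), mul_assoc, ← h]
      refine Finset.sum_congr rfl fun m _ => ?_
      rw [hcoeff, Finset.prod_insert ha]
      ring
    · rw [hf]
      simp only [derivative_mul, derivative_pow_succ, derivative_sub, derivative_X, derivative_one,
        map_add, map_natCast, map_one]
      ring

lemma prod_range_erase_sub (m r : ℕ) :
    ∏ a ∈ (Finset.range (m + 1 + r)).erase m, ((m : ℝ) - a) =
      (-1) ^ r * (m.factorial * r.factorial) := by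
  have h1 : ∏ a ∈ Finset.range m, ((m : ℝ) - a) = m.factorial := by
    rw [← Finset.prod_range_add_one_eq_factorial, ← Finset.prod_range_reflect]
    push_cast
    refine Finset.prod_congr rfl fun a ha => ?_
    have ha' : a + 1 ≤ m := Finset.mem_range.mp ha
    rw [show m - 1 - a = m - (a + 1) by omega, Nat.cast_sub ha']
    push_cast
    ring
  have h2 : ∏ a ∈ Finset.range r, ((m : ℝ) - ((m + 1 + a : ℕ) : ℝ)) = (-1) ^ r * r.factorial := by
    have h := Finset.prod_const (s := Finset.range r) (-1 : ℝ)
    rw [Finset.card_range] at h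
    rw [← Finset.prod_range_add_one_eq_factorial, ← h]
    push_cast
    rw [← Finset.prod_mul_distrib]
    exact Finset.prod_congr rfl fun a _ => by ring
  have h3 : ∏ a ∈ (Finset.range (m + 1 + r)).erase m, ((m : ℝ) - a) =
      ∏ a ∈ Finset.range (m + 1 + r), if a = m then 1 else ((m : ℝ) - a) := by
    rw [← Finset.mul_prod_erase (Finset.range (m + 1 + r)) _ (a := m)
      (Finset.mem_range.mpr (by omega)), if_pos rfl, one_mul]
    exact Finset.prod_congr rfl fun a ha => by rw [if_neg (Finset.ne_of_mem_erase ha)]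
  rw [h3, Finset.prod_range_add, Finset.prod_range_succ, if_pos rfl, mul_one,
    Finset.prod_congr rfl (g := fun a : ℕ => (m : ℝ) - a)
      fun a ha => if_neg (Finset.mem_range.mp ha).ne,
    Finset.prod_congr rfl (g := fun a : ℕ => (m : ℝ) - ((m + 1 + a : ℕ) : ℝ))
      fun a _ => if_neg (by omega), h1, h2]
  ring

/-- The exponents in `{0, …, 4n + 4}` that are neither equal to `4l + 1` nor divisible by `4`. -/
def nodeSet (n l : ℕ) : Finset ℕ :=
  ((Finset.range (4 * n + 5)).erase (4 * l + 1)).filter fun a => ¬ 4 ∣ a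

lemma filter_four_dvd (n l : ℕ) :
    ((Finset.range (4 * n + 5)).erase (4 * l + 1)).filter (fun a => 4 ∣ a) =
      (Finset.range (n + 2)).image fun k => 4 * k := by
  ext a
  simp only [Finset.mem_filter, Finset.mem_erase, Finset.mem_range, Finset.mem_image]
  constructor
  · rintro ⟨⟨_, h⟩, k, rfl⟩
    exact ⟨k, by omega, rfl⟩
  · rintro ⟨k, hk, rfl⟩
    exact ⟨⟨by omega, by omega⟩, k, rfl⟩

lemma card_nodeSet (n l : ℕ) (hl : l ≤ n) : (nodeSet n l).card = 3 * n + 2 := by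
  have h := Finset.card_filter_add_card_filter_not
    (s := (Finset.range (4 * n + 5)).erase (4 * l + 1)) (fun a => 4 ∣ a)
  rw [filter_four_dvd, Finset.card_image_of_injective _ (fun a b hab => by simpa using hab),
    Finset.card_erase_of_mem (Finset.mem_range.mpr (by omega)), Finset.card_range,
    Finset.card_range] at h
  unfold nodeSet
  omega

lemma nodeWeight_mul_prod (n l : ℕ) (hl : l ≤ n) :
    nodeWeight n l * ∏ a ∈ nodeSet n l, (((4 * l + 1 : ℕ) : ℝ) - a) = 1 := by
  have h := Finset.prod_filter_mul_prod_filter_not ((Finset.range (4 * n + 5)).erase (4 * l + 1))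
    (fun a => 4 ∣ a) fun a => ((4 * l + 1 : ℕ) : ℝ) - a
  have h' := prod_range_erase_sub (4 * l + 1) (4 * n + 3 - 4 * l)
  rw [show 4 * l + 1 + 1 + (4 * n + 3 - 4 * l) = 4 * n + 5 by omega,
    Odd.neg_one_pow ⟨2 * (n - l) + 1, by omega⟩] at h'
  rw [h', filter_four_dvd, Finset.prod_image (fun a _ b _ hab => by simpa using hab)] at h
  unfold nodeWeight
  have f1 : ((4 * l + 1).factorial : ℝ) ≠ 0 := by positivity
  have f2 : ((4 * n + 3 - 4 * l).factorial : ℝ) ≠ 0 := by positivity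
  rw [div_mul_eq_mul_div, div_eq_one_iff_eq (mul_ne_zero f1 f2)]
  push_cast at h
  change _ * ∏ a ∈ nodeSet n l, _ = _ at h
  push_cast
  linarith

open Polynomial in
/-- The polynomial `(1 - X ^ 2) ^ N * (G(X) ^ k - G(-X) ^ k)` where `G = X (1 + X) / (1 - X)`. -/
noncomputable def delannoyPoly (N k : ℕ) : ℂ[X] :=
  X ^ k * ((1 + X) ^ (N + k) * (1 - X) ^ (N - k) -
    (-1) ^ k * ((1 - X) ^ (N + k) * (1 + X) ^ (N - k)))

open PowerSeries in
lemma coe_delannoyPoly {N k : ℕ} (hk : k ≤ N) : (delannoyPoly N k : ℂ⟦X⟧) =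
    (1 - X ^ 2) ^ N * (delannoySeries ^ k - evalNegHom (delannoySeries ^ k)) := by
  obtain ⟨r, rfl⟩ := Nat.exists_eq_add_of_le hk
  have h1 : (1 - X ^ 2) ^ (k + r) * delannoySeries ^ k =
      X ^ k * ((1 + X) ^ (k + r + k) * (1 - X) ^ r) := by
    have h := congrArg (· ^ k) one_sub_X_mul_delannoySeries
    simp only [mul_pow] at h
    rw [show (1 - X ^ 2 : ℂ⟦X⟧) = (1 + X) * (1 - X) by ring, mul_pow, pow_add (1 - X) k r]
    linear_combination ((1 + X) ^ (k + r) * (1 - X) ^ r) * h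
  have h2 := congrArg evalNegHom h1
  simp only [map_mul, map_pow, map_sub, map_add, map_one, evalNegHom_X, neg_sq] at h2
  rw [map_pow, mul_sub, h1, h2, delannoyPoly, Nat.add_sub_cancel_left]
  push_cast
  simp only [neg_pow X k, sub_neg_eq_add, ← sub_eq_add_neg]
  ring

lemma one_sub_I_pow_mul (k r : ℕ) :
    (1 - Complex.I) ^ (k + r + k) * (1 + Complex.I) ^ r = 2 ^ (k + r) * (-Complex.I) ^ k := by
  have h1 : (1 - Complex.I) ^ 2 = 2 * -Complex.I := by linear_combination Complex.I_sq
  have h2 : (1 - Complex.I) * (1 + Complex.I) = 2 := by linear_combination -Complex.I_sq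
  rw [show k + r + k = 2 * k + r by ring, pow_add, pow_mul, h1, mul_assoc, ← mul_pow, h2, mul_pow]
  ring

lemma one_add_I_pow_mul (k r : ℕ) :
    (1 + Complex.I) ^ (k + r + k) * (1 - Complex.I) ^ r = 2 ^ (k + r) * Complex.I ^ k := by
  have h1 : (1 + Complex.I) ^ 2 = 2 * Complex.I := by linear_combination Complex.I_sq
  have h2 : (1 + Complex.I) * (1 - Complex.I) = 2 := by linear_combination -Complex.I_sq
  rw [show k + r + k = 2 * k + r by ring, pow_add, pow_mul, h1, mul_assoc, ← mul_pow, h2, mul_pow]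
  ring

/-- The value of `delannoyPoly` at the Cayley transform `w = -i (u - 1) / (u + 1)`. -/
lemma eval_delannoyPoly_cayley {N k : ℕ} (hk : k ≤ N) {u w : ℂ}
    (hw : w * (u + 1) = -Complex.I * (u - 1)) :
    (u - 1) ^ N * (u + 1) ^ (3 * N) * (delannoyPoly N k).eval w =
      2 ^ N * ((-1) ^ k * ((u - 1) ^ (N + k) * (u + 1) ^ (N - k) *
        ((u + Complex.I) ^ (N + k) * (u - Complex.I) ^ (N - k) -
          (u - Complex.I) ^ (N + k) * (u + Complex.I) ^ (N - k)))) := by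
  obtain ⟨r, rfl⟩ := Nat.exists_eq_add_of_le hk
  have hp : (1 + w) * (u + 1) = (1 - Complex.I) * (u + Complex.I) := by
    linear_combination hw + Complex.I_sq
  have hm : (1 - w) * (u + 1) = (1 + Complex.I) * (u - Complex.I) := by
    linear_combination -hw + Complex.I_sq
  have e : ∀ p q : ℂ, (u + 1) ^ (3 * (k + r)) * (w ^ k * (p ^ (k + r + k) * q ^ r)) =
      (u + 1) ^ r * (w * (u + 1)) ^ k * ((p * (u + 1)) ^ (k + r + k) * (q * (u + 1)) ^ r) := by
    intro p q
    generalize u + 1 = v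
    ring
  have h1 := e (1 + w) (1 - w)
  have h2 := e (1 - w) (1 + w)
  rw [hp, hm, hw, mul_pow, mul_pow, mul_pow] at h1 h2
  have s1 : (-Complex.I) ^ k * (-Complex.I) ^ k = (-1) ^ k := by
    rw [← mul_pow, neg_mul_neg, Complex.I_mul_I]
  have s2 : (-Complex.I) ^ k * Complex.I ^ k = 1 := by
    rw [← mul_pow, neg_mul, Complex.I_mul_I, neg_neg, one_pow]
  have t1 := one_sub_I_pow_mul k r
  have t2 := one_add_I_pow_mul k r
  simp only [delannoyPoly, Polynomial.eval_mul, Polynomial.eval_sub, Polynomial.eval_add,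
    Polynomial.eval_pow, Polynomial.eval_X, Polynomial.eval_one, Polynomial.eval_neg,
    Nat.add_sub_cancel_left]
  calc _ = (u - 1) ^ (k + r) * ((u + 1) ^ (3 * (k + r)) * (w ^ k * ((1 + w) ^ (k + r + k) *
        (1 - w) ^ r)) - (-1) ^ k * ((u + 1) ^ (3 * (k + r)) * (w ^ k * ((1 - w) ^ (k + r + k) *
        (1 + w) ^ r)))) := by ring
    _ = (u - 1) ^ (k + r) * (u + 1) ^ r * (u - 1) ^ k *
        ((-Complex.I) ^ k * ((1 - Complex.I) ^ (k + r + k) * (1 + Complex.I) ^ r) *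
          ((u + Complex.I) ^ (k + r + k) * (u - Complex.I) ^ r) -
        (-1) ^ k * ((-Complex.I) ^ k * ((1 + Complex.I) ^ (k + r + k) * (1 - Complex.I) ^ r)) *
          ((u - Complex.I) ^ (k + r + k) * (u + Complex.I) ^ r)) := by
      rw [h1, h2]
      ring
    _ = (u - 1) ^ (k + r) * (u + 1) ^ r * (u - 1) ^ k *
        (((-Complex.I) ^ k * (-Complex.I) ^ k) * 2 ^ (k + r) *
          ((u + Complex.I) ^ (k + r + k) * (u - Complex.I) ^ r) -
        (-1) ^ k * ((-Complex.I) ^ k * Complex.I ^ k) * 2 ^ (k + r) *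
          ((u - Complex.I) ^ (k + r + k) * (u + Complex.I) ^ r)) := by
      rw [t1, t2]
      ring
    _ = _ := by
      rw [s1, s2, pow_add (u - 1) (k + r) k]
      ring

open Polynomial in
/-- The image of `∑ c_l * delannoyPoly (n + 1) (l + 1)` under the Cayley transform. -/
noncomputable def cayleyPoly (n : ℕ) (c : ℕ → ℂ) : ℂ[X] :=
  C (2 ^ (n + 1)) * ∑ l ∈ Finset.range (n + 1), C (c l * (-1) ^ (l + 1)) *
    ((X - 1) ^ (n + 1 + (l + 1)) * (X + 1) ^ (n + 1 - (l + 1)) *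
      ((X + C Complex.I) ^ (n + 1 + (l + 1)) * (X - C Complex.I) ^ (n + 1 - (l + 1)) -
        (X - C Complex.I) ^ (n + 1 + (l + 1)) * (X + C Complex.I) ^ (n + 1 - (l + 1))))

open Polynomial in
lemma coeff_cayleyPoly_of_four_dvd (n : ℕ) (c : ℕ → ℂ) (m : ℕ) :
    (cayleyPoly n c).coeff (4 * m) = 0 := by
  set P : ℂ[X] := C (2 ^ (n + 1)) * ∑ l ∈ Finset.range (n + 1), C (c l * (-1) ^ (l + 1)) *
    (((X - 1) * (X + C Complex.I)) ^ (n + 1 + (l + 1)) *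
      ((X - C Complex.I) * (X + 1)) ^ (n + 1 - (l + 1))) with hP
  have hI : (C Complex.I * C Complex.I : ℂ[X]) = -1 := by
    rw [← C_mul, Complex.I_mul_I, C_neg, C_1]
  have h1 : (C (-Complex.I) * X - 1) * (C (-Complex.I) * X + C Complex.I) =
      -((X - C Complex.I) * (X - 1) : ℂ[X]) := by
    rw [C_neg]; linear_combination (X ^ 2 - X) * hI
  have h2 : (C (-Complex.I) * X - C Complex.I) * (C (-Complex.I) * X + 1) =
      -((X + 1) * (X + C Complex.I) : ℂ[X]) := by
    rw [C_neg]; linear_combination (X ^ 2 + X) * hI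
  have h : cayleyPoly n c = P - P.comp (C (-Complex.I) * X) := by
    simp only [cayleyPoly, hP, mul_comp, sub_comp, add_comp, pow_comp, Polynomial.sum_comp, C_comp,
      X_comp, one_comp, h1, h2]
    rw [← mul_sub, ← Finset.sum_sub_distrib]
    congr 1
    refine Finset.sum_congr rfl fun l hl => ?_
    rw [← mul_sub, neg_pow _ (n + 1 + (l + 1)), neg_pow _ (n + 1 - (l + 1))]
    have hs : (-1 : ℂ[X]) ^ (n + 1 + (l + 1)) * (-1) ^ (n + 1 - (l + 1)) = 1 := by
      have := Finset.mem_range.mp hl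
      rw [← pow_add, Even.neg_one_pow ⟨n + 1, by omega⟩]
    congr 1
    simp only [mul_pow]
    linear_combination (((X - C Complex.I) ^ (n + 1 + (l + 1)) * (X - 1) ^ (n + 1 + (l + 1))) *
      ((X + 1) ^ (n + 1 - (l + 1)) * (X + C Complex.I) ^ (n + 1 - (l + 1)))) * hs
  rw [h, coeff_sub, comp_C_mul_X_coeff, pow_mul,
    show (-Complex.I) ^ 4 = 1 by rw [neg_pow, Complex.I_pow_four]; norm_num, one_pow, mul_one,
    sub_self]

lemma sum_range_four_mul (F : ℕ → ℂ) (N : ℕ) : ∑ m ∈ Finset.range (4 * N), F m =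
    ∑ l ∈ Finset.range N, (F (4 * l) + F (4 * l + 1) + F (4 * l + 2) + F (4 * l + 3)) := by
  induction N with
  | zero => simp
  | succ N ih =>
    rw [Finset.sum_range_succ, ← ih, show 4 * (N + 1) = 4 * N + 1 + 1 + 1 + 1 by ring]
    simp only [Finset.sum_range_succ]
    ring

open Polynomial in
lemma sum_coeff_four_mul_add_one (f : ℂ[X]) (N : ℕ) (hf : ∀ m, 4 * N ≤ m → f.coeff m = 0) :
    4 * ∑ l ∈ Finset.range N, f.coeff (4 * l + 1) =
      f.eval 1 - Complex.I * f.eval Complex.I - f.eval (-1) +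
        Complex.I * f.eval (-Complex.I) := by
  have heval : ∀ u, f.eval u = ∑ m ∈ Finset.range (4 * N), f.coeff m * u ^ m := by
    intro u
    rw [Polynomial.eval_eq_sum, Polynomial.sum_def]
    refine Finset.sum_subset (fun m hm => ?_) fun m _ hm => by
      rw [notMem_support_iff.mp hm, zero_mul]
    rw [Finset.mem_range]
    by_contra hlt
    exact (mem_support_iff.mp hm) (hf m (not_lt.mp hlt))
  simp only [heval, sum_range_four_mul, Finset.mul_sum]
  rw [← Finset.sum_sub_distrib, ← Finset.sum_sub_distrib, ← Finset.sum_add_distrib]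
  refine Finset.sum_congr rfl fun l _ => ?_
  have e : ∀ u : ℂ, u ^ 4 = 1 → u ^ (4 * l) = 1 := fun u hu => by rw [pow_mul, hu, one_pow]
  have e1 : (-Complex.I) ^ 4 = 1 := by rw [neg_pow, Complex.I_pow_four]; norm_num
  simp only [pow_add, e _ e1, e _ Complex.I_pow_four, e (-1) (by norm_num), one_pow, pow_one,
    one_mul, mul_one]
  have h3 : Complex.I ^ 3 = -Complex.I := Complex.I_pow_three
  have h3' : (-Complex.I) ^ 3 = Complex.I := by linear_combination -h3
  have h2' : (-Complex.I) ^ 2 = -1 := by linear_combination Complex.I_sq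
  rw [h3, h3', h2', Complex.I_sq]
  linear_combination (2 * f.coeff (4 * l + 1) - 2 * f.coeff (4 * l + 3)) * Complex.I_sq

lemma neg_I_pow_sub_I_pow (N : ℕ) :
    (-Complex.I) ^ N * (1 - Complex.I) - Complex.I ^ N * (1 + Complex.I) =
      -2 * Complex.I * (-1) ^ (N / 2) := by
  rcases Nat.even_or_odd' N with ⟨m, rfl | rfl⟩
  · rw [Nat.mul_div_cancel_left m two_pos, pow_mul, pow_mul, neg_sq, Complex.I_sq]
    ring
  · rw [show (2 * m + 1) / 2 = m by omega, pow_succ, pow_succ, pow_mul, pow_mul, neg_sq,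
      Complex.I_sq]
    ring

lemma sum_coeff_cayleyPoly (n : ℕ) (c : ℕ → ℂ)
    (hf : ∀ m, 4 * (n + 1) ≤ m → (cayleyPoly n c).coeff m = 0) :
    2 * ∑ l ∈ Finset.range (n + 1), (cayleyPoly n c).coeff (4 * l + 1) =
      -Complex.I * (-1) ^ ((n + 1) / 2) * 16 ^ (n + 1) * c n := by
  have h := sum_coeff_four_mul_add_one _ _ hf
  have v1 : (cayleyPoly n c).eval 1 = 0 := by
    simp [cayleyPoly, Polynomial.eval_finsetSum]
  have hI : Complex.I ^ 2 = -1 := Complex.I_sq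
  have a1 : (Complex.I - 1) ^ 2 = -2 * Complex.I := by linear_combination hI
  have a2 : (-Complex.I - 1) ^ 2 = 2 * Complex.I := by linear_combination hI
  have hdouble : ∀ u : ℂ, u ^ (n + 1 + (n + 1)) = (u ^ 2) ^ (n + 1) := fun u => by
    rw [← pow_mul]; congr 1; ring
  have hzero : ∀ l ∈ Finset.range n, (0 : ℂ) ^ (n + 1 - (l + 1)) = 0 ∧
      (0 : ℂ) ^ (n + 1 + (l + 1)) = 0 := fun l hl => by
    have := Finset.mem_range.mp hl
    exact ⟨zero_pow (by omega), zero_pow (by omega)⟩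
  have h0 : (0 : ℂ) ^ (n + 1 + (n + 1)) = 0 := zero_pow (by omega)
  have v2 : (cayleyPoly n c).eval Complex.I = 16 ^ (n + 1) * (-Complex.I) ^ (n + 1) * c n := by
    simp only [cayleyPoly, Polynomial.eval_finsetSum, Polynomial.eval_mul, Polynomial.eval_C,
      Polynomial.eval_sub, Polynomial.eval_add, Polynomial.eval_pow, Polynomial.eval_X,
      Polynomial.eval_one, sub_self]
    rw [Finset.sum_range_succ, Finset.sum_eq_zero fun l hl => by
      rw [(hzero l hl).1, (hzero l hl).2]; ring, zero_add, h0, Nat.sub_self, hdouble, hdouble, a1,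
      show (Complex.I + Complex.I) ^ 2 = -4 by linear_combination 4 * hI,
      show (16 : ℂ) = 2 * (-1) * (-2) * 4 by norm_num]
    simp only [mul_pow, neg_pow Complex.I, neg_pow (2 : ℂ), neg_pow (4 : ℂ)]
    ring
  have v3 : (cayleyPoly n c).eval (-Complex.I) = -(16 ^ (n + 1) * Complex.I ^ (n + 1) * c n) := by
    simp only [cayleyPoly, Polynomial.eval_finsetSum, Polynomial.eval_mul, Polynomial.eval_C,
      Polynomial.eval_sub, Polynomial.eval_add, Polynomial.eval_pow, Polynomial.eval_X,
      Polynomial.eval_one, neg_add_cancel]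
    rw [Finset.sum_range_succ, Finset.sum_eq_zero fun l hl => by
      rw [(hzero l hl).1, (hzero l hl).2]; ring, zero_add, h0, Nat.sub_self, hdouble, hdouble, a2,
      show (-Complex.I - Complex.I) ^ 2 = -4 by linear_combination 4 * hI,
      show (16 : ℂ) = 2 * (-1) * 2 * (-4) by norm_num]
    simp only [mul_pow]
    ring
  have v4 : (cayleyPoly n c).eval (-1) =
      16 ^ (n + 1) * (Complex.I ^ (n + 1) - (-Complex.I) ^ (n + 1)) * c n := by
    simp only [cayleyPoly, Polynomial.eval_finsetSum, Polynomial.eval_mul, Polynomial.eval_C,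
      Polynomial.eval_sub, Polynomial.eval_add, Polynomial.eval_pow, Polynomial.eval_X,
      Polynomial.eval_one, neg_add_cancel]
    rw [Finset.sum_range_succ, Finset.sum_eq_zero fun l hl => by
      rw [(hzero l hl).1]; ring, zero_add, Nat.sub_self, hdouble, hdouble, hdouble,
      show (-1 + Complex.I) ^ 2 = -2 * Complex.I by linear_combination hI,
      show (-1 - Complex.I) ^ 2 = 2 * Complex.I by linear_combination hI,
      show (-1 - 1 : ℂ) ^ 2 = 4 by norm_num,
      show (16 : ℂ) = 2 * 2 * 4 by norm_num]
    simp only [mul_pow, neg_mul, neg_pow (2 * Complex.I), neg_pow Complex.I]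
    have hs : (-1 : ℂ) ^ (n + 1) * (-1) ^ (n + 1) = 1 := by rw [← mul_pow]; norm_num
    linear_combination (c n * 2 ^ (n + 1) * 4 ^ (n + 1) * 2 ^ (n + 1) * Complex.I ^ (n + 1)) * hs
  rw [v1, v2, v3, v4] at h
  linear_combination h / 2 + 16 ^ (n + 1) * c n / 2 * neg_I_pow_sub_I_pow (n + 1)

open Polynomial in
lemma natDegree_delannoyPoly_le {N k : ℕ} (hk : k ≤ N) : (delannoyPoly N k).natDegree ≤ 3 * N := by
  have h1 : ∀ m, ((1 + X : ℂ[X]) ^ m).natDegree ≤ m := fun m => by compute_degree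
  have h2 : ∀ m, ((1 - X : ℂ[X]) ^ m).natDegree ≤ m := fun m => by compute_degree
  unfold delannoyPoly
  refine natDegree_mul_le.trans ?_
  have e1 : ((1 + X : ℂ[X]) ^ (N + k) * (1 - X) ^ (N - k)).natDegree ≤ 2 * N :=
    natDegree_mul_le.trans ((add_le_add (h1 _) (h2 _)).trans (by omega))
  have e2 : ((-1) ^ k * ((1 - X : ℂ[X]) ^ (N + k) * (1 + X) ^ (N - k))).natDegree ≤ 2 * N := by
    rw [show ((-1) ^ k : ℂ[X]) = C ((-1) ^ k) by simp]
    exact (natDegree_C_mul_le _ _).trans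
      (natDegree_mul_le.trans ((add_le_add (h2 _) (h1 _)).trans (by omega)))
  have e3 := (natDegree_sub_le_of_le e1 e2)
  rw [max_self] at e3
  rw [natDegree_X_pow]
  omega

open PowerSeries in
lemma coeff_sub_evalNegHom (F : ℂ⟦X⟧) (m : ℕ) :
    coeff m (F - evalNegHom F) = (1 - (-1) ^ m) * coeff m F := by
  rw [map_sub, evalNegHom, coeff_rescale]
  ring

open Polynomial in
/-- If `c` is orthogonal to the first `n` odd rows, the corresponding combination of the
`delannoyPoly` vanishes to order `2n + 1` at `0`. -/
lemma exists_sum_delannoyPoly_eq (n : ℕ) (c : ℕ → ℂ) (h : ℂ)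
    (hc : ∀ i < n, ∑ l ∈ Finset.range (n + 1), delannoyCoeff (2 * i) l * c l = 0)
    (hn : ∑ l ∈ Finset.range (n + 1), delannoyCoeff (2 * n) l * c l = h) :
    ∃ q : ℂ[X], ∑ l ∈ Finset.range (n + 1), C (c l) * delannoyPoly (n + 1) (l + 1) =
      X ^ (2 * n + 1) * q ∧ q.coeff 0 = 2 * h ∧ q.natDegree ≤ n + 2 := by
  set g := ∑ l ∈ Finset.range (n + 1), C (c l) * delannoyPoly (n + 1) (l + 1) with hg
  set F : PowerSeries ℂ :=
    ∑ l ∈ Finset.range (n + 1), PowerSeries.C (c l) * delannoySeries ^ (l + 1) with hF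
  have hgF : (g : PowerSeries ℂ) =
      (1 - PowerSeries.X ^ 2) ^ (n + 1) * (F - PowerSeries.evalNegHom F) := by
    rw [← Polynomial.coeToPowerSeries.ringHom_apply, hg, map_sum, hF, map_sum,
      ← Finset.sum_sub_distrib, Finset.mul_sum]
    refine Finset.sum_congr rfl fun l hl => ?_
    rw [map_mul, map_mul, Polynomial.coeToPowerSeries.ringHom_apply,
      Polynomial.coeToPowerSeries.ringHom_apply,
      coe_delannoyPoly (by have := Finset.mem_range.mp hl; omega), Polynomial.coe_C]
    have hC : PowerSeries.evalNegHom (PowerSeries.C (c l)) = PowerSeries.C (c l) := by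
      ext m
      rw [PowerSeries.evalNegHom, PowerSeries.coeff_rescale, PowerSeries.coeff_C]
      split_ifs with hm <;> simp [hm]
    rw [hC]
    ring
  have hFc : ∀ i, PowerSeries.coeff (2 * i + 1) F =
      ∑ l ∈ Finset.range (n + 1), delannoyCoeff (2 * i) l * c l := fun i => by
    rw [hF, map_sum]
    exact Finset.sum_congr rfl fun l _ => by rw [PowerSeries.coeff_C_mul, mul_comm]; rfl
  have hdvd : (PowerSeries.X : PowerSeries ℂ) ^ (2 * n + 1) ∣ F - PowerSeries.evalNegHom F := by
    rw [PowerSeries.X_pow_dvd_iff]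
    intro m hm
    rw [coeff_sub_evalNegHom]
    rcases Nat.even_or_odd' m with ⟨i, rfl | rfl⟩
    · rw [pow_mul]; norm_num
    · rw [hFc, hc i (by omega), mul_zero]
  obtain ⟨R, hR⟩ := hdvd
  have hR0 : PowerSeries.constantCoeff R = 2 * h := by
    have h1 := PowerSeries.coeff_X_pow_mul R (2 * n + 1) 0
    rw [← hR, coeff_sub_evalNegHom, zero_add, hFc, hn, Odd.neg_one_pow ⟨n, rfl⟩] at h1
    rw [← PowerSeries.coeff_zero_eq_constantCoeff_apply, ← h1]
    ring
  have hgR : (g : PowerSeries ℂ) =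
      PowerSeries.X ^ (2 * n + 1) * ((1 - PowerSeries.X ^ 2) ^ (n + 1) * R) := by
    rw [hgF, hR]; ring
  have hgdvd : X ^ (2 * n + 1) ∣ g := by
    rw [Polynomial.X_pow_dvd_iff]
    intro m hm
    rw [← Polynomial.coeff_coe, hgR]
    exact PowerSeries.X_pow_dvd_iff.mp (Dvd.intro _ rfl) m hm
  obtain ⟨q, hq⟩ := hgdvd
  have hqg : ∀ m, q.coeff m = g.coeff (m + (2 * n + 1)) := fun m => by
    rw [hq, Polynomial.coeff_X_pow_mul]
  refine ⟨q, hq, ?_, ?_⟩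
  · rw [hqg, ← Polynomial.coeff_coe, hgR, PowerSeries.coeff_X_pow_mul,
      PowerSeries.coeff_zero_eq_constantCoeff_apply]
    simp [hR0]
  · have hdeg : g.natDegree ≤ 3 * (n + 1) := by
      refine natDegree_sum_le_of_forall_le _ _ fun l hl => (natDegree_C_mul_le _ _).trans
        (natDegree_delannoyPoly_le (by have := Finset.mem_range.mp hl; omega))
    rw [natDegree_le_iff_coeff_eq_zero]
    intro m hm
    rw [hqg]
    exact coeff_eq_zero_of_natDegree_lt (by omega)

open Polynomial in
lemma exists_cayleyPoly_eq (n : ℕ) (c : ℕ → ℂ) (h : ℂ)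
    (hc : ∀ i < n, ∑ l ∈ Finset.range (n + 1), delannoyCoeff (2 * i) l * c l = 0)
    (hn : ∑ l ∈ Finset.range (n + 1), delannoyCoeff (2 * n) l * c l = h) :
    ∃ B : ℂ[X], cayleyPoly n c = (X - 1) ^ (3 * n + 2) * B ∧ B.natDegree ≤ n + 2 ∧
      B.eval 1 = -Complex.I * (-1) ^ n * 2 ^ (n + 3) * h := by
  obtain ⟨q, hq, hq0, hqd⟩ := exists_sum_delannoyPoly_eq n c h hc hn
  refine ⟨C ((-Complex.I) ^ (2 * n + 1)) * ∑ s ∈ Finset.range (n + 3),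
    C (q.coeff s * (-Complex.I) ^ s) * ((X - 1) ^ s * (X + 1) ^ (n + 2 - s)), ?_, ?_, ?_⟩
  · apply eq_of_infinite_eval_eq
    refine Set.Infinite.mono ?_ (Set.finite_singleton (-1 : ℂ)).infinite_compl
    intro u hu
    have hu' : u + 1 ≠ 0 := fun h0 => hu (by
      rw [Set.mem_singleton_iff]; linear_combination h0)
    set w := -Complex.I * (u - 1) / (u + 1) with hw
    have hwu : w * (u + 1) = -Complex.I * (u - 1) := div_mul_cancel₀ _ hu'
    have hl : (cayleyPoly n c).eval u = (u - 1) ^ (n + 1) * (u + 1) ^ (3 * (n + 1)) *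
        (∑ l ∈ Finset.range (n + 1), C (c l) * delannoyPoly (n + 1) (l + 1)).eval w := by
      rw [eval_finsetSum, Finset.mul_sum]
      simp only [cayleyPoly, eval_mul, eval_C, eval_finsetSum, eval_sub, eval_add, eval_pow, eval_X,
        eval_one]
      rw [Finset.mul_sum]
      refine Finset.sum_congr rfl fun l hl => ?_
      have := eval_delannoyPoly_cayley (N := n + 1) (k := l + 1)
        (by have := Finset.mem_range.mp hl; omega) hwu
      linear_combination -c l * this
    have hqw : (u + 1) ^ (n + 2) * q.eval w = ∑ s ∈ Finset.range (n + 3),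
        q.coeff s * (-Complex.I) ^ s * ((u - 1) ^ s * (u + 1) ^ (n + 2 - s)) := by
      rw [eval_eq_sum_range' (n := n + 3) (by omega), Finset.mul_sum]
      refine Finset.sum_congr rfl fun s hs => ?_
      have hs' : s ≤ n + 2 := by have := Finset.mem_range.mp hs; omega
      have e := congrArg (· ^ s) hwu
      simp only [mul_pow] at e
      rw [← Nat.add_sub_cancel' hs', Nat.add_sub_cancel_left, pow_add]
      linear_combination q.coeff s * (u + 1) ^ (n + 2 - s) * e
    rw [Set.mem_ofPred_eq, hl, hq]
    simp only [eval_mul, eval_C, eval_finsetSum, eval_sub, eval_add, eval_pow, eval_X, eval_one]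
    rw [← hqw]
    have e := congrArg (· ^ (2 * n + 1)) hwu
    simp only [mul_pow] at e
    rw [show 3 * (n + 1) = 2 * n + 1 + (n + 2) by ring, pow_add (u + 1),
      show 3 * n + 2 = n + 1 + (2 * n + 1) by ring, pow_add (u - 1)]
    linear_combination (u - 1) ^ (n + 1) * (u + 1) ^ (n + 2) * q.eval w * e
  · refine (natDegree_C_mul_le _ _).trans (natDegree_sum_le_of_forall_le _ _ fun s hs =>
      (natDegree_C_mul_le _ _).trans (natDegree_mul_le.trans ?_))
    have e1 : ((X - 1 : ℂ[X]) ^ s).natDegree ≤ s := by compute_degree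
    have e2 : ((X + 1 : ℂ[X]) ^ (n + 2 - s)).natDegree ≤ n + 2 - s := by compute_degree
    have := Finset.mem_range.mp hs
    omega
  · simp only [eval_mul, eval_C, eval_finsetSum, eval_sub, eval_add, eval_pow, eval_X, eval_one,
      sub_self]
    rw [Finset.sum_eq_single_of_mem 0 (Finset.mem_range.mpr (by omega))
      (fun s _ hs => by rw [zero_pow hs]; ring), hq0, pow_succ, pow_mul, neg_sq, Complex.I_sq]
    norm_num
    ring

lemma det_recurrence_of_orthogonal (n : ℕ) (c : ℕ → ℂ) (h : ℂ)
    (hc : ∀ i < n, ∑ l ∈ Finset.range (n + 1), delannoyCoeff (2 * i) l * c l = 0)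
    (hn : ∑ l ∈ Finset.range (n + 1), delannoyCoeff (2 * n) l * c l = h) :
    h * ((3 * n + 2).factorial * ∏ j ∈ Finset.range n, ((n : ℂ) + 2 + 2 * j)) =
      2 ^ n * (4 * n + 2).factorial * c n := by
  obtain ⟨B, hB, hBd, hB1⟩ := exists_cayleyPoly_eq n c h hc hn
  have hf : ∀ m, 4 * (n + 1) ≤ m → (cayleyPoly n c).coeff m = 0 := by
    intro m hm
    rcases hm.eq_or_lt with rfl | hm
    · exact coeff_cayleyPoly_of_four_dvd n c (n + 1)
    · refine Polynomial.coeff_eq_zero_of_natDegree_lt (lt_of_le_of_lt ?_ hm)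
      have h1 : ((Polynomial.X - 1 : Polynomial ℂ) ^ (3 * n + 2)).natDegree ≤ 3 * n + 2 := by
        compute_degree
      rw [hB]
      exact Polynomial.natDegree_mul_le.trans (by omega)
  have hcoeff : ∀ l ∈ Finset.range (n + 1), (cayleyPoly n c).coeff (4 * l + 1) =
      (3 * n + 2).factorial * B.eval 1 * ((nodeWeight n l : ℝ) : ℂ) := by
    intro l hl
    have hl' : l ≤ n := Nat.lt_succ_iff.mp (Finset.mem_range.mp hl)
    have h1 := sum_coeff_mul_prod_sub (nodeSet n l) (cayleyPoly n c) B (4 * (n + 1))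
      (by rw [card_nodeSet n l hl', hB]) hf
    rw [card_nodeSet n l hl', Finset.sum_eq_single_of_mem (4 * l + 1)
      (Finset.mem_range.mpr (by omega))] at h1
    · have h2 := congrArg (fun x : ℝ => (x : ℂ)) (nodeWeight_mul_prod n l hl')
      push_cast at h1 h2
      rw [← h1]
      linear_combination -(cayleyPoly n c).coeff (4 * l + 1) * h2
    · intro m hm hml
      by_cases h4 : 4 ∣ m
      · obtain ⟨k, rfl⟩ := h4
        rw [coeff_cayleyPoly_of_four_dvd, zero_mul]
      · have hmem : m ∈ nodeSet n l := by
          have := Finset.mem_range.mp hm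
          simp only [nodeSet, Finset.mem_filter, Finset.mem_erase, Finset.mem_range]
          exact ⟨⟨hml, by omega⟩, h4⟩
        rw [Finset.prod_eq_zero hmem (sub_self _), mul_zero]
  have hsum := sum_coeff_cayleyPoly n c hf
  rw [Finset.sum_congr rfl hcoeff, ← Finset.mul_sum, ← Complex.ofReal_sum, sum_nodeWeight,
    hB1] at hsum
  push_cast at hsum
  have f0 : ((4 * n + 2).factorial : ℂ) ≠ 0 := by exact_mod_cast (4 * n + 2).factorial_ne_zero
  rw [mul_div_assoc', mul_div_assoc', div_eq_iff f0] at hsum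
  generalize (∏ j ∈ Finset.range n, ((n : ℂ) + 2 + 2 * j)) = Q at hsum ⊢
  have hs : (-1 : ℂ) ^ n * (-1) ^ (n / 2) * (-1) ^ ((n + 1) / 2) = 1 := by
    rw [← pow_add, ← pow_add, Even.neg_one_pow ⟨n, by omega⟩]
  have hs2 : (-1 : ℂ) ^ ((n + 1) / 2) * (-1) ^ ((n + 1) / 2) = 1 := by
    rw [← mul_pow]; norm_num
  have p4 : (4 : ℂ) ^ n = 2 ^ n * 2 ^ n := by rw [← mul_pow]; norm_num
  have p16 : (16 : ℂ) ^ n = 2 ^ n * 2 ^ n * 2 ^ n * 2 ^ n := by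
    rw [← mul_pow, ← mul_pow, ← mul_pow]; norm_num
  have hne : -Complex.I * (2 ^ n * 2 ^ n * 2 ^ n * 16) ≠ 0 :=
    mul_ne_zero (neg_ne_zero.mpr Complex.I_ne_zero) (by simp)
  apply mul_left_cancel₀ hne
  rw [pow_succ (16 : ℂ), p16, p4, pow_add (2 : ℂ) n 3] at hsum
  linear_combination (-1 : ℂ) ^ ((n + 1) / 2) * hsum +
    Complex.I * (2 ^ n * 2 ^ n * 2 ^ n * 16) * h * (3 * n + 2).factorial * Q * hs -
    Complex.I * (2 ^ n * 2 ^ n * 2 ^ n * 16) * 2 ^ n * (4 * n + 2).factorial * c n * hs2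

lemma det_delannoyMatrix_succ (n : ℕ) :
    (delannoyMatrix (n + 1)).det *
        ((3 * n + 2).factorial * ∏ j ∈ Finset.range n, ((n : ℂ) + 2 + 2 * j)) =
      2 ^ n * (4 * n + 2).factorial * (delannoyMatrix n).det := by
  set A := delannoyMatrix (n + 1) with hA
  set c : ℕ → ℂ := fun l => if hl : l < n + 1 then A.adjugate ⟨l, hl⟩ (Fin.last n) else 0 with hc
  have hmul : ∀ i : Fin (n + 1), ∑ l ∈ Finset.range (n + 1), delannoyCoeff (2 * i) l * c l =
      A.det * (1 : Matrix (Fin (n + 1)) (Fin (n + 1)) ℂ) i (Fin.last n) := by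
    intro i
    have h := congrFun (congrFun (Matrix.mul_adjugate A) i) (Fin.last n)
    rw [Matrix.smul_apply, smul_eq_mul, Matrix.mul_apply] at h
    rw [← h, Finset.sum_range]
    refine Finset.sum_congr rfl fun l _ => ?_
    simp only [hc, l.isLt, dite_true]
    rfl
  have hcn : c n = (delannoyMatrix n).det := by
    simp only [hc, Nat.lt_succ_self, dite_true]
    rw [show (⟨n, Nat.lt_succ_self n⟩ : Fin (n + 1)) = Fin.last n from rfl,
      Matrix.adjugate_fin_succ_eq_det_submatrix, Even.neg_one_pow ⟨_, rfl⟩, one_mul]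
    congr 1
    ext i j
    simp [hA, delannoyMatrix, Fin.succAbove_last]
  rw [← hcn]
  refine det_recurrence_of_orthogonal n c A.det (fun i hi => ?_) ?_
  · have := hmul ⟨i, by omega⟩
    rw [Matrix.one_apply_ne (by simp [Fin.ext_iff]; omega), mul_zero] at this
    exact this
  · have := hmul (Fin.last n)
    rw [Matrix.one_apply_eq, mul_one] at this
    exact this

lemma prod_mul_prod_eq_factorial (n m : ℕ) :
    (n.factorial : ℝ) * ((∏ k ∈ Finset.range m, ((n : ℝ) + 1 + 2 * k)) *
      ∏ k ∈ Finset.range m, ((n : ℝ) + 2 + 2 * k)) = (n + 2 * m).factorial := by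
  induction m with
  | zero => simp
  | succ m ih =>
    rw [show n + 2 * (m + 1) = n + 2 * m + 1 + 1 by ring, Nat.factorial_succ, Nat.factorial_succ,
      Finset.prod_range_succ, Finset.prod_range_succ]
    push_cast
    rw [← ih]
    ring

lemma Gamma_add_natCast_eq_prod {x : ℝ} (hx : 0 < x) (n : ℕ) :
    Real.Gamma (x + n) = (∏ k ∈ Finset.range n, (x + k)) * Real.Gamma x := by
  induction n with
  | zero => simp
  | succ n ih =>
    rw [Nat.cast_succ, ← add_assoc, Real.Gamma_add_one (by positivity), ih, Finset.prod_range_succ]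
    ring

lemma gamma_factor_eq (n : ℕ) :
    2 ^ (2 * n) * (Real.Gamma ((n + 1 : ℕ) : ℝ) * Real.Gamma (4 * ((n + 1 : ℕ) : ℝ) - 1) *
        Real.Gamma ((3 * ((n + 1 : ℕ) : ℝ) - 2) / 2) /
      (Real.Gamma (3 * ((n + 1 : ℕ) : ℝ)) * Real.Gamma (3 * ((n + 1 : ℕ) : ℝ) - 2) *
        Real.Gamma (((n + 1 : ℕ) : ℝ) / 2))) *
      ((3 * n + 2).factorial * ∏ j ∈ Finset.range n, ((n : ℝ) + 2 + 2 * j)) =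
      2 ^ n * (4 * n + 2).factorial := by
  have g1 : Real.Gamma ((n + 1 : ℕ) : ℝ) = n.factorial := by
    rw [Nat.cast_succ, Real.Gamma_nat_eq_factorial]
  have g2 : Real.Gamma (4 * ((n + 1 : ℕ) : ℝ) - 1) = (4 * n + 2).factorial := by
    rw [← Real.Gamma_nat_eq_factorial]; congr 1; push_cast; ring
  have g3 : Real.Gamma (3 * ((n + 1 : ℕ) : ℝ)) = (3 * n + 2).factorial := by
    rw [← Real.Gamma_nat_eq_factorial]; congr 1; push_cast; ring
  have g4 : Real.Gamma (3 * ((n + 1 : ℕ) : ℝ) - 2) = (n + 2 * n).factorial := by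
    rw [← Real.Gamma_nat_eq_factorial]; congr 1; push_cast; ring
  have g5 : Real.Gamma ((3 * ((n + 1 : ℕ) : ℝ) - 2) / 2) =
      (∏ k ∈ Finset.range n, (((n + 1 : ℕ) : ℝ) / 2 + k)) *
        Real.Gamma (((n + 1 : ℕ) : ℝ) / 2) := by
    rw [← Gamma_add_natCast_eq_prod (by positivity)]; congr 1; push_cast; ring
  have g6 : 2 ^ n * ∏ k ∈ Finset.range n, (((n + 1 : ℕ) : ℝ) / 2 + k) =
      ∏ k ∈ Finset.range n, ((n : ℝ) + 1 + 2 * k) := by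
    have h := Finset.prod_const (s := Finset.range n) (2 : ℝ)
    rw [Finset.card_range] at h
    rw [← h, ← Finset.prod_mul_distrib]
    exact Finset.prod_congr rfl fun k _ => by push_cast; ring
  have g7 := prod_mul_prod_eq_factorial n n
  rw [← g6] at g7
  rw [g1, g2, g3, g4, g5, show (2 : ℝ) ^ (2 * n) = 2 ^ n * 2 ^ n by ring, mul_div_assoc',
    div_mul_eq_mul_div, div_eq_iff (by positivity)]
  linear_combination (2 : ℝ) ^ n * (4 * n + 2).factorial * (3 * n + 2).factorial *
    Real.Gamma (((n + 1 : ℕ) : ℝ) / 2) * g7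

lemma det_delannoyMatrix (n : ℕ) :
    (delannoyMatrix n).det = ((2 ^ (n * (n - 1)) * ∏ i ∈ Finset.Icc 1 n,
      Real.Gamma (i : ℝ) * Real.Gamma (4 * (i : ℝ) - 1) * Real.Gamma ((3 * (i : ℝ) - 2) / 2)
        / (Real.Gamma (3 * (i : ℝ)) * Real.Gamma (3 * (i : ℝ) - 2) * Real.Gamma ((i : ℝ) / 2)) :
          ℝ) : ℂ) := by
  induction n with
  | zero => simp
  | succ n ih =>
    have h := det_delannoyMatrix_succ n
    have hg := congrArg (fun x : ℝ => (x : ℂ)) (gamma_factor_eq n)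
    have hne : (((3 * n + 2).factorial : ℂ) * ∏ j ∈ Finset.range n, ((n : ℂ) + 2 + 2 * j)) ≠ 0 := by
      refine mul_ne_zero (by exact_mod_cast (3 * n + 2).factorial_ne_zero)
        (Finset.prod_ne_zero_iff.mpr fun j _ => ?_)
      exact_mod_cast (by omega : n + 2 + 2 * j ≠ 0)
    apply mul_right_cancel₀ hne
    rw [h, ih, Finset.prod_Icc_succ_top (by omega), show (n + 1) * (n + 1 - 1) =
      n * (n - 1) + 2 * n by cases n <;> simp; ring, pow_add]
    have key : ∀ p q r s : ℝ, ((p * q * (r * s) : ℝ) : ℂ) = ((p * r : ℝ) : ℂ) * ((q * s : ℝ) : ℂ) :=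
      fun p q r s => by push_cast; ring
    rw [key]
    simp only [Complex.ofReal_mul _ (((3 * n + 2).factorial : ℝ) * _)] at hg
    have e : (((((3 * n + 2).factorial : ℝ) * ∏ j ∈ Finset.range n, ((n : ℝ) + 2 + 2 * j) : ℝ)) : ℂ)
        = ((3 * n + 2).factorial : ℂ) * ∏ j ∈ Finset.range n, ((n : ℂ) + 2 + 2 * j) := by
      push_cast; rfl
    rw [e] at hg
    rw [mul_assoc (Complex.ofReal _) (Complex.ofReal _), hg]
    push_cast
    ring

theorem stmt_8 (n : ℕ) (hn : 0 < n) :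
    (Matrix.of fun i j : Fin n =>
        (2 : ℝ) ^ ((j : ℕ) + 1) * binom (2 * ((i : ℕ) : ℤ) + ((j : ℕ) : ℤ) + 1) (2 * (i : ℕ) + 1)
          + binom (2 * ((i : ℕ) : ℤ) - ((j : ℕ) : ℤ) - 1) (2 * (i : ℕ) + 1)).det =
      2 ^ (n * (n - 1)) * ∏ i ∈ Finset.Icc 1 n,
          Real.Gamma (i : ℝ) * Real.Gamma (4 * (i : ℝ) - 1) * Real.Gamma ((3 * (i : ℝ) - 2) / 2)
            / (Real.Gamma (3 * (i : ℝ)) * Real.Gamma (3 * (i : ℝ) - 2) * Real.Gamma ((i : ℝ) / 2)) :=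
  Complex.ofReal_injective ((det_eq_det_delannoyMatrix n).trans (det_delannoyMatrix n))
end
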